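/- Let (R, m) be an analytically unramified Cohen-Macaulay local ring with infinite residue field, I an m-primary ideal with minimal reduction J. If S̄ ≠ 0 has multiplicity 1 (equivalently ē₁(I) = e₀(I) − λ(R/closure(I)) + 1), then S̄ is a free module of rank one over B = R(J)/m·R(J), a polynomial ring in d variables over the residue field; in particular depth S̄ = d. -/

import Mathlib

set_option synthInstance.maxHeartbeats 1000000
set_option maxHeartbeats 2000000

open IsLocalRing Polynomial Finset

variable {R : Type*}

/-- `x` is integral over the ideal `I`: it satisfies an equation
`x^n + a₁ x^{n-1} + ⋯ + aₙ = 0` with `aᵢ ∈ Iⁱ`. -/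
def IsIntegralOverIdeal [CommRing R] (I : Ideal R) (x : R) : Prop :=
  ∃ n : ℕ, 0 < n ∧ ∃ a : ℕ → R, (∀ i ∈ Finset.Icc 1 n, a i ∈ I ^ i) ∧
    x ^ n + ∑ i ∈ Finset.Icc 1 n, a i * x ^ (n - i) = 0

/-- The integral closure of an ideal (the set of integral elements is an ideal,
so the span equals it). -/
def intCl [CommRing R] (I : Ideal R) : Ideal R :=
  Ideal.span {x | IsIntegralOverIdeal I x}

/-- Length of a module, as the Krull dimension of its lattice of submodules. -/
noncomputable def mlen (R M : Type*) [CommRing R] [AddCommGroup M] [Module R M] :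
    WithBot ℕ∞ :=
  Order.krullDim (Submodule R M)

/-- The quotient module `N/(K ∩ N)` for ideals `N K`. -/
abbrev idealQuot [CommRing R] (N K : Ideal R) :=
  N ⧸ (Submodule.comap N.subtype K)

/-- Depth of `M` with respect to the ideal `J`: sup of lengths of `M`-regular
sequences contained in `J`. -/
noncomputable def rdepth (A : Type*) [CommRing A] (J : Ideal A)
    (M : Type*) [AddCommGroup M] [Module A M] : ℕ∞ :=
  sSup {n : ℕ∞ | ∃ rs : List A, (rs.length : ℕ∞) = n ∧ (∀ x ∈ rs, x ∈ J) ∧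
    RingTheory.Sequence.IsRegular M rs}

/-- A local ring is Cohen-Macaulay if its depth equals its Krull dimension. -/
def IsCMLocal (R : Type*) [CommRing R] [IsLocalRing R] : Prop :=
  (rdepth R (maximalIdeal R) R : WithBot ℕ∞) = ringKrullDim R

/-- A local ring is analytically unramified if its `m`-adic completion is reduced. -/
def AnalyticallyUnramified (R : Type*) [CommRing R] [IsLocalRing R] : Prop :=
  IsReduced (AdicCompletion (maximalIdeal R) R)

/-- An ideal is `m`-primary. -/
def IsMPrimary [CommRing R] [IsLocalRing R] (I : Ideal R) : Prop :=
  I.radical = maximalIdeal R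

/-- `J ⊆ I` is a minimal reduction: generated by `d = dim R` elements and
`I^{n+1} = J I^n` for `n ≫ 0`. -/
def IsMinimalReduction [CommRing R] (d : ℕ) (J I : Ideal R) : Prop :=
  J ≤ I ∧ (∃ s : Fin d → R, J = Ideal.span (Set.range s)) ∧
    ∃ N : ℕ, ∀ n ≥ N, I ^ (n + 1) = J * I ^ n

/-- Normal Hilbert data: `L n = λ(R/ intCl(I^{n+1}))` and for `n ≫ 0` this agrees
with the polynomial whose normalized coefficients are the `e i`. -/
def NormalHilbertData [CommRing R] (d : ℕ) (I : Ideal R) (L : ℕ → ℕ) (e : ℕ → ℤ) : Prop :=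
  (∀ n, mlen R (R ⧸ intCl (I ^ (n + 1))) = (L n : WithBot ℕ∞)) ∧
    ∃ N : ℕ, ∀ n ≥ N, (L n : ℤ) =
      ∑ i ∈ Finset.range (d + 1), (-1 : ℤ) ^ i * e i * ((n + d - i).choose (d - i))

/-- `t` is the Cohen-Macaulay type of the local ring `R` of dimension `d`:
`t = λ((Q : m)/Q)` for every ideal `Q` generated by a maximal regular sequence in `m`. -/
def CMTypeData (R : Type*) [CommRing R] [IsLocalRing R] (d t : ℕ) : Prop :=
  ∀ s : List R, s.length = d → (∀ x ∈ s, x ∈ maximalIdeal R) →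
    RingTheory.Sequence.IsRegular R s →
      mlen R (idealQuot ((Ideal.span {x | x ∈ s}).colon (maximalIdeal R))
        (Ideal.span {x | x ∈ s})) = (t : WithBot ℕ∞)

/-- The quotient module `N/(K ∩ N)` for submodules `N K` of a module. -/
abbrev submoduleQuot {A M : Type*} [CommRing A] [AddCommGroup M] [Module A M]
    (N K : Submodule A M) :=
  N ⧸ (Submodule.comap N.subtype K)


/-! ### Part A: forms -/
section PartA
variable {R : Type*} [CommRing R] {d : ℕ}

/-- The ideal generated by the entries of `s`. -/
def JJ (s : Fin d → R) : Ideal R := Ideal.span (Set.range s)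

/-- The extension of an ideal to the polynomial ring. -/
noncomputable abbrev PE (d : ℕ) (a : Ideal R) : Ideal (MvPolynomial (Fin d) R) :=
  Ideal.map MvPolynomial.C a

lemma mem_PE {a : Ideal R} {f : MvPolynomial (Fin d) R} :
    f ∈ PE d a ↔ ∀ μ, MvPolynomial.coeff μ f ∈ a := MvPolynomial.mem_map_C_iff

lemma monomial_mem_JJ_pow (s : Fin d → R) (μ : Fin d →₀ ℕ) :
    (μ.prod fun i e => s i ^ e) ∈ JJ s ^ μ.degree := by
  refine (Ideal.mem_span_pow_iff_exists_isHomogeneous s _).2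
    ⟨MvPolynomial.monomial μ 1, MvPolynomial.isHomogeneous_monomial _ rfl, ?_⟩
  simp [MvPolynomial.eval_monomial]

lemma mem_JJ_pow {s : Fin d → R} {n : ℕ} {c : R} :
    c ∈ JJ s ^ n ↔ ∃ f : MvPolynomial (Fin d) R, f.IsHomogeneous n ∧ MvPolynomial.eval s f = c :=
  Ideal.mem_span_pow_iff_exists_isHomogeneous s c

lemma eval_mem_JJ_pow_mul {s : Fin d → R} {n : ℕ} {a : Ideal R} {f : MvPolynomial (Fin d) R}
    (hf : f.IsHomogeneous n) (ha : f ∈ PE d a) : MvPolynomial.eval s f ∈ JJ s ^ n * a := by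
  rw [MvPolynomial.eval_eq]
  refine Ideal.sum_mem _ fun μ hμ => ?_
  rw [mul_comm (MvPolynomial.coeff μ f)]
  refine Ideal.mul_mem_mul ?_ (mem_PE.1 ha μ)
  have h1 : μ.degree = n := by
    have := hf (MvPolynomial.mem_support_iff.1 hμ)
    rw [← this, Finsupp.degree_eq_weight_one]
    rfl
  have := monomial_mem_JJ_pow s μ
  rw [h1] at this
  exact this

lemma mem_JJ_pow_mul {s : Fin d → R} {n : ℕ} {a : Ideal R} {c : R} :
    c ∈ JJ s ^ n * a ↔ ∃ f : MvPolynomial (Fin d) R, f.IsHomogeneous n ∧ f ∈ PE d a ∧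
      MvPolynomial.eval s f = c := by
  constructor
  · intro h
    refine Submodule.mul_induction_on h ?_ ?_
    · intro x hx y hy
      obtain ⟨g, hg, rfl⟩ := mem_JJ_pow.1 hx
      refine ⟨g * MvPolynomial.C y, ?_, ?_, by simp⟩
      · simpa using hg.mul (MvPolynomial.isHomogeneous_C _ y)
      · exact Ideal.mul_mem_left _ _ (Ideal.mem_map_of_mem _ hy)
    · rintro x y ⟨f, h1, h2, rfl⟩ ⟨g, h3, h4, rfl⟩
      exact ⟨f + g, h1.add h3, Ideal.add_mem _ h2 h4, by simp⟩
  · rintro ⟨f, h1, h2, rfl⟩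
    exact eval_mem_JJ_pow_mul h1 h2

/-- decomposition of polynomials with coefficients in `b + (x)` -/
lemma exists_decomp {b : Ideal R} {x : R} {n : ℕ} {h : MvPolynomial (Fin d) R}
    (hn : h.IsHomogeneous n) (hh : h ∈ PE d (b ⊔ Ideal.span {x})) :
    ∃ g : MvPolynomial (Fin d) R, g.IsHomogeneous n ∧ h - MvPolynomial.C x * g ∈ PE d b := by
  have key : ∀ h : MvPolynomial (Fin d) R, h ∈ PE d (b ⊔ Ideal.span {x}) →
      ∃ g : MvPolynomial (Fin d) R, h - MvPolynomial.C x * g ∈ PE d b := by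
    intro h hh
    rw [PE, Ideal.map_sup, Ideal.map_span, Set.image_singleton] at hh
    obtain ⟨u, hu, v, hv, rfl⟩ := Submodule.mem_sup.1 hh
    obtain ⟨g, rfl⟩ := Ideal.mem_span_singleton'.1 hv
    exact ⟨g, by convert hu using 1; ring⟩
  obtain ⟨g, hg⟩ := key h hh
  refine ⟨MvPolynomial.homogeneousComponent n g, MvPolynomial.homogeneousComponent_isHomogeneous n g, ?_⟩
  rw [mem_PE] at hg ⊢
  intro μ
  have := hg μ
  rw [MvPolynomial.coeff_sub, MvPolynomial.coeff_C_mul] at this ⊢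
  rw [MvPolynomial.coeff_homogeneousComponent]
  split_ifs with hd
  · exact this
  · have : MvPolynomial.coeff μ h = 0 := hn.coeff_eq_zero hd
    simp [this]

end PartA

/-! ### Part B: regular sequences are quasi-regular -/
section PartB
variable {R : Type*} [CommRing R]

/-- elementary form of weak regularity -/
def WReg {d : ℕ} (s : Fin d → R) : Prop :=
  ∀ i : Fin d, ∀ z : R, s i * z ∈ Ideal.span (s '' {j | j < i}) →
    z ∈ Ideal.span (s '' {j | j < i})

/-- quasi-regularity -/
def QReg {d : ℕ} (s : Fin d → R) : Prop :=
  ∀ (n : ℕ) (f : MvPolynomial (Fin d) R), f.IsHomogeneous n → MvPolynomial.eval s f = 0 →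
    f ∈ PE d (JJ s)

lemma qreg_aux {d : ℕ} {s : Fin d → R} {n : ℕ}
    (hq : ∀ (f : MvPolynomial (Fin d) R), f.IsHomogeneous n → MvPolynomial.eval s f = 0 →
    f ∈ PE d (JJ s)) (f : MvPolynomial (Fin d) R) (hf : f.IsHomogeneous n) (a : Ideal R)
    (ha : JJ s ≤ a) (h : MvPolynomial.eval s f ∈ JJ s ^ n * a) : f ∈ PE d a := by
  obtain ⟨g, hg1, hg2, hg3⟩ := mem_JJ_pow_mul.1 h
  have h1 := hq (f - g) (hf.sub hg1) (by simp [hg3])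
  have := Ideal.add_mem _ (Ideal.map_mono ha h1) hg2
  simpa using this

lemma exists_split_last {d n : ℕ} (F : MvPolynomial (Fin (d+1)) R) (hF : F.IsHomogeneous (n+1)) :
    ∃ (G : MvPolynomial (Fin d) R) (H : MvPolynomial (Fin (d+1)) R), G.IsHomogeneous (n+1) ∧
      H.IsHomogeneous n ∧ F = MvPolynomial.rename Fin.castSucc G +
        MvPolynomial.X (Fin.last d) * H := by
  classical
  have key : ∀ (μ : Fin (d+1) →₀ ℕ) (c : R), μ.degree = n + 1 →
    ∃ (G : MvPolynomial (Fin d) R) (H : MvPolynomial (Fin (d+1)) R), G.IsHomogeneous (n+1) ∧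
      H.IsHomogeneous n ∧ MvPolynomial.monomial μ c = MvPolynomial.rename Fin.castSucc G +
        MvPolynomial.X (Fin.last d) * H := by
    intro μ c hμ
    by_cases h0 : μ (Fin.last d) = 0
    · have hx : ∃ ν : Fin d →₀ ℕ, ν.mapDomain Fin.castSucc = μ := by
        refine ⟨Finsupp.comapDomain Fin.castSucc μ (Fin.castSucc_injective d).injOn, ?_⟩
        refine Finsupp.mapDomain_comapDomain _ (Fin.castSucc_injective d) μ ?_
        intro i hi
        induction i using Fin.lastCases with
        | last => simp [h0] at hi
        | cast i => exact ⟨i, rfl⟩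
      obtain ⟨ν, rfl⟩ := hx
      refine ⟨MvPolynomial.monomial ν c, 0, ?_, MvPolynomial.isHomogeneous_zero _ _ _, ?_⟩
      · refine MvPolynomial.isHomogeneous_monomial _ ?_
        rw [← hμ]
        simp [Finsupp.degree_eq_sum, Fin.sum_univ_castSucc, h0,
          Finsupp.mapDomain_apply (Fin.castSucc_injective d)]
      · simp [MvPolynomial.rename_monomial]
    · refine ⟨0, MvPolynomial.monomial (μ - Finsupp.single (Fin.last d) 1) c,
        MvPolynomial.isHomogeneous_zero _ _ _, ?_, ?_⟩
      · refine MvPolynomial.isHomogeneous_monomial _ ?_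
        have h2 : Finsupp.single (Fin.last d) 1 ≤ μ := by
          rw [Finsupp.single_le_iff]; omega
        have h3 := congrArg Finsupp.degree (tsub_add_cancel_of_le h2)
        rw [map_add, hμ, Finsupp.degree_single] at h3
        omega
      · have h2 : Finsupp.single (Fin.last d) 1 ≤ μ := by
          rw [Finsupp.single_le_iff]; omega
        rw [map_zero, zero_add, MvPolynomial.X, MvPolynomial.monomial_mul, one_mul,
          add_tsub_cancel_of_le h2]
  have hsum := F.as_sum
  have hdeg : ∀ μ ∈ F.support, μ.degree = n + 1 := by
    intro μ hμ
    have := hF (MvPolynomial.mem_support_iff.1 hμ)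
    rw [← this, Finsupp.degree_eq_weight_one]; rfl
  choose! G H h1 h2 h3 using fun μ => key μ (MvPolynomial.coeff μ F)
  refine ⟨∑ μ ∈ F.support, G μ, ∑ μ ∈ F.support, H μ, ?_, ?_, ?_⟩
  · exact MvPolynomial.IsHomogeneous.sum _ _ _ fun μ hμ => h1 μ (hdeg μ hμ)
  · exact MvPolynomial.IsHomogeneous.sum _ _ _ fun μ hμ => h2 μ (hdeg μ hμ)
  · rw [map_sum, Finset.mul_sum, ← Finset.sum_add_distrib]
    conv_lhs => rw [hsum]
    exact Finset.sum_congr rfl fun μ hμ => h3 μ (hdeg μ hμ)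

lemma qreg_of_wreg : ∀ {d : ℕ} (s : Fin d → R), WReg s → QReg s := by
  intro d
  induction d with
  | zero =>
    intro s _ n f hf h0
    have : f = MvPolynomial.C (MvPolynomial.eval s f) := by
      obtain ⟨r, rfl⟩ := MvPolynomial.C_surjective (Fin 0) f
      simp
    rw [this, h0]; simp
  | succ d ih =>
    intro s hs
    set s' : Fin d → R := s ∘ Fin.castSucc with hs'
    have himg : ∀ i : Fin d, s '' {j | j < i.castSucc} = s' '' {j | j < i} := by
      intro i
      ext x
      constructor
      · rintro ⟨j, hj, rfl⟩
        induction j using Fin.lastCases with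
        | last => exact absurd hj (by simp [Fin.le_last])
        | cast j => exact ⟨j, by simpa using hj, rfl⟩
      · rintro ⟨j, hj, rfl⟩
        exact ⟨j.castSucc, by simpa using hj, rfl⟩
    have hlast : s '' {j | j < Fin.last d} = Set.range s' := by
      ext x
      constructor
      · rintro ⟨j, hj, rfl⟩
        induction j using Fin.lastCases with
        | last => simp at hj
        | cast j => exact ⟨j, rfl⟩
      · rintro ⟨j, rfl⟩
        exact ⟨j.castSucc, by simp [Fin.castSucc_lt_last], rfl⟩
    have hw' : WReg s' := by
      intro i z hz
      have := hs i.castSucc z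
      rw [himg] at this
      exact this hz
    have hq' := ih s' hw'
    have hcol1 : ∀ z, s (Fin.last d) * z ∈ JJ s' → z ∈ JJ s' := by
      intro z hz
      have := hs (Fin.last d) z
      rw [hlast] at this
      exact this hz
    have hcol : ∀ n z, s (Fin.last d) * z ∈ JJ s' ^ n → z ∈ JJ s' ^ n := by
      intro n
      induction n with
      | zero => simp
      | succ n ihn =>
        intro z hz
        obtain ⟨h, hh, rfl⟩ := mem_JJ_pow.1 (ihn z (Ideal.pow_le_pow_right (Nat.le_succ n) hz))
        rw [pow_succ] at hz ⊢
        refine eval_mem_JJ_pow_mul hh ?_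
        have := qreg_aux (hq' n) (MvPolynomial.C (s (Fin.last d)) * h)
          (by simpa using (MvPolynomial.isHomogeneous_C _ _).mul hh) (JJ s') le_rfl
          (by simpa using hz)
        rw [mem_PE] at this ⊢
        intro μ
        apply hcol1
        simpa using this μ
    have hJle : JJ s' ≤ JJ s := by
      refine Ideal.span_mono ?_
      rintro _ ⟨j, rfl⟩; exact ⟨_, rfl⟩
    have hlastmem : s (Fin.last d) ∈ JJ s := Ideal.subset_span ⟨_, rfl⟩
    intro n
    induction n with
    | zero =>
      intro f hf h0
      obtain ⟨r, rfl⟩ : ∃ r, f = MvPolynomial.C r :=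
        ⟨_, (MvPolynomial.totalDegree_eq_zero_iff_eq_C).1
          (Nat.le_zero.1 hf.totalDegree_le)⟩
      have : r = 0 := by simpa using h0
      simp [this]
    | succ n ihn =>
      intro F hF h0
      obtain ⟨G, H, hG, hH, rfl⟩ := exists_split_last F hF
      have hev : MvPolynomial.eval s' G + s (Fin.last d) * MvPolynomial.eval s H = 0 := by
        rw [map_add, MvPolynomial.eval_rename, map_mul, MvPolynomial.eval_X] at h0
        exact h0
      have hGm : MvPolynomial.eval s' G ∈ JJ s' ^ (n+1) := mem_JJ_pow.2 ⟨G, hG, rfl⟩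
      have hHm : MvPolynomial.eval s H ∈ JJ s' ^ (n+1) := by
        apply hcol
        rw [eq_neg_of_add_eq_zero_right hev]
        exact neg_mem hGm
      obtain ⟨h, hh1, hh2⟩ := mem_JJ_pow.1 hHm
      have h1 : H ∈ PE (d+1) (JJ s) := by
        refine qreg_aux ihn H hH (JJ s) le_rfl ?_
        rw [← pow_succ]
        exact Ideal.pow_right_mono hJle _ hHm
      have h2 : G + MvPolynomial.C (s (Fin.last d)) * h ∈ PE d (JJ s') := by
        refine hq' (n+1) _ (hG.add ?_) ?_
        · simpa using (MvPolynomial.isHomogeneous_C _ _).mul hh1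
        · simpa [hh2] using hev
      have h3 : G ∈ PE d (JJ s) := by
        rw [mem_PE] at h2 ⊢
        intro μ
        have := Ideal.sub_mem _ (hJle (h2 μ))
          (Ideal.mul_mem_right (MvPolynomial.coeff μ h) _ hlastmem)
        simpa using this
      refine Ideal.add_mem _ ?_ (Ideal.mul_mem_left _ _ h1)
      have := Ideal.mem_map_of_mem (MvPolynomial.rename Fin.castSucc : MvPolynomial (Fin d) R →ₐ[R] MvPolynomial (Fin (d+1)) R).toRingHom h3
      rw [PE, Ideal.map_map] at this
      have hc : ((MvPolynomial.rename Fin.castSucc : MvPolynomial (Fin d) R →ₐ[R]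
          MvPolynomial (Fin (d+1)) R).toRingHom).comp MvPolynomial.C = MvPolynomial.C := by
        apply RingHom.ext
        intro x
        exact MvPolynomial.rename_C _ x
      rw [hc] at this
      exact this

end PartB

/-! ### Part C: parameters of a Cohen-Macaulay local ring form a regular sequence -/
section PartC
open CategoryTheory Abelian Limits RingTheory.Sequence
open scoped Pointwise
universe u

lemma assDim {R : Type u} [CommRing R] [IsLocalRing R] [IsNoetherianRing R] :
    ∀ (rs : List R) (M : Type u) [AddCommGroup M] [Module R M] [Module.Finite R M]
      (_ : ∀ r ∈ rs, r ∈ maximalIdeal R) (_ : IsRegular M rs) (p : Ideal R)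
      (_ : IsAssociatedPrime p M), (rs.length : WithBot ℕ∞) ≤ ringKrullDim (R ⧸ p) := by
  intro rs
  induction rs with
  | nil =>
    intro M _ _ _ _ _ p hp
    haveI := hp.isPrime
    simpa using ringKrullDim_nonneg_of_nontrivial
  | cons x rs ih =>
    intro M _ _ _ hmem hreg p hp
    rw [isRegular_cons_iff] at hreg
    have hpp := hp.isPrime
    obtain ⟨_, z0, hz0⟩ := isAssociatedPrime_iff.1 hp
    have hz0ne : z0 ≠ 0 := by
      rintro rfl
      apply hpp.ne_top
      rw [hz0]; ext; simp [Submodule.mem_colon_singleton]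
    have hpz0 : ∀ r ∈ p, r • z0 = 0 := by
      intro r hr
      rw [hz0, Submodule.mem_colon_singleton] at hr
      simpa using hr
    have hxp : x ∉ p := by
      intro hx
      exact hz0ne (hreg.1 (by simp [hpz0 x hx]))
    let N : Submodule R M :=
      { carrier := {z | ∀ r ∈ p, r • z = 0}
        zero_mem' := by intro r _; simp
        add_mem' := by intro a b ha hb r hr; simp [ha r hr, hb r hr]
        smul_mem' := by intro c a ha r hr; rw [smul_comm, ha r hr, smul_zero] }
    have hN : ¬ N ≤ x • (⊤ : Submodule R M) := by
      intro hle
      have h1 : N ≤ maximalIdeal R • N := by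
        intro z hz
        obtain ⟨w, -, rfl⟩ := (Submodule.mem_smul_pointwise_iff_exists _ _ _).1 (hle hz)
        refine Submodule.smul_mem_smul (hmem x (by simp)) ?_
        intro r hr
        have := hz r hr
        rw [smul_comm] at this
        exact hreg.1 (by simpa using this)
      have h2 : N = ⊥ := Submodule.eq_bot_of_le_smul_of_le_jacobson_bot (maximalIdeal R) N
        (IsNoetherian.noetherian N) h1 (IsLocalRing.maximalIdeal_le_jacobson _)
      have : z0 ∈ N := hpz0
      rw [h2] at this
      exact hz0ne (by simpa using this)
    obtain ⟨z, hzN, hzx⟩ := SetLike.not_le_iff_exists.1 hN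
    obtain ⟨q, hq, hqz⟩ := exists_le_isAssociatedPrime_of_isNoetherianRing R
      (Submodule.Quotient.mk z : QuotSMulTop x M)
      (by rwa [Ne, Submodule.Quotient.mk_eq_zero])
    have hpq : p ≤ q := by
      intro r hr
      apply hqz
      rw [Submodule.mem_colon_singleton, ← Submodule.Quotient.mk_smul, hzN r hr]
      simp
    have hxq : x ∈ q := by
      apply hqz
      rw [Submodule.mem_colon_singleton, ← Submodule.Quotient.mk_smul]
      simp only [Submodule.mem_bot, Submodule.Quotient.mk_eq_zero]
      exact Submodule.smul_mem_pointwise_smul _ _ _ trivial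
    have h3 := ih (QuotSMulTop x M) (fun r hr => hmem r (by simp [hr])) hreg.2 q hq
    haveI := hpp
    have h4 := ringKrullDim_succ_le_of_surjective (Ideal.Quotient.factor hpq)
      (Ideal.Quotient.factor_surjective hpq) (r := Ideal.Quotient.mk p x)
      (mem_nonZeroDivisors_of_ne_zero (by rwa [Ne, Ideal.Quotient.eq_zero_iff_mem]))
      (by simpa [Ideal.Quotient.eq_zero_iff_mem] using hxq)
    refine le_trans ?_ h4
    simp only [List.length_cons, Nat.cast_add, Nat.cast_one]
    gcongr

lemma dim_quot_le {R : Type u} [CommRing R] [IsLocalRing R] [IsNoetherianRing R]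
    (p : Ideal R) [p.IsPrime] (l : List R) (hl : ∀ r ∈ l, r ∈ maximalIdeal R)
    (h : maximalIdeal R ≤ (p ⊔ Ideal.ofList l).radical) :
    ringKrullDim (R ⧸ p) ≤ l.length := by
  classical
  haveI : IsLocalRing (R ⧸ p) :=
    IsLocalRing.of_surjective' (Ideal.Quotient.mk p) Ideal.Quotient.mk_surjective
  let S : Finset (R ⧸ p) := (l.map (Ideal.Quotient.mk p)).toFinset
  have hloc : IsLocalHom (Ideal.Quotient.mk p) :=
    .of_surjective _ Ideal.Quotient.mk_surjective
  have hS : (S : Set (R ⧸ p)) ⊆ Ring.jacobson (R ⧸ p) := by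
    rw [IsLocalRing.ringJacobson_eq_maximalIdeal]
    intro y hy
    obtain ⟨r, hr, rfl⟩ : ∃ r ∈ l, Ideal.Quotient.mk p r = y := by
      simpa [S] using hy
    rw [SetLike.mem_coe, IsLocalRing.mem_maximalIdeal, mem_nonunits_iff]
    intro hu
    exact (IsLocalRing.mem_maximalIdeal r).1 (hl r hr) (hloc.map_nonunit r hu)
  have h1 := ringKrullDim_le_ringKrullDim_quotient_add_card S hS
  have h2 : Ring.KrullDimLE 0 ((R ⧸ p) ⧸ Ideal.span (S : Set (R ⧸ p))) := by
    rw [Ring.krullDimLE_zero_iff]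
    intro Q hQ
    let φ : R →+* ((R ⧸ p) ⧸ Ideal.span (S : Set (R ⧸ p))) :=
      (Ideal.Quotient.mk _).comp (Ideal.Quotient.mk p)
    have hφ : Function.Surjective φ :=
      Ideal.Quotient.mk_surjective.comp Ideal.Quotient.mk_surjective
    haveI : (Q.comap φ).IsPrime := hQ.comap φ
    have h3 : p ⊔ Ideal.ofList l ≤ Q.comap φ := by
      refine sup_le ?_ ?_
      · intro x hx
        have : φ x = 0 := by simp [φ, Ideal.Quotient.eq_zero_iff_mem.2 hx]
        simp [Ideal.mem_comap, this]
      · rw [Ideal.ofList, Ideal.span_le]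
        intro x hx
        have : φ x = 0 := by
          simp only [φ, RingHom.comp_apply, Ideal.Quotient.eq_zero_iff_mem]
          refine Ideal.subset_span ?_
          simp only [S, List.coe_toFinset, Set.mem_setOf_eq, List.mem_map]
          exact ⟨x, hx, rfl⟩
        simp [Ideal.mem_comap, this]
    have h4 : maximalIdeal R ≤ Q.comap φ :=
      h.trans ((Ideal.IsPrime.radical_le_iff inferInstance).2 h3)
    have h5 : (Q.comap φ).IsMaximal := by
      rw [← (IsLocalRing.maximalIdeal.isMaximal R).eq_of_le (Ideal.IsPrime.ne_top inferInstance) h4]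
      infer_instance
    have := Ideal.map_eq_top_or_isMaximal_of_surjective φ hφ h5
    rw [Ideal.map_comap_of_surjective φ hφ] at this
    exact this.resolve_left hQ.ne_top
  have h6 : ringKrullDim ((R ⧸ p) ⧸ Ideal.span (S : Set (R ⧸ p))) ≤ 0 := by
    simpa using Ring.krullDimLE_iff.1 h2
  refine h1.trans ?_
  calc _ ≤ (0 : WithBot ℕ∞) + (S.card : WithBot ℕ∞) := by gcongr
    _ ≤ _ := by
      rw [zero_add]
      have : S.card ≤ l.length := (List.toFinset_card_le _).trans (by simp)
      exact_mod_cast this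

lemma weaklyRegular_of_ext {R : Type u} [CommRing R] [IsLocalRing R] [IsNoetherianRing R] :
    ∀ (l : List R) (M : Type u) [AddCommGroup M] [Module R M] [Module.Finite R M]
      (_ : ∀ r ∈ l, r ∈ maximalIdeal R)
      (_ : ∀ i < l.length, Subsingleton
        (Ext (ModuleCat.of R (R ⧸ maximalIdeal R)) (ModuleCat.of R M) i))
      (_ : maximalIdeal R ≤ (Module.annihilator R M ⊔ Ideal.ofList l).radical),
      IsWeaklyRegular M l := by
  intro l
  induction l with
  | nil => intro M _ _ _ _ _ _; exact IsWeaklyRegular.nil R M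
  | cons x l ih =>
    intro M _ _ _ hmem hext hrad
    rw [isWeaklyRegular_cons_iff]
    have hx : IsSMulRegular M x := by
      by_cases hM : Subsingleton M
      · intro a b _; exact Subsingleton.elim _ _
      rw [not_subsingleton_iff_nontrivial] at hM
      have hlt : maximalIdeal R • (⊤ : Submodule R M) < ⊤ := by
        rw [lt_top_iff_ne_top]
        intro h
        have := Submodule.eq_bot_of_le_smul_of_le_jacobson_bot (maximalIdeal R) (⊤ : Submodule R M)
          Module.Finite.fg_top h.ge (IsLocalRing.maximalIdeal_le_jacobson _)
        exact top_ne_bot this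
      obtain ⟨rs, hlen, hrs, hreg⟩ := ModuleCat.exists_isRegular_of_exists_subsingleton_ext
        (maximalIdeal R) (l.length + 1) (ModuleCat.of R M) hlt
        (ModuleCat.of R (R ⧸ maximalIdeal R))
        (by
          rw [Module.support_eq_zeroLocus]
          congr 1
          show ((Module.annihilator R (R ⧸ maximalIdeal R) : Ideal R) : Set R) = _
          rw [Ideal.annihilator_quotient])
        (by intro i hi; exact hext i (by simpa using hi))
      by_contra hnr
      have : ∃ z : M, z ≠ 0 ∧ x • z = 0 := by
        by_contra hc
        push Not at hc
        apply hnr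
        intro a b hab
        have h0 : x • (a - b) = 0 := by
          rw [smul_sub]; exact sub_eq_zero.2 hab
        by_contra hne
        exact hc (a - b) (sub_ne_zero.2 hne) h0
      have hx : x ∈ ⋃ p ∈ associatedPrimes R M, (p : Set R) := by
        rw [biUnion_associatedPrimes_eq_zero_divisors]; exact this
      simp only [Set.mem_iUnion] at hx
      obtain ⟨p, hp, hxp⟩ := hx
      have hp' : IsAssociatedPrime p M := hp
      haveI := hp'.isPrime
      have h1 := assDim rs M hrs hreg p hp'
      have hann : Module.annihilator R M ≤ p := by
        have := hp'.annihilator_le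
        rwa [Submodule.annihilator_top] at this
      have h2 := dim_quot_le p l (fun r hr => hmem r (by simp [hr])) (hrad.trans (by
        apply Ideal.radical_mono
        refine sup_le (hann.trans le_sup_left) ?_
        rw [Ideal.ofList_cons]
        refine sup_le (le_trans ?_ le_sup_left) le_sup_right
        rw [Ideal.span_singleton_le_iff_mem]; exact hxp))
      have h3 := h1.trans h2
      rw [hlen] at h3
      have : l.length + 1 ≤ l.length := by exact_mod_cast h3
      omega
    refine ⟨hx, ih (QuotSMulTop x M) (fun r hr => hmem r (by simp [hr])) ?_ ?_⟩
    · intro i hi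
      have zero1 := AddCommGrpCat.isZero_of_iff_subsingleton.mpr (hext i (by simp; omega))
      have zero2 := AddCommGrpCat.isZero_of_iff_subsingleton.mpr (hext (i + 1) (by simp; omega))
      have hx' : IsSMulRegular (ModuleCat.of R M) x := hx
      exact AddCommGrpCat.subsingleton_of_isZero <| ShortComplex.Exact.isZero_of_both_zeros
        ((Ext.covariant_sequence_exact₃' (ModuleCat.of R (R ⧸ maximalIdeal R))
          hx'.smulShortComplex_shortExact) i (i + 1) rfl)
        (zero1.eq_zero_of_src _) (zero2.eq_zero_of_tgt _)
    · refine hrad.trans (Ideal.radical_mono ?_)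
      rw [Ideal.ofList_cons]
      refine sup_le (le_trans ?_ le_sup_left) (sup_le (le_trans ?_ le_sup_left) le_sup_right)
      · exact LinearMap.annihilator_le_of_surjective _ (Submodule.mkQ_surjective _)
      · rw [Ideal.span_singleton_le_iff_mem, Module.mem_annihilator]
        intro y
        obtain ⟨z, rfl⟩ := Submodule.mkQ_surjective _ y
        rw [← map_smul]
        simp only [Submodule.mkQ_apply, Submodule.Quotient.mk_eq_zero]
        exact Submodule.smul_mem_pointwise_smul _ _ _ trivial

lemma wreg_of_isWeaklyRegular {R : Type u} [CommRing R] {d : ℕ} (s : Fin d → R)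
    (h : IsWeaklyRegular R (List.ofFn s)) : WReg s := by
  intro i z hz
  have hset : Ideal.ofList ((List.ofFn s).take i) = Ideal.span (s '' {j | j < i}) := by
    rw [Ideal.ofList]
    congr 1
    ext x
    simp only [Set.mem_setOf_eq, Set.mem_image, List.mem_take_iff_getElem, List.getElem_ofFn,
      List.length_ofFn]
    constructor
    · rintro ⟨j, hj, rfl⟩
      exact ⟨⟨j, by omega⟩, by simpa [Fin.lt_def] using (by omega : j < (i : ℕ)), rfl⟩
    · rintro ⟨j, hj, rfl⟩
      exact ⟨j, by have := Fin.lt_def.1 hj; omega, rfl⟩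
  have h1 := h.regular_mod_prev i (by simp)
  rw [hset] at h1
  have h2 : (Ideal.span (s '' {j | j < i}) • ⊤ : Submodule R R) = Ideal.span (s '' {j | j < i}) := by
    simp
  rw [h2] at h1
  have h3 := h1 (a₁ := Submodule.Quotient.mk z) (a₂ := 0) (by
    simp only [smul_zero, ← Submodule.Quotient.mk_smul]
    rw [Submodule.Quotient.mk_eq_zero]
    simpa using hz)
  rwa [Submodule.Quotient.mk_eq_zero] at h3

lemma wreg_of_CM {R : Type u} [CommRing R] [IsLocalRing R] [IsNoetherianRing R] {d : ℕ}
    (hdim : ringKrullDim R = d) (hCM : IsCMLocal R) (s : Fin d → R)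
    (hs : ∀ i, s i ∈ maximalIdeal R) (hrad : maximalIdeal R ≤ (JJ s).radical) : WReg s := by
  apply wreg_of_isWeaklyRegular
  have h1 : rdepth R (maximalIdeal R) R = d := by
    have : (rdepth R (maximalIdeal R) R : WithBot ℕ∞) = ((d : ℕ∞) : WithBot ℕ∞) := by
      rw [hCM, hdim]; rfl
    exact_mod_cast this
  obtain ⟨rs, hlen, hmem, hreg⟩ : ∃ rs : List R, d ≤ rs.length ∧ (∀ x ∈ rs, x ∈ maximalIdeal R) ∧
      IsRegular R rs := by
    by_contra hc
    push Not at hc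
    rcases Nat.eq_zero_or_pos d with h0 | hpos
    · subst h0
      refine hc [] (by simp) (by simp) ?_
      exact ⟨IsWeaklyRegular.nil R R, by simp⟩
    · have : rdepth R (maximalIdeal R) R ≤ ((d - 1 : ℕ) : ℕ∞) := by
        apply sSup_le
        rintro _ ⟨rs, rfl, h2, h3⟩
        by_contra h4
        rw [not_le] at h4
        have h5 : d - 1 < rs.length := by exact_mod_cast h4
        exact hc rs (by omega) h2 h3
      rw [h1] at this
      have : d ≤ d - 1 := by exact_mod_cast this
      omega
  have hlt : maximalIdeal R • (⊤ : Submodule R (ModuleCat.of R R)) < ⊤ := by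
    rw [lt_top_iff_ne_top]
    intro h
    have h' : maximalIdeal R • (⊤ : Submodule R R) = ⊤ := h
    rw [smul_eq_mul, Ideal.mul_top] at h'
    exact Ideal.IsPrime.ne_top inferInstance h'
  have hext := ModuleCat.subsingleton_ext_of_exists_isRegular (maximalIdeal R)
    (ModuleCat.of R (R ⧸ maximalIdeal R)) (by
          rw [Module.support_eq_zeroLocus]
          show PrimeSpectrum.zeroLocus
            ((Module.annihilator R (R ⧸ maximalIdeal R) : Ideal R) : Set R) ⊆ _
          rw [Ideal.annihilator_quotient]) (ModuleCat.of R R) hlt rs hmem hreg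
  refine weaklyRegular_of_ext (List.ofFn s) R ?_ ?_ ?_
  · intro r hr
    obtain ⟨i, rfl⟩ := List.mem_ofFn.1 hr
    exact hs i
  · intro i hi
    exact hext i (by simp at hi; omega)
  · refine hrad.trans (Ideal.radical_mono (le_trans (le_of_eq ?_) le_sup_right))
    rw [JJ, Ideal.ofList]
    congr 1
    ext x
    simp [List.mem_ofFn]

end PartC

/-! ### Part D: `m`-primary ideals, lengths -/
section PartD
variable {R : Type*} [CommRing R] [IsLocalRing R]

/-- `b` contains a power of the maximal ideal -/
def MP (b : Ideal R) : Prop := ∃ N, maximalIdeal R ^ N ≤ b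

lemma MP.mono {a b : Ideal R} (h : MP a) (hab : a ≤ b) : MP b := by
  obtain ⟨N, hN⟩ := h; exact ⟨N, hN.trans hab⟩

lemma MP.mul {a b : Ideal R} (h : MP a) (h' : MP b) : MP (a * b) := by
  obtain ⟨N, hN⟩ := h; obtain ⟨N', hN'⟩ := h'
  exact ⟨N + N', by rw [pow_add]; exact Ideal.mul_mono hN hN'⟩

lemma MP.pow {a : Ideal R} (h : MP a) (n : ℕ) : MP (a ^ n) := by
  obtain ⟨N, hN⟩ := h
  exact ⟨N * n, by rw [pow_mul]; exact Ideal.pow_right_mono hN n⟩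

lemma MP.top : MP (⊤ : Ideal R) := ⟨0, le_top⟩

lemma MP.exists_socle {b : Ideal R} (hb : MP b) {a : R} (ha : a ∉ b) :
    ∃ c : R, c * a ∉ b ∧ (∀ r ∈ maximalIdeal R, r * (c * a) ∈ b) := by
  classical
  obtain ⟨N, hN⟩ := hb
  have hex : ∃ n, ∀ c ∈ maximalIdeal R ^ n, c * a ∈ b :=
    ⟨N, fun c hc => Ideal.mul_mem_right _ _ (hN hc)⟩
  have h1 := Nat.find_spec hex
  have h0 : Nat.find hex ≠ 0 := by
    intro h; rw [h] at h1
    exact ha (by simpa using h1 1 (by simp))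
  obtain ⟨k, hk⟩ := Nat.exists_eq_succ_of_ne_zero h0
  have h2 := Nat.find_min hex (m := k) (by omega)
  push Not at h2
  obtain ⟨c, hc, hca⟩ := h2
  refine ⟨c, hca, fun r hr => ?_⟩
  rw [← mul_assoc]
  apply h1
  rw [hk, pow_succ, mul_comm r]
  exact Ideal.mul_mem_mul hc hr

lemma mp_induction [IsNoetherianRing R] {P : Ideal R → Prop} (top : P ⊤)
    (step : ∀ (b : Ideal R) (x : R), MP b → x ∉ b → (∀ r ∈ maximalIdeal R, r * x ∈ b) →
      P (b ⊔ Ideal.span {x}) → P b) : ∀ b, MP b → P b := by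
  intro b
  induction b using WellFoundedGT.induction with
  | ind b ih =>
    intro hb
    by_cases h : (1 : R) ∈ b
    · rwa [(Ideal.eq_top_iff_one b).2 h]
    · obtain ⟨c, hc, hm⟩ := hb.exists_socle h
      rw [mul_one] at hc hm
      refine step b c hb hc hm (ih _ ?_ (hb.mono le_sup_left))
      refine lt_of_le_of_ne le_sup_left fun he => hc ?_
      rw [he]
      exact (le_sup_right : Ideal.span {c} ≤ b ⊔ Ideal.span {c}) (Ideal.mem_span_singleton_self c)

lemma mem_m_of_mul_mem {b : Ideal R} {x r : R} (hx : x ∉ b) (h : r * x ∈ b) :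
    r ∈ maximalIdeal R := by
  rw [IsLocalRing.mem_maximalIdeal, mem_nonunits_iff]
  intro hu
  exact hx ((Ideal.unit_mul_mem_iff_mem b hu).1 h)

lemma PE_m_prime {d : ℕ} {f g : MvPolynomial (Fin d) R} (h : f * g ∈ PE d (maximalIdeal R))
    (hf : f ∉ PE d (maximalIdeal R)) : g ∈ PE d (maximalIdeal R) := by
  have hp : (PE d (maximalIdeal R)).IsPrime := by
    have : RingHom.ker (MvPolynomial.map (σ := Fin d) (Ideal.Quotient.mk (maximalIdeal R))) =
        PE d (maximalIdeal R) := by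
      rw [MvPolynomial.ker_map, Ideal.mk_ker]
    rw [← this]
    exact RingHom.ker_isPrime _
  exact (hp.mem_or_mem h).resolve_left hf

variable [IsNoetherianRing R] {d : ℕ} {s : Fin d → R}

lemma PE_cancel {p : ℕ} {f : MvPolynomial (Fin d) R} (hf : f ∉ PE d (maximalIdeal R)) :
    ∀ b : Ideal R, MP b → ∀ (n : ℕ) (h : MvPolynomial (Fin d) R), h.IsHomogeneous n →
      f * h ∈ PE d b → h ∈ PE d b := by
  refine mp_induction ?_ ?_
  · intro n h _ _; rw [mem_PE]; simp
  · intro b x hb hx hm ih n h hh hfh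
    have h1 := ih n h hh (Ideal.map_mono le_sup_left hfh)
    obtain ⟨g, hg, hg'⟩ := exists_decomp hh h1
    have h2 : MvPolynomial.C x * (f * g) ∈ PE d b := by
      have := Ideal.sub_mem _ hfh (Ideal.mul_mem_left _ f hg')
      convert this using 1; ring
    have h3 : f * g ∈ PE d (maximalIdeal R) := by
      rw [mem_PE] at h2 ⊢
      intro μ
      have := h2 μ
      rw [MvPolynomial.coeff_C_mul, mul_comm] at this
      exact mem_m_of_mul_mem hx this
    have h4 := PE_m_prime h3 hf
    have h5 : MvPolynomial.C x * g ∈ PE d b := by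
      rw [mem_PE] at h4 ⊢
      intro μ
      rw [MvPolynomial.coeff_C_mul, mul_comm]
      exact hm _ (h4 μ)
    have := Ideal.add_mem _ hg' h5
    simpa using this

lemma form_cancel (hq : QReg s) (hJ : MP (JJ s)) {b : Ideal R} (hb : JJ s ≤ b) {p n : ℕ}
    {f : MvPolynomial (Fin d) R} (hfp : f.IsHomogeneous p) (hf : f ∉ PE d (maximalIdeal R))
    {a : R} (h : MvPolynomial.eval s f * a ∈ JJ s ^ (p + n) * b) : a ∈ JJ s ^ n * b := by
  have key : ∀ i ≤ n, a ∈ JJ s ^ i := by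
    intro i
    induction i with
    | zero => simp
    | succ i ih =>
      intro hi
      obtain ⟨g, hg, rfl⟩ := mem_JJ_pow.1 (ih (by omega))
      have h1 : f * g ∈ PE d (JJ s) := by
        refine qreg_aux (hq (p + i)) _ (hfp.mul hg) _ le_rfl ?_
        have hle : JJ s ^ (p + n) ≤ JJ s ^ (p + i + 1) := Ideal.pow_le_pow_right (by omega)
        have hle' : JJ s ^ (p + n) * b ≤ JJ s ^ (p + n) := Ideal.mul_le_left
        rw [pow_succ] at hle
        rw [map_mul]
        exact hle (hle' h)
      have := eval_mem_JJ_pow_mul hg (PE_cancel (p := p) hf _ hJ _ g hg h1) (s := s)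
      rwa [← pow_succ] at this
  obtain ⟨g, hg, rfl⟩ := mem_JJ_pow.1 (key n le_rfl)
  have h1 : f * g ∈ PE d b := by
    refine qreg_aux (hq (p + n)) _ (hfp.mul hg) _ hb ?_
    rwa [map_mul]
  exact eval_mem_JJ_pow_mul hg (PE_cancel (p := p) hf _ (hJ.mono hb) _ g hg h1)

lemma form_cancel' (hq : QReg s) (hJ : MP (JJ s)) {p n : ℕ}
    {f : MvPolynomial (Fin d) R} (hfp : f.IsHomogeneous p) (hf : f ∉ PE d (maximalIdeal R))
    {a : R} (h : MvPolynomial.eval s f * a ∈ JJ s ^ (p + n)) : a ∈ JJ s ^ n := by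
  have := form_cancel hq hJ (b := ⊤) le_top hfp hf (a := a) (n := n) (by simpa using h)
  simpa using this

/-! lengths -/

/-- length of `R/X` as a natural number -/
noncomputable def len (X : Ideal R) : ℕ := (Module.length R (R ⧸ X)).toNat

lemma length_step {Y : Ideal R} {z : R} (h : ∀ r ∈ maximalIdeal R, r * z ∈ Y) :
    Module.length R (R ⧸ Y) ≤ Module.length R (R ⧸ (Y ⊔ Ideal.span {z})) + 1 := by
  let g : (R ⧸ Y) →ₗ[R] (R ⧸ (Y ⊔ Ideal.span {z})) := Submodule.factor le_sup_left
  have hg : Function.Surjective g := Submodule.factor_surjective _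
  have h1 := Module.length_eq_add_of_exact (LinearMap.ker g).subtype g
    (Submodule.subtype_injective _) hg (LinearMap.exact_subtype_ker_map g)
  rw [h1, add_comm]
  gcongr
  let φ : (R ⧸ maximalIdeal R) →ₗ[R] (R ⧸ Y) :=
    Submodule.liftQ _ ((Submodule.mkQ Y).comp (LinearMap.mulRight R z)) (by
      intro r hr
      simp only [LinearMap.mem_ker, LinearMap.comp_apply, LinearMap.mulRight_apply,
        Submodule.mkQ_apply, Submodule.Quotient.mk_eq_zero]
      exact h r hr)
  have hle : LinearMap.ker g ≤ LinearMap.range φ := by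
    intro y hy
    obtain ⟨a, rfl⟩ := Submodule.mkQ_surjective _ y
    have : a ∈ Y ⊔ Ideal.span {z} := by
      have h2 : g (Submodule.mkQ Y a) = Submodule.mkQ _ a := rfl
      rw [LinearMap.mem_ker, h2, Submodule.mkQ_apply, Submodule.Quotient.mk_eq_zero] at hy
      exact hy
    obtain ⟨u, hu, v, hv, rfl⟩ := Submodule.mem_sup.1 this
    obtain ⟨c, rfl⟩ := Ideal.mem_span_singleton'.1 hv
    refine ⟨Submodule.Quotient.mk c, ?_⟩
    simp only [φ, Submodule.liftQ_apply, LinearMap.comp_apply, LinearMap.mulRight_apply]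
    rw [map_add]
    simp only [Submodule.mkQ_apply]
    rw [(Submodule.Quotient.mk_eq_zero Y).2 hu, zero_add]
  calc Module.length R (LinearMap.ker g) ≤ Module.length R (LinearMap.range φ) :=
        Module.length_le_of_injective _ (Submodule.inclusion_injective hle)
    _ ≤ Module.length R (R ⧸ maximalIdeal R) :=
        Module.length_le_of_surjective _ (LinearMap.surjective_rangeRestrict φ)
    _ = 1 := by
        rw [Module.length_eq_one_iff]
        rw [isSimpleModule_iff_isCoatom]
        exact (IsLocalRing.maximalIdeal.isMaximal R).out

lemma length_ne_top : ∀ X : Ideal R, MP X → Module.length R (R ⧸ X) ≠ ⊤ := by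
  refine mp_induction ?_ ?_
  · rw [Module.length_eq_zero_iff.2 (Submodule.Quotient.subsingleton_iff.2 rfl)]; simp
  · intro b x _ _ hm h1 h2
    have := length_step hm
    rw [h2, top_le_iff] at this
    exact h1 (by simpa using this)

lemma len_cast {X : Ideal R} (hX : MP X) : ((len X : ℕ) : ℕ∞) = Module.length R (R ⧸ X) :=
  ENat.coe_toNat (length_ne_top X hX)

lemma len_step {Y : Ideal R} (hY : MP Y) {z : R} (h : ∀ r ∈ maximalIdeal R, r * z ∈ Y) :
    len Y ≤ len (Y ⊔ Ideal.span {z}) + 1 := by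
  have := length_step h
  rw [← len_cast hY, ← len_cast (hY.mono le_sup_left)] at this
  exact_mod_cast this

lemma len_lt {Y Z : Ideal R} (hY : MP Y) (h : Y < Z) : len Z + 1 ≤ len Y := by
  have h1 : Module.length R (R ⧸ Z) + 1 ≤ Module.length R (R ⧸ Y) := by
    rw [Module.length_quotient, Module.length_quotient]
    exact Order.coheight_add_one_le h
  rw [← len_cast hY, ← len_cast (hY.mono h.le)] at h1
  exact_mod_cast h1

lemma len_mono {Y Z : Ideal R} (hY : MP Y) (h : Y ≤ Z) : len Z ≤ len Y := by
  rcases h.eq_or_lt with rfl | h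
  · exact le_rfl
  · have := len_lt hY h; omega

lemma eq_of_len_le {Y Z : Ideal R} (hY : MP Y) (h : Y ≤ Z) (hl : len Y ≤ len Z) : Y = Z := by
  rcases h.eq_or_lt with rfl | h
  · rfl
  · have := len_lt hY h; omega

lemma len_top : len (⊤ : Ideal R) = 0 := by
  rw [len, Module.length_eq_zero_iff.2 (Submodule.Quotient.subsingleton_iff.2 rfl)]; simp

lemma len_indep {τ : Type*} (T : Finset τ) : ∀ (Y Z : Ideal R) (_ : MP Y) (_ : Y ≤ Z) (z : τ → R)
    (_ : ∀ i ∈ T, z i ∈ Z)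
    (_ : ∀ r : τ → R, ∑ i ∈ T, r i * z i ∈ Y → ∀ i ∈ T, r i ∈ maximalIdeal R),
    len Z + T.card ≤ len Y := by
  classical
  induction T using Finset.induction_on with
  | empty => intro Y Z hY hYZ z _ _; simpa using len_mono hY hYZ
  | insert a T ha ih =>
    intro Y Z hY hYZ z hz hind
    have hlt : Y < Y ⊔ Ideal.span {z a} := by
      refine lt_of_le_of_ne le_sup_left fun he => ?_
      have hza : z a ∈ Y := by
        rw [he]
        exact (le_sup_right : Ideal.span {z a} ≤ Y ⊔ Ideal.span {z a})
          (Ideal.mem_span_singleton_self _)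
      have := hind (fun i => if i = a then 1 else 0) (by simpa using hza) a (by simp)
      simp at this
    have h1 := len_lt hY hlt
    have h2 := ih (Y ⊔ Ideal.span {z a}) Z (hY.mono le_sup_left)
      (sup_le hYZ ((Ideal.span_singleton_le_iff_mem _).2 (hz a (by simp)))) z
      (fun i hi => hz i (by simp [hi])) (by
        intro r hr i hi
        obtain ⟨u, hu, v, hv, huv⟩ := Submodule.mem_sup.1 hr
        obtain ⟨c, rfl⟩ := Ideal.mem_span_singleton'.1 hv
        have := hind (fun i => if i = a then -c else r i) (by
          rw [Finset.sum_insert ha]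
          have : ∑ x ∈ T, (if x = a then -c else r x) * z x = ∑ x ∈ T, r x * z x := by
            refine Finset.sum_congr rfl fun x hx => ?_
            rw [if_neg (by rintro rfl; exact ha hx)]
          rw [this, ← huv]
          simpa using hu) i (by simp [hi])
        rwa [if_neg (by rintro rfl; exact ha hi)] at this)
    rw [Finset.card_insert_of_notMem ha]
    omega

lemma len_span_le {τ : Type*} (T : Finset τ) : ∀ (Y : Ideal R) (_ : MP Y) (z : τ → R)
    (_ : ∀ i ∈ T, ∀ r ∈ maximalIdeal R, r * z i ∈ Y),
    len Y ≤ len (Y ⊔ Ideal.span (z '' T)) + T.card := by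
  classical
  induction T using Finset.induction_on with
  | empty => intro Y hY z _; simp
  | insert a T ha ih =>
    intro Y hY z hz
    have h1 := len_step hY (hz a (by simp))
    have h2 := ih (Y ⊔ Ideal.span {z a}) (hY.mono le_sup_left) z
      (fun i hi r hr => (le_sup_left : Y ≤ Y ⊔ Ideal.span {z a}) (hz i (by simp [hi]) r hr))
    rw [Finset.card_insert_of_notMem ha]
    have h3 : Y ⊔ Ideal.span {z a} ⊔ Ideal.span (z '' T) =
        Y ⊔ Ideal.span (z '' (insert a T : Finset τ)) := by
      rw [Finset.coe_insert, Set.image_insert_eq, Ideal.span_insert, sup_assoc]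
    rw [h3] at h2
    omega

/-- exponents of degree `n` -/
def mons (d n : ℕ) : Finset (Fin d →₀ ℕ) := (Finset.univ : Finset (Fin d)).finsuppAntidiag n

/-- number of monomials of degree `n` -/
def Nn (d n : ℕ) : ℕ := (mons d n).card

lemma mem_mons {d n : ℕ} {μ : Fin d →₀ ℕ} : μ ∈ mons d n ↔ μ.degree = n := by
  rw [mons, Finset.mem_finsuppAntidiag]
  simp [Finsupp.degree_eq_sum]

lemma Nn_eq (d n : ℕ) : Nn (d + 1) n = (n + d).choose d := by
  rw [Nn, mons, Finset.card_finsuppAntidiag_nat_eq_multichoose, Nat.multichoose_eq]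
  simp only [Finset.card_univ, Fintype.card_fin]
  rw [show d + 1 + n - 1 = n + d by omega, Nat.choose_symm_add]

/-- the value of a monomial -/
def mev (s : Fin d → R) (μ : Fin d →₀ ℕ) : R := μ.prod fun i e => s i ^ e

/-- the form with given coefficients -/
lemma isHomogeneous_form (n : ℕ) (r : (Fin d →₀ ℕ) → R) :
    (∑ μ ∈ mons d n, MvPolynomial.monomial μ (r μ)).IsHomogeneous n :=
  MvPolynomial.IsHomogeneous.sum _ _ _ fun μ hμ =>
    MvPolynomial.isHomogeneous_monomial _ (mem_mons.1 hμ)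

lemma eval_form (n : ℕ) (r : (Fin d →₀ ℕ) → R) :
    MvPolynomial.eval s (∑ μ ∈ mons d n, MvPolynomial.monomial μ (r μ)) =
      ∑ μ ∈ mons d n, r μ * mev s μ := by
  rw [map_sum]
  refine Finset.sum_congr rfl fun μ _ => ?_
  rw [MvPolynomial.eval_monomial, mev]

lemma coeff_form (n : ℕ) (r : (Fin d →₀ ℕ) → R) {ν} (hν : ν ∈ mons d n) :
    MvPolynomial.coeff ν (∑ μ ∈ mons d n, MvPolynomial.monomial μ (r μ)) = r ν := by
  classical
  rw [MvPolynomial.coeff_sum, Finset.sum_eq_single ν]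
  · simp
  · intro b _ hb; rw [MvPolynomial.coeff_monomial, if_neg hb]
  · intro h; exact absurd hν h

lemma mev_mem {n : ℕ} {μ : Fin d →₀ ℕ} (hμ : μ ∈ mons d n) : mev s μ ∈ JJ s ^ n := by
  have := monomial_mem_JJ_pow s μ
  rwa [mem_mons.1 hμ] at this

lemma count_multi {ι : Type*} (S : Finset ι) {Y Y' : Ideal R} (hY : MP Y) (hle : Y ≤ Y')
    (y : ι → R) (e : ι → ℕ) (h1 : ∀ j ∈ S, ∀ c ∈ JJ s ^ e j, c * y j ∈ Y')
    (h2 : ∀ f : ι → MvPolynomial (Fin d) R, (∀ j, (f j).IsHomogeneous (e j)) →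
      ∑ j ∈ S, MvPolynomial.eval s (f j) * y j ∈ Y → ∀ j ∈ S, f j ∈ PE d (maximalIdeal R)) :
    len Y' + ∑ j ∈ S, Nn d (e j) ≤ len Y := by
  classical
  have := len_indep (S.sigma fun j => mons d (e j)) Y Y' hY hle (fun p => mev s p.2 * y p.1) ?_ ?_
  · rwa [Finset.card_sigma] at this
  · rintro ⟨j, μ⟩ hj
    rw [Finset.mem_sigma] at hj
    exact h1 j hj.1 _ (mev_mem hj.2)
  · intro r hr
    have h3 := h2 (fun j => ∑ μ ∈ mons d (e j), MvPolynomial.monomial μ (r ⟨j, μ⟩))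
      (fun j => isHomogeneous_form _ fun μ => r ⟨j, μ⟩) (by
        rw [Finset.sum_sigma] at hr
        convert hr using 1
        refine Finset.sum_congr rfl fun j _ => ?_
        rw [eval_form (e j) fun μ => r ⟨j, μ⟩, Finset.sum_mul]
        refine Finset.sum_congr rfl fun μ _ => ?_
        ring)
    rintro ⟨j, μ⟩ hj
    rw [Finset.mem_sigma] at hj
    have := mem_PE.1 (h3 j hj.1) μ
    rwa [coeff_form (e j) (fun μ => r ⟨j, μ⟩) hj.2] at this

lemma count_one {Y Y' : Ideal R} (hY : MP Y) (hle : Y ≤ Y')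
    (y : R) (e : ℕ) (h1 : ∀ c ∈ JJ s ^ e, c * y ∈ Y')
    (h2 : ∀ f : MvPolynomial (Fin d) R, f.IsHomogeneous e →
      MvPolynomial.eval s f * y ∈ Y → f ∈ PE d (maximalIdeal R)) :
    len Y' + Nn d e ≤ len Y := by
  have := count_multi (s := s) ({()} : Finset Unit) hY hle (fun _ => y) (fun _ => e)
    (by simpa using h1) (by
      intro f hf h j _
      exact h2 _ (hf j) (by simpa using h))
  simpa using this

lemma len_mul (hq : QReg s) (hJ : MP (JJ s)) (n : ℕ) : ∀ b : Ideal R, MP b → JJ s ≤ b →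
    len (JJ s ^ n * b) = len (JJ s ^ n) + len b * Nn d n := by
  classical
  refine mp_induction ?_ ?_
  · intro _; rw [Ideal.mul_top, len_top]; simp
  · intro b x hb hx hm ih hJb
    have h0 := ih (hJb.trans le_sup_left)
    have hMP : MP (JJ s ^ n * b) := (hJ.pow n).mul hb
    have hsup : JJ s ^ n * (b ⊔ Ideal.span {x}) =
        JJ s ^ n * b ⊔ Ideal.span ((fun μ => mev s μ * x) '' (mons d n)) := by
      rw [Ideal.mul_sup]
      refine le_antisymm (sup_le le_sup_left ?_) (sup_le le_sup_left ?_)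
      · rw [Ideal.mul_le]
        intro c hc y hy
        obtain ⟨t, rfl⟩ := Ideal.mem_span_singleton'.1 hy
        obtain ⟨f, hf, rfl⟩ := mem_JJ_pow.1 hc
        refine (le_sup_right : _ ≤ JJ s ^ n * b ⊔ _) ?_
        rw [MvPolynomial.eval_eq, Finset.sum_mul]
        refine Ideal.sum_mem _ fun μ hμ => ?_
        have : μ ∈ mons d n := by
          rw [mem_mons]
          have := hf (MvPolynomial.mem_support_iff.1 hμ)
          rw [← this, Finsupp.degree_eq_weight_one]; rfl
        have h3 : mev s μ * x ∈ Ideal.span ((fun μ => mev s μ * x) '' (mons d n : Set _)) :=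
          Ideal.subset_span ⟨μ, this, rfl⟩
        have h4 := Ideal.mul_mem_left _ (MvPolynomial.coeff μ f * t) h3
        convert h4 using 1
        rw [mev, Finsupp.prod]
        ring
      · refine le_trans ?_ le_sup_right
        rw [Ideal.span_le]
        rintro _ ⟨μ, hμ, rfl⟩
        exact Ideal.mul_mem_mul (mev_mem hμ) (Ideal.mem_span_singleton_self x)
    have h1 := len_span_le (mons d n) _ hMP (fun μ => mev s μ * x) (by
      intro μ hμ r hr
      have := Ideal.mul_mem_mul (mev_mem (s := s) hμ) (hm r hr)
      convert this using 1; ring)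
    rw [← hsup] at h1
    have h2 := count_one (s := s) hMP (Ideal.mul_mono_right le_sup_left :
        JJ s ^ n * b ≤ JJ s ^ n * (b ⊔ Ideal.span {x})) x n
      (fun c hc => Ideal.mul_mem_mul hc
        ((le_sup_right : Ideal.span {x} ≤ b ⊔ Ideal.span {x}) (Ideal.mem_span_singleton_self x)))
      (by
        intro f hf hfx
        have : f * MvPolynomial.C x ∈ PE d b := by
          refine qreg_aux (hq n) _ ?_ b hJb (by simpa using hfx)
          simpa using hf.mul (MvPolynomial.isHomogeneous_C _ x)
        rw [mem_PE] at this ⊢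
        intro μ
        have := this μ
        rw [mul_comm, MvPolynomial.coeff_C_mul, mul_comm] at this
        exact mem_m_of_mul_mem hx this)
    have h3 := len_step hb hm
    have h4 := len_lt hb (Z := b ⊔ Ideal.span {x}) (by
      refine lt_of_le_of_ne le_sup_left fun he => hx ?_
      rw [he]
      exact (le_sup_right : Ideal.span {x} ≤ b ⊔ Ideal.span {x}) (Ideal.mem_span_singleton_self x))
    have h5 : len b = len (b ⊔ Ideal.span {x}) + 1 := by omega
    rw [h5, add_mul, one_mul]
    unfold Nn at *
    omega

lemma len_pow (hq : QReg s) (hJ : MP (JJ s)) (n : ℕ) :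
    len (JJ s ^ n) = len (JJ s) * ∑ i ∈ Finset.range n, Nn d i := by
  induction n with
  | zero => simp [len_top]
  | succ n ih =>
    rw [pow_succ, len_mul hq hJ n _ hJ le_rfl, ih, Finset.sum_range_succ, mul_add]

end PartD

/-! ### Part E: the filtration W of integrally closed ideals, in bounded form -/
section PartE
variable {R : Type*} [CommRing R]

lemma W_add_aux {J : Ideal R} {n : ℕ} {a b : R} {N N' : ℕ} (ha : ∀ i, a ^ i ∈ J ^ (i * n - N))
    (hb : ∀ i, b ^ i ∈ J ^ (i * n - N')) (i : ℕ) : (a + b) ^ i ∈ J ^ (i * n - (N + N')) := by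
  rw [add_pow]
  refine Ideal.sum_mem _ fun k hk => Ideal.mul_mem_right _ _ ?_
  have hk' : k ≤ i := by simpa [Nat.lt_succ_iff] using hk
  have h1 := Ideal.mul_mem_mul (ha k) (hb (i - k))
  rw [← pow_add] at h1
  refine Ideal.pow_le_pow_right ?_ h1
  have : i * n = k * n + (i - k) * n := by rw [← add_mul]; congr 1; omega
  omega

/-- the filtration -/
def W (J : Ideal R) (n : ℕ) : Ideal R where
  carrier := {c | ∃ N, ∀ i, c ^ i ∈ J ^ (i * n - N)}
  zero_mem' := ⟨n, fun i => by
    rcases i with _ | i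
    · simp
    · simp⟩
  add_mem' := by
    rintro a b ⟨N, ha⟩ ⟨N', hb⟩
    exact ⟨N + N', W_add_aux ha hb⟩
  smul_mem' := by
    rintro c x ⟨N, hx⟩
    refine ⟨N, fun i => ?_⟩
    rw [smul_eq_mul, mul_pow]
    exact Ideal.mul_mem_left _ _ (hx i)

variable {J : Ideal R}

lemma mem_W {n : ℕ} {c : R} : c ∈ W J n ↔ ∃ N, ∀ i, c ^ i ∈ J ^ (i * n - N) := Iff.rfl

lemma pow_le_W (n : ℕ) : J ^ n ≤ W J n := fun c hc => ⟨0, fun i => by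
  have := Ideal.pow_mem_pow hc i
  rw [← pow_mul, mul_comm] at this
  simpa using this⟩

lemma W_zero : W J 0 = ⊤ := by
  rw [eq_top_iff]; intro c _; exact ⟨0, fun i => by simp⟩

lemma W_anti {n n' : ℕ} (h : n ≤ n') : W J n' ≤ W J n := by
  rintro c ⟨N, hc⟩
  refine ⟨N, fun i => Ideal.pow_le_pow_right ?_ (hc i)⟩
  have := Nat.mul_le_mul_left i h
  omega

lemma W_mul_mem {n n' : ℕ} {a b : R} (ha : a ∈ W J n) (hb : b ∈ W J n') : a * b ∈ W J (n + n') := by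
  obtain ⟨N, ha⟩ := ha
  obtain ⟨N', hb⟩ := hb
  refine ⟨N + N', fun i => ?_⟩
  have h1 := Ideal.mul_mem_mul (ha i) (hb i)
  rw [← pow_add] at h1
  rw [mul_pow]
  refine Ideal.pow_le_pow_right ?_ h1
  rw [mul_add]; omega

lemma W_pow_mem {n : ℕ} {a : R} (ha : a ∈ W J n) (i : ℕ) : a ^ i ∈ W J (i * n) := by
  induction i with
  | zero => simp [W_zero]
  | succ i ih => rw [pow_succ, add_mul, one_mul]; exact W_mul_mem ih ha

lemma W_of_pow {n l : ℕ} (hl : 0 < l) {a : R} (ha : a ^ l ∈ W J (l * n)) : a ∈ W J n := by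
  obtain ⟨N, ha⟩ := ha
  refine ⟨N + l * n, fun i => ?_⟩
  have h1 := ha (i / l)
  rw [← pow_mul] at h1
  have h2 : a ^ i = a ^ (i % l) * a ^ (l * (i / l)) := by rw [← pow_add, Nat.mod_add_div]
  rw [h2]
  refine Ideal.mul_mem_left _ _ (Ideal.pow_le_pow_right ?_ h1)
  have h3 : i ≤ i / l * l + l := by
    have := Nat.mod_lt i hl
    have := Nat.mod_add_div i l
    nlinarith
  have h4 := Nat.mul_le_mul_right n h3
  rw [add_mul, mul_assoc] at h4
  omega

lemma W_trans {y : R} {e j : ℕ} (hj : 0 < j) (C : ℕ → R)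
    (hC : ∀ l < j, C l ∈ W J ((j - l) * e)) (hy : y ^ j = ∑ l ∈ Finset.range j, C l * y ^ l) :
    y ∈ W J e := by
  classical
  have hC' : ∀ l, ∃ N, l < j → ∀ i, C l ^ i ∈ J ^ (i * ((j - l) * e) - N) := fun l => by
    by_cases h : l < j
    · obtain ⟨N, hN⟩ := hC l h; exact ⟨N, fun _ => hN⟩
    · exact ⟨0, fun h' => absurd h' h⟩
  choose Nl hNl using hC'
  set Nt := ∑ l ∈ Finset.range j, Nl l with hNt
  let Q : ℕ → Ideal R := fun w => Ideal.span {x | ∃ a : ℕ → ℕ,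
    ∑ l ∈ Finset.range j, a l * (j - l) = w ∧ x = ∏ l ∈ Finset.range j, C l ^ a l}
  have hQJ : ∀ w, Q w ≤ J ^ (w * e - Nt) := by
    intro w
    refine Ideal.span_le.2 ?_
    rintro x ⟨a, ha, rfl⟩
    have h1 : ∏ l ∈ Finset.range j, C l ^ a l ∈
        ∏ l ∈ Finset.range j, J ^ (a l * ((j - l) * e) - Nl l) :=
      Ideal.prod_mem_prod fun l hl => hNl l (Finset.mem_range.1 hl) (a l)
    rw [Finset.prod_pow_eq_pow_sum] at h1
    refine Ideal.pow_le_pow_right ?_ h1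
    rw [← ha, Finset.sum_mul, hNt, tsub_le_iff_right, ← Finset.sum_add_distrib]
    refine Finset.sum_le_sum fun l _ => ?_
    rw [mul_assoc]; omega
  have hQC : ∀ w l, l < j → ∀ x ∈ Q w, x * C l ∈ Q (w + (j - l)) := by
    intro w l hl x hx
    have : Q w * Ideal.span {C l} ≤ Q (w + (j - l)) := by
      rw [Ideal.span_mul_span']
      refine Ideal.span_le.2 ?_
      rintro _ ⟨x, ⟨a, ha, rfl⟩, z, hz, rfl⟩
      rw [Set.mem_singleton_iff] at hz
      subst hz
      refine Ideal.subset_span ⟨fun i => a i + if i = l then 1 else 0, ?_, ?_⟩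
      · simp only [add_mul, Finset.sum_add_distrib, ha, ite_mul, one_mul, zero_mul]
        rw [Finset.sum_ite_eq' , if_pos (Finset.mem_range.2 hl)]
      · simp only [pow_add, Finset.prod_mul_distrib, pow_ite, pow_one, pow_zero]
        rw [Finset.prod_ite_eq', if_pos (Finset.mem_range.2 hl)]
    exact this (Ideal.mul_mem_mul hx (Ideal.mem_span_singleton_self _))
  have hone : (1 : R) ∈ Q 0 := Ideal.subset_span ⟨0, by simp, by simp⟩
  obtain ⟨j, rfl⟩ : ∃ j', j = j' + 1 := ⟨j - 1, by omega⟩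
  have key : ∀ k, ∃ c : ℕ → R, (∀ l ≤ j, c l ∈ Q (j + k - l)) ∧
      y ^ (j + k) = ∑ l ∈ Finset.range (j + 1), c l * y ^ l := by
    intro k
    induction k with
    | zero =>
      refine ⟨fun l => if l = j then 1 else 0, fun l hl => ?_, ?_⟩
      · by_cases h : l = j
        · simp only [h, if_true]; simpa using hone
        · simp [h]
      · simp
    | succ k ih =>
      obtain ⟨c, hc, hyc⟩ := ih
      refine ⟨fun l => (if l = 0 then 0 else c (l - 1)) + c j * C l, fun l hl => ?_, ?_⟩
      · refine Ideal.add_mem _ ?_ ?_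
        · by_cases h : l = 0
          · simp [h]
          · simp only [h, if_false]
            have := hc (l - 1) (by omega)
            convert this using 2; omega
        · have := hQC _ l (by omega) _ (hc j le_rfl)
          convert this using 2; omega
      · have e1 : y ^ (j + (k + 1)) = y * y ^ (j + k) := by ring
        rw [e1, hyc, Finset.sum_range_succ, mul_add]
        have e2 : y * (c j * y ^ j) = c j * y ^ (j + 1) := by ring
        rw [e2, hy, Finset.mul_sum, Finset.mul_sum]
        simp only [add_mul]
        rw [Finset.sum_add_distrib]
        congr 1
        · rw [Finset.sum_range_succ' _ j]
          simp only [if_true, zero_mul, add_zero, Nat.add_eq_zero_iff, one_ne_zero, and_false,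
            if_false, Nat.add_sub_cancel]
          refine Finset.sum_congr rfl fun l _ => ?_
          ring
        · refine Finset.sum_congr rfl fun l _ => ?_
          ring
  refine ⟨Nt + j * e, fun i => ?_⟩
  by_cases hi : i < j
  · have : i * e - (Nt + j * e) = 0 := by
      have := Nat.mul_le_mul_right e hi.le; omega
    rw [this]; simp
  · obtain ⟨k, rfl⟩ := Nat.exists_eq_add_of_le (not_lt.1 hi)
    obtain ⟨c, hc, hyc⟩ := key k
    rw [hyc]
    refine Ideal.sum_mem _ fun l hl => Ideal.mul_mem_right _ _ ?_
    have hl' : l ≤ j := by simpa [Nat.lt_succ_iff] using hl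
    refine Ideal.pow_le_pow_right ?_ (hQJ _ (hc l hl'))
    have : k ≤ j + k - l := by omega
    have := Nat.mul_le_mul_right e this
    rw [add_mul]; omega

lemma W_uniform [IsNoetherianRing R] (n : ℕ) : ∃ N, ∀ i, W J n ^ i ≤ J ^ (i * n - N) := by
  have key : ∀ a : Ideal R, a.FG → a ≤ W J n → ∃ N, ∀ i, a ^ i ≤ J ^ (i * n - N) := by
    intro a ha
    refine Submodule.fg_induction
      (motive := fun (a : Ideal R) _ => a ≤ W J n → ∃ N, ∀ i, a ^ i ≤ J ^ (i * n - N))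
      ?_ ?_ a ha
    · intro x hx
      obtain ⟨N, hN⟩ := hx (Submodule.mem_span_singleton_self x)
      refine ⟨N, fun i => ?_⟩
      change Ideal.span {x} ^ i ≤ _
      rw [Ideal.span_singleton_pow, Ideal.span_singleton_le_iff_mem]
      exact hN i
    · intro a b _ _ iha ihb h
      obtain ⟨N, hN⟩ := iha (le_sup_left.trans h)
      obtain ⟨N', hN'⟩ := ihb (le_sup_right.trans h)
      refine ⟨N + N', fun i => ?_⟩
      have e1 : (a ⊔ b) ^ i = ∑ k ∈ Finset.range (i + 1), a ^ k * b ^ (i - k) * (i.choose k : Ideal R) := by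
        rw [← Submodule.add_eq_sup]; exact add_pow _ _ _
      change (a ⊔ b) ^ i ≤ _
      rw [e1, Ideal.sum_eq_sup]
      refine Finset.sup_le fun k hk => ?_
      have hk' : k ≤ i := by simpa [Nat.lt_succ_iff] using hk
      have h1 : a ^ k * b ^ (i - k) ≤ J ^ (k * n - N) * J ^ ((i - k) * n - N') :=
        Ideal.mul_mono (hN k) (hN' _)
      rw [← pow_add] at h1
      have h3 : a ^ k * b ^ (i - k) * (i.choose k : Ideal R) ≤ a ^ k * b ^ (i - k) :=
        Ideal.mul_le_left
      refine h3.trans (h1.trans (Ideal.pow_le_pow_right ?_))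
      have : i * n = k * n + (i - k) * n := by rw [← add_mul]; congr 1; omega
      omega
  exact key _ (IsNoetherian.noetherian _) le_rfl

lemma W_cancel [IsLocalRing R] [IsNoetherianRing R] {d : ℕ} {s : Fin d → R}
    (hq : QReg s) (hJ : MP (JJ s)) {p n : ℕ}
    {f : MvPolynomial (Fin d) R} (hfp : f.IsHomogeneous p) (hf : f ∉ PE d (maximalIdeal R))
    {a : R} (h : MvPolynomial.eval s f * a ∈ W (JJ s) (p + n)) : a ∈ W (JJ s) n := by
  obtain ⟨N, hN⟩ := h
  refine ⟨N, fun i => ?_⟩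
  have hfi : f ^ i ∉ PE d (maximalIdeal R) := by
    induction i with
    | zero =>
      rw [pow_zero]
      intro h1
      have := mem_PE.1 h1 0
      simp only [MvPolynomial.coeff_zero_one] at this
      exact (Ideal.ne_top_iff_one _).1 (maximalIdeal.isMaximal R).ne_top this
    | succ i ih =>
      intro h1
      rw [pow_succ'] at h1
      exact ih (PE_m_prime h1 hf)
  by_cases hi : i * n ≤ N
  · rw [Nat.sub_eq_zero_of_le hi]; simp
  · have h1 := hN i
    rw [mul_pow, ← map_pow] at h1
    refine form_cancel' hq hJ (hfp.pow i) hfi ?_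
    convert h1 using 2
    rw [mul_add, mul_comm p i]; omega

lemma eval_mem_W {d : ℕ} {s : Fin d → R} {p : ℕ}
    {f : MvPolynomial (Fin d) R} (hfp : f.IsHomogeneous p) : MvPolynomial.eval s f ∈ W (JJ s) p :=
  pow_le_W p (mem_JJ_pow.2 ⟨f, hfp, rfl⟩)

/-- comparison with the integral closure -/
lemma intCl_eq_W [IsNoetherianRing R] {I : Ideal R} (hJI : J ≤ I)
    (hred : ∃ N : ℕ, ∀ n ≥ N, I ^ (n + 1) = J * I ^ n) (x : R) (hx : x ∈ J)
    (hreg : ∀ z, x * z = 0 → z = 0) (n : ℕ) : intCl (I ^ n) = W J n := by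
  have hI : I ≤ W J 1 := by
    obtain ⟨N, hN⟩ := hred
    have h1 : ∀ i, I ^ (N + i) = J ^ i * I ^ N := by
      intro i
      induction i with
      | zero => simp
      | succ i ih => rw [← add_assoc, hN _ (by omega), ih, pow_succ', mul_assoc]
    intro c hc
    refine ⟨N, fun i => ?_⟩
    rw [mul_one]
    have h2 := Ideal.pow_mem_pow hc i
    by_cases hi : i ≤ N
    · rw [Nat.sub_eq_zero_of_le hi]; simp
    · have : i = N + (i - N) := by omega
      rw [this, h1] at h2
      have h3 : J ^ (i - N) * I ^ N ≤ J ^ (i - N) := Ideal.mul_le_left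
      rw [← this] at h2
      exact h3 h2
  have hIn : ∀ n, I ^ n ≤ W J n := by
    intro n
    induction n with
    | zero => rw [W_zero]; exact le_top
    | succ n ih =>
      rw [pow_succ]
      refine Ideal.mul_le.2 fun a ha b hb => W_mul_mem (ih ha) (hI hb)
  refine le_antisymm (Ideal.span_le.2 ?_) ?_
  · rintro y ⟨j, hj, a, ha, hy⟩
    refine W_trans hj (fun l => - a (j - l)) (fun l hl => ?_) ?_
    · have := ha (j - l) (Finset.mem_Icc.2 (by omega))
      rw [← pow_mul, mul_comm] at this
      exact Ideal.neg_mem_iff _ |>.2 (hIn _ this)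
    · rw [eq_neg_of_add_eq_zero_left hy, ← Finset.sum_neg_distrib]
      refine Finset.sum_bij' (fun i _ => j - i) (fun i _ => j - i) ?_ ?_ ?_ ?_ ?_
      · intro i hi; have := Finset.mem_Icc.1 hi; exact Finset.mem_range.2 (by omega)
      · intro i hi; have := Finset.mem_range.1 hi; exact Finset.mem_Icc.2 (by omega)
      · intro i hi; have := Finset.mem_Icc.1 hi; omega
      · intro i hi; have := Finset.mem_range.1 hi; omega
      · intro i hi; have := Finset.mem_Icc.1 hi
        have e : j - (j - i) = i := by omega
        rw [e]; ring
  · rintro c ⟨N, hc⟩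
    refine Ideal.subset_span ?_
    -- Noetherian argument
    have hmem : ∀ l, x ^ N * c ^ l ∈ (J ^ n) ^ l := by
      intro l
      have h1 := Ideal.mul_mem_mul (Ideal.pow_mem_pow hx N) (hc l)
      rw [← pow_add] at h1
      rw [← pow_mul]
      refine Ideal.pow_le_pow_right ?_ h1
      rw [mul_comm n l]; omega
    let u : ℕ → reesAlgebra (J ^ n) := fun l =>
      ⟨Polynomial.monomial l (x ^ N * c ^ l), reesAlgebra.monomial_mem.2 (hmem l)⟩
    let A : ℕ →o Ideal (reesAlgebra (J ^ n)) :=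
      ⟨fun k => Ideal.span (u '' {l | l < k}), fun k k' h =>
        Ideal.span_mono (Set.image_mono fun l (hl : l < k) => lt_of_lt_of_le hl h)⟩
    obtain ⟨k, hk⟩ := monotone_stabilizes_iff_noetherian.2 inferInstance A
    have hk1 : u (k+1) ∈ Ideal.span (u '' {l | l < k + 1}) := by
      have h2 : A (k+2) = A (k+1) := (hk (k+2) (by omega)).symm.trans (hk (k+1) (by omega))
      change u (k+1) ∈ A (k+1)
      rw [← h2]
      exact Ideal.subset_span ⟨k+1, by simp, rfl⟩
    have hset : u '' {l | l < k + 1} = u '' ((Finset.range (k+1) : Finset ℕ) : Set ℕ) := by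
      congr 1; ext; simp
    rw [hset, Submodule.mem_span_image_finset_iff_exists_fun'] at hk1
    obtain ⟨b, hb⟩ := hk1
    have hb' := congrArg (fun z : reesAlgebra (J ^ n) => (z : R[X]).coeff (k+1)) hb
    simp only [AddSubmonoidClass.coe_finset_sum, smul_eq_mul, MulMemClass.coe_mul,
      Polynomial.finset_sum_coeff, u, Polynomial.coeff_monomial, if_true] at hb'
    have hb2 : ∑ l ∈ Finset.range (k+1), (b l : R[X]).coeff (k + 1 - l) * c ^ l = c ^ (k+1) := by
      have hN : ∀ N z, x ^ N * z = 0 → z = 0 := by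
        intro N
        induction N with
        | zero => intro z hz; simpa using hz
        | succ N ih => intro z hz; rw [pow_succ, mul_assoc] at hz; exact hreg _ (ih _ hz)
      refine sub_eq_zero.1 (hN N _ ?_)
      rw [mul_sub, ← hb', Finset.mul_sum, ← Finset.sum_sub_distrib]
      refine Finset.sum_eq_zero fun l hl => ?_
      have hl' := Finset.mem_range.1 hl
      have e1 : k + 1 = (k + 1 - l) + l := by omega
      have e2 : ((b l : R[X]) * Polynomial.monomial l (x ^ N * c ^ l)).coeff (k+1) =
          (b l : R[X]).coeff (k + 1 - l) * (x ^ N * c ^ l) := by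
        conv_lhs => rw [e1]
        exact Polynomial.coeff_mul_monomial _ _ _ _
      rw [e2]; ring
    refine ⟨k + 1, by omega, fun i => - (b (k + 1 - i) : R[X]).coeff i, fun i hi => ?_, ?_⟩
    · have h3 := (b (k+1-i)).2 i
      exact Ideal.neg_mem_iff _ |>.2 (Ideal.pow_right_mono (Ideal.pow_right_mono hJI n) i h3)
    · rw [← hb2]
      have : ∑ l ∈ Finset.range (k+1), (b l : R[X]).coeff (k + 1 - l) * c ^ l =
        ∑ i ∈ Finset.Icc 1 (k+1), (b (k + 1 - i) : R[X]).coeff i * c ^ (k + 1 - i) := by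
        refine Finset.sum_bij' (fun i _ => k + 1 - i) (fun i _ => k + 1 - i) ?_ ?_ ?_ ?_ ?_
        · intro i hi; have := Finset.mem_range.1 hi; exact Finset.mem_Icc.2 (by omega)
        · intro i hi; have := Finset.mem_Icc.1 hi; exact Finset.mem_range.2 (by omega)
        · intro i hi; have := Finset.mem_range.1 hi; omega
        · intro i hi; have := Finset.mem_Icc.1 hi; omega
        · intro i hi; have := Finset.mem_range.1 hi
          have e : k + 1 - (k + 1 - i) = i := by omega
          rw [e]
      rw [this]
      simp

end PartE

/-! ### Part F: asymptotics, attainment, rationality of the order function -/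
section PartF
open Filter Topology

lemma choose_tendsto (k a c : ℕ) :
    Tendsto (fun n : ℕ => ((n + a - c).choose k : ℝ) / (n : ℝ) ^ k) atTop
      (𝓝 (1 / (k.factorial : ℝ))) := by
  have hg : Tendsto (fun n : ℕ => n + a - c) atTop atTop :=
    tendsto_atTop_mono (fun n => by omega : ∀ n, n - c ≤ n + a - c) (tendsto_sub_atTop_nat c)
  have hr : Tendsto (fun n : ℕ => ((n + a - c : ℕ) : ℝ) / (n : ℝ)) atTop (𝓝 1) := by
    have h1 : Tendsto (fun n : ℕ => 1 + ((a : ℝ) - c) / (n : ℝ)) atTop (𝓝 (1 + 0)) :=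
      tendsto_const_nhds.add (tendsto_const_div_atTop_nhds_zero_nat _)
    rw [add_zero] at h1
    refine h1.congr' ?_
    filter_upwards [eventually_ge_atTop (c + 1)] with n hn
    have hn0 : (n : ℝ) ≠ 0 := by
      have : n ≠ 0 := by omega
      exact_mod_cast this
    rw [Nat.cast_sub (by omega)]
    push_cast
    field_simp
    ring
  have h2 := (isEquivalent_choose k).comp_tendsto hg
  have h3 : Tendsto (fun n : ℕ => (((n + a - c : ℕ) : ℝ) ^ k / (k.factorial : ℝ)) / (n : ℝ) ^ k)
      atTop (𝓝 (1 / (k.factorial : ℝ))) := by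
    have := (hr.pow k).div_const (k.factorial : ℝ)
    rw [one_pow] at this
    refine this.congr fun n => ?_
    rw [div_pow]; ring
  have h4 : Asymptotics.IsEquivalent atTop
      (fun n : ℕ => ((n + a - c).choose k : ℝ) / (n : ℝ) ^ k)
      (fun n : ℕ => (((n + a - c : ℕ) : ℝ) ^ k / (k.factorial : ℝ)) / (n : ℝ) ^ k) :=
    h2.div Asymptotics.IsEquivalent.refl
  exact h4.symm.tendsto_nhds h3

lemma Nn_tendsto {d : ℕ} (hd : 0 < d) (c : ℕ) :
    Tendsto (fun n : ℕ => (Nn d (n - c) : ℝ) / (n : ℝ) ^ (d - 1)) atTop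
      (𝓝 (1 / ((d - 1).factorial : ℝ))) := by
  refine (choose_tendsto (d - 1) (d - 1) c).congr' ?_
  filter_upwards [eventually_ge_atTop c] with n hn
  obtain ⟨d, rfl⟩ : ∃ d', d = d' + 1 := ⟨d - 1, by omega⟩
  rw [Nn_eq]
  simp only [Nat.add_sub_cancel]
  congr 3
  omega

lemma Nn_card_le {d : ℕ} (hd : 0 < d) {ι : Type*} (S : Finset ι) (e : ι → ℕ) (C n0 : ℕ)
    (h : ∀ n ≥ n0, ∑ j ∈ S, Nn d (n - e j) ≤ C * Nn d n) : S.card ≤ C := by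
  have h1 : Tendsto (fun n : ℕ => ∑ j ∈ S, (Nn d (n - e j) : ℝ) / (n : ℝ) ^ (d - 1)) atTop
      (𝓝 (∑ j ∈ S, 1 / ((d - 1).factorial : ℝ))) :=
    tendsto_finsetSum _ fun j _ => Nn_tendsto hd (e j)
  have h2 : Tendsto (fun n : ℕ => (C : ℝ) * ((Nn d (n - 0) : ℝ) / (n : ℝ) ^ (d - 1))) atTop
      (𝓝 ((C : ℝ) * (1 / ((d - 1).factorial : ℝ)))) := (Nn_tendsto hd 0).const_mul _
  have h3 := le_of_tendsto_of_tendsto h1 h2 (by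
    filter_upwards [eventually_ge_atTop n0] with n hn
    rw [← Finset.sum_div, ← mul_div_assoc]
    gcongr
    have := h n hn
    rw [Nat.sub_zero]
    exact_mod_cast this)
  rw [Finset.sum_const, nsmul_eq_mul] at h3
  have hpos : (0 : ℝ) < 1 / ((d - 1).factorial : ℝ) := by positivity
  have h4 : (S.card : ℝ) ≤ C := le_of_mul_le_mul_right h3 hpos
  exact_mod_cast h4

variable {R : Type*} [CommRing R]

lemma cross {J : Ideal R} {a b : R} {i n : ℕ} (hi : 0 < i) (ha : a ^ i ∈ W J n)
    (hb : b ^ i ∈ W J n) : (a + b) ^ i ∈ W J n := by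
  rw [add_pow]
  refine Ideal.sum_mem _ fun k hk => Ideal.mul_mem_right _ _ ?_
  have hk' : k ≤ i := by simpa [Nat.lt_succ_iff] using hk
  refine W_of_pow hi ?_
  have h1 := W_mul_mem (W_pow_mem ha k) (W_pow_mem hb (i - k))
  have e1 : (a ^ k * b ^ (i - k)) ^ i = (a ^ i) ^ k * (b ^ i) ^ (i - k) := by
    rw [mul_pow, ← pow_mul, ← pow_mul, ← pow_mul, ← pow_mul, mul_comm k, mul_comm (i - k)]
  rw [e1]
  convert h1 using 2
  rw [← add_mul]; congr 1; omega

/-- real-indexed filtration -/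
def VV (J : Ideal R) (β : ℝ) : Ideal R where
  carrier := {a | ∀ n i : ℕ, 0 < i → (n : ℝ) < i * β → a ^ i ∈ W J n}
  zero_mem' := fun n i hi _ => by rw [zero_pow hi.ne']; exact Ideal.zero_mem _
  add_mem' := fun ha hb n i hi h => cross hi (ha n i hi h) (hb n i hi h)
  smul_mem' := fun c x hx n i hi h => by
    rw [smul_eq_mul, mul_pow]; exact Ideal.mul_mem_left _ _ (hx n i hi h)

variable {J : Ideal R}

lemma mem_VV {β : ℝ} {a : R} :
    a ∈ VV J β ↔ ∀ n i : ℕ, 0 < i → (n : ℝ) < i * β → a ^ i ∈ W J n := Iff.rfl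

lemma VV_anti {β γ : ℝ} (h : β ≤ γ) : VV J γ ≤ VV J β := fun a ha n i hi hn =>
  ha n i hi (hn.trans_le (by gcongr))

lemma VV_of_pow_mem {a : R} {i n : ℕ} (hi : 0 < i) (h : a ^ i ∈ W J n) :
    a ∈ VV J ((n : ℝ) / i) := by
  intro n' i' hi' hn'
  refine W_of_pow hi ?_
  have h1 := W_pow_mem h i'
  rw [← pow_mul, mul_comm i i', pow_mul] at h1
  refine W_anti ?_ h1
  have hi0 : (0 : ℝ) < i := by exact_mod_cast hi
  rw [← mul_div_assoc, lt_div_iff₀ hi0] at hn'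
  have : n' * i < i' * n := by exact_mod_cast hn'
  rw [mul_comm i n']; exact this.le

lemma W_le_VV (n : ℕ) : W J n ≤ VV J n := fun a ha => by
  have := VV_of_pow_mem (J := J) (a := a) (i := 1) (n := n) one_pos (by simpa using ha)
  simpa using this

lemma pow_mem_VV {a : R} {j : ℕ} (hj : 0 < j) {β : ℝ} :
    a ^ j ∈ VV J (j * β) ↔ a ∈ VV J β := by
  constructor
  · intro h n i hi hn
    refine W_of_pow hj ?_
    rw [← pow_mul, mul_comm i j, pow_mul]
    refine h (j * n) i hi ?_
    push_cast
    have hj0 : (0 : ℝ) < j := by exact_mod_cast hj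
    nlinarith
  · intro h n i hi hn
    rw [← pow_mul, mul_comm]
    rw [mul_comm]
    refine h n (j * i) (by positivity) ?_
    push_cast; nlinarith

lemma W_mul_VV {c x : R} {e : ℕ} {β : ℝ} (hc : c ∈ W J e) (hx : x ∈ VV J β) :
    c * x ∈ VV J (e + β) := by
  intro n i hi hn
  rw [mul_pow]
  by_cases h : i * e ≤ n
  · have h1 := W_mul_mem (W_pow_mem hc i) (hx (n - i * e) i hi (by
      rw [Nat.cast_sub h]; push_cast; linarith))
    rwa [Nat.add_sub_cancel' h] at h1
  · exact Ideal.mul_mem_right _ _ (W_anti (by omega) (W_pow_mem hc i))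

variable [IsLocalRing R] [IsNoetherianRing R] {d : ℕ} {s : Fin d → R}

/-- standing assumptions -/
structure SU (s : Fin d → R) : Prop where
  hd : 0 < d
  hq : QReg s
  hJ : MP (JJ s)
  hB : ∃ C n0 : ℕ, ∀ n ≥ n0, len (W (JJ s) (n + 1)) ≤ len (W (JJ s) n) + C * Nn d n

lemma SU.mpW (h : SU s) (n : ℕ) : MP (W (JJ s) n) := (h.hJ.pow n).mono (pow_le_W n)

lemma VV_cancel (hs : SU s) {p : ℕ} {f : MvPolynomial (Fin d) R} (hfp : f.IsHomogeneous p)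
    (hf : f ∉ PE d (maximalIdeal R)) {a : R} {β : ℝ}
    (h : MvPolynomial.eval s f * a ∈ VV (JJ s) (p + β)) : a ∈ VV (JJ s) β := by
  intro n i hi hn
  have h1 := h (n + i * p) i hi (by push_cast; linarith)
  have hfi : f ^ i ∉ PE d (maximalIdeal R) := by
    clear h1 hn hi
    induction i with
    | zero =>
      rw [pow_zero]
      intro h1
      have := mem_PE.1 h1 0
      simp only [MvPolynomial.coeff_zero_one] at this
      exact (Ideal.ne_top_iff_one _).1 (maximalIdeal.isMaximal R).ne_top this
    | succ i ih =>
      intro h1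
      rw [pow_succ'] at h1
      exact ih (PE_m_prime h1 hf)
  rw [mul_pow, ← map_pow] at h1
  refine W_cancel hs.hq hs.hJ (hfp.pow i) hfi ?_
  convert h1 using 2
  rw [mul_comm p i, add_comm]

/-- auxiliary chain -/
def YY (J : Ideal R) (b : R) (p n : ℕ) : ℕ → Ideal R
  | 0 => ⊥
  | j + 1 => YY J b p n j ⊔ W J (n - j * p) * Ideal.span {b ^ j}

lemma mem_YY {b : R} {p n : ℕ} : ∀ {j : ℕ} {x : R}, x ∈ YY J b p n j →
    ∃ c : ℕ → R, (∀ l < j, c l ∈ W J (n - l * p)) ∧ x = ∑ l ∈ Finset.range j, c l * b ^ l := by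
  intro j
  induction j with
  | zero => intro x hx; exact ⟨0, by simp, by simpa [YY] using hx⟩
  | succ j ih =>
    intro x hx
    obtain ⟨y, hy, z, hz, rfl⟩ := Submodule.mem_sup.1 hx
    obtain ⟨c, hc, rfl⟩ := ih hy
    obtain ⟨w, hw, rfl⟩ := Ideal.mem_mul_span_singleton.1 hz
    refine ⟨fun l => if l = j then w else c l, fun l hl => ?_, ?_⟩
    · by_cases h : l = j
      · simp only [h, if_true]; exact hw
      · simp only [h, if_false]; exact hc l (by omega)
    · rw [Finset.sum_range_succ]
      simp only [if_true]
      congr 1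
      refine Finset.sum_congr rfl fun l hl => ?_
      rw [if_neg (Finset.mem_range.1 hl).ne]

lemma attain (hs : SU s) {b : R} {p : ℕ} (hb : ∀ l, 0 < l → b ^ l ∈ W (JJ s) (l * p - 1)) :
    b ∈ W (JJ s) p := by
  by_contra hcon
  have hp : 0 < p := by
    rcases Nat.eq_zero_or_pos p with rfl | h
    · exact absurd (by rw [W_zero]; trivial) hcon
    · exact h
  obtain ⟨C, n0, hC⟩ := hs.hB
  have hW : ∀ n j, W (JJ s) n ≤ YY (JJ s) b p n (j + 1) := by
    intro n j
    induction j with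
    | zero => intro x hx; simpa [YY] using hx
    | succ j ih => exact ih.trans le_sup_left
  have hle : ∀ n j, YY (JJ s) b p n j ≤ W (JJ s) (n - 1) := by
    intro n j
    induction j with
    | zero => exact bot_le
    | succ j ih =>
      refine sup_le ih (Ideal.mul_le.2 fun x hx y hy => ?_)
      obtain ⟨z, rfl⟩ := Ideal.mem_span_singleton'.1 hy
      rcases Nat.eq_zero_or_pos j with rfl | hj
      · exact Ideal.mul_mem_right _ _ (W_anti (by omega) hx)
      · rw [mul_left_comm]
        refine Ideal.mul_mem_left _ _ (W_anti ?_ (W_mul_mem hx (hb j hj)))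
        have : 0 < j * p := by positivity
        omega
  have hchain : ∀ n j, j * p ≤ n → len (YY (JJ s) b p n (j + 1)) +
      ∑ l ∈ Finset.range j, Nn d (n - (l + 1) * p) ≤ len (W (JJ s) n) := by
    intro n j
    induction j with
    | zero => intro _; simpa using len_mono (hs.mpW n) (hW n 0)
    | succ j ih =>
      intro hj
      have h1 := ih (by rw [add_mul] at hj; omega)
      have h2 := count_one (s := s) (Y := YY (JJ s) b p n (j + 1)) (Y' := YY (JJ s) b p n (j + 2))
        ((hs.mpW n).mono (hW n j)) le_sup_left (b ^ (j + 1)) (n - (j + 1) * p)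
        (fun c hc => (le_sup_right : _ ≤ YY (JJ s) b p n (j + 2))
          (Ideal.mul_mem_mul (pow_le_W _ hc) (Ideal.mem_span_singleton_self _)))
        (fun f hf hF => by
          by_contra hfm
          apply hcon
          obtain ⟨c, hc, hFc⟩ := mem_YY hF
          set F := MvPolynomial.eval s f with hFdef
          set e := n - (j + 1) * p with he
          have hFW : F ∈ W (JJ s) e := eval_mem_W hf
          have : F * b ∈ W (JJ s) (e + p) := by
            refine W_trans (Nat.succ_pos j) (fun l => c l * F ^ (j - l)) (fun l hl => ?_) ?_
            · have := W_mul_mem (hc l hl) (W_pow_mem hFW (j - l))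
              refine W_anti (le_of_eq ?_) this
              obtain ⟨t, rfl⟩ : ∃ t, j = l + t := ⟨j - l, by omega⟩
              obtain ⟨u, hu⟩ : ∃ u, n = u + (l + t + 1) * p := ⟨e, by omega⟩
              have e1 : n - l * p = u + (t + 1) * p := by
                have : (l + t + 1) * p = l * p + (t + 1) * p := by ring
                omega
              have e2 : e = u := by omega
              have e3 : l + t + 1 - l = t + 1 := by omega
              have e4 : l + t - l = t := by omega
              simp only [Nat.succ_eq_add_one]
              rw [e1, e2, e3, e4]; ring
            · have e1 : (F * b) ^ (j + 1) = F ^ j * (F * b ^ (j + 1)) := by ring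
              rw [Nat.succ_eq_add_one, e1, hFc, Finset.mul_sum]
              refine Finset.sum_congr rfl fun l hl => ?_
              have hl' := Finset.mem_range.1 hl
              have : F ^ j = F ^ (j - l) * F ^ l := by rw [← pow_add]; congr 1; omega
              rw [this]; ring
          exact W_cancel hs.hq hs.hJ hf hfm this)
      rw [Finset.sum_range_succ]
      change len (YY (JJ s) b p n (j + 2)) + _ ≤ _
      omega
  have := Nn_card_le hs.hd (Finset.range (C + 1)) (fun l => (l + 1) * p - 1) C
    (n0 + (C + 1) * p) (fun n hn => by
      have h1 := hchain (n + 1) (C + 1) (by omega)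
      have h2 := len_mono ((hs.mpW (n+1)).mono (hW (n + 1) (C + 1))) (hle (n + 1) (C + 2))
      have h3 := hC n (by omega)
      simp only [Nat.add_sub_cancel] at h2
      have h4 : ∑ l ∈ Finset.range (C + 1), Nn d (n - ((l + 1) * p - 1)) =
          ∑ l ∈ Finset.range (C + 1), Nn d (n + 1 - (l + 1) * p) := by
        refine Finset.sum_congr rfl fun l _ => ?_
        congr 1
        have : 0 < (l + 1) * p := by positivity
        omega
      rw [h4]; omega)
  simp at this

lemma VV_nat (hs : SU s) (n : ℕ) : VV (JJ s) n = W (JJ s) n := by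
  refine le_antisymm (fun a ha => ?_) (W_le_VV n)
  rcases Nat.eq_zero_or_pos n with rfl | hn
  · rw [W_zero]; trivial
  · refine attain hs fun l hl => ha _ l hl ?_
    have : l * n - 1 < l * n := Nat.sub_lt (by positivity) one_pos
    exact_mod_cast this

lemma MP_VV (hs : SU s) (β : ℝ) : MP (VV (JJ s) β) := by
  obtain ⟨n, hn⟩ := exists_nat_ge β
  exact (hs.mpW n).mono ((W_le_VV n).trans (VV_anti hn))

theorem reduced_exponent (hs : SU s) : ∃ q : ℕ, 0 < q ∧ ∀ (a : R) (t m : ℕ), 0 < t →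
    a ^ (q * t) ∈ W (JJ s) (m * t + 1) → a ^ q ∈ W (JJ s) (m + 1) := by
  obtain ⟨C, n0, hC⟩ := hs.hB
  refine ⟨C.factorial, Nat.factorial_pos _, fun a t m ht h => ?_⟩
  set q := C.factorial with hqdef
  have hq0 : 0 < q := Nat.factorial_pos _
  by_cases hbdd : BddAbove {β : ℝ | a ∈ VV (JJ s) β}
  swap
  · have h1 : ∃ β ∈ {β : ℝ | a ∈ VV (JJ s) β}, ((m + 1 : ℕ) : ℝ) < β := not_bddAbove_iff.1 hbdd _
    obtain ⟨β, hβ, hm⟩ := h1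
    have h2 : a ∈ W (JJ s) (m + 1) := by rw [← VV_nat hs]; exact VV_anti hm.le hβ
    have h3 := W_pow_mem h2 q
    exact W_anti (Nat.le_mul_of_pos_left _ hq0) h3
  set α := sSup {β : ℝ | a ∈ VV (JJ s) β} with hα
  have hne : {β : ℝ | a ∈ VV (JJ s) β}.Nonempty := ⟨0, fun n i _ hn => by
    exfalso; rw [mul_zero] at hn; exact absurd hn (not_lt.2 (Nat.cast_nonneg n))⟩
  have hαmem : a ∈ VV (JJ s) α := by
    intro n i hi hn
    have hi0 : (0 : ℝ) < i := by exact_mod_cast hi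
    have h1 : (n : ℝ) / i < α := by rw [div_lt_iff₀ hi0]; linarith
    obtain ⟨β, hβ, hlt⟩ := exists_lt_of_lt_csSup hne h1
    refine hβ n i hi ?_
    rw [div_lt_iff₀ hi0] at hlt; linarith
  have hα0 : 0 ≤ α := le_csSup hbdd (by
    intro n i _ hn
    exfalso; rw [mul_zero] at hn; exact absurd hn (not_lt.2 (Nat.cast_nonneg n)))
  have hle : ∀ β, a ∈ VV (JJ s) β → β ≤ α := fun β hβ => le_csSup hbdd hβ
  have hpow : ∀ j : ℕ, 0 < j → ∀ β, a ^ j ∈ VV (JJ s) β → β ≤ j * α := by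
    intro j hj β hβ
    have hj0 : (0 : ℝ) < j := by exact_mod_cast hj
    have e1 : β = j * (β / j) := by field_simp
    rw [e1, pow_mem_VV hj] at hβ
    rw [e1]
    exact mul_le_mul_of_nonneg_left (hle _ hβ) hj0.le
  have h_intg : ∃ u : ℕ, 0 < u ∧ u ≤ C ∧ ∃ z : ℤ, u * α = z := by
    by_contra hcon
    push Not at hcon
    set S := Finset.Icc 1 (C + 1) with hS
    set w : ℕ → ℝ := fun j => Int.fract (j * α) with hw
    have hlt : ∀ i j : ℕ, 1 ≤ i → i < j → j ≤ C + 1 → w i ≠ w j := by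
      intro i j hi hij hj heq
      obtain ⟨z, hz⟩ := Int.fract_eq_fract.1 heq.symm
      refine hcon (j - i) (by omega) (by omega) z ?_
      rw [← hz, Nat.cast_sub hij.le]; ring
    have hinj : ∀ i ∈ S, ∀ j ∈ S, i ≠ j → w i ≠ w j := by
      intro i hi j hj hij
      have hi' := Finset.mem_Icc.1 hi
      have hj' := Finset.mem_Icc.1 hj
      rcases lt_or_gt_of_ne hij with h | h
      · exact hlt i j hi'.1 h hj'.2
      · exact (hlt j i hj'.1 h hi'.2).symm
    have hchain : ∀ n : ℕ, (∀ j ∈ S, ⌊(j : ℝ) * α⌋₊ ≤ n) → ∀ T : Finset ℕ, T ⊆ S →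
        ∀ β : ℝ, (∀ j ∈ T, β ≤ w j) → β ≤ 1 →
        len (VV (JJ s) (n + β)) + ∑ j ∈ T, Nn d (n - ⌊(j : ℝ) * α⌋₊) ≤ len (VV (JJ s) (n + 1)) := by
      intro n hn T
      refine Finset.induction_on_min_value w T ?_ ?_
      · intro _ β _ hβ
        simpa using len_mono (MP_VV hs _) (VV_anti (by linarith : (n : ℝ) + β ≤ n + 1))
      · intro j T hj hmin ih hTS β hβ _
        have hjS : j ∈ S := hTS (Finset.mem_insert_self _ _)
        have hj0 : 0 < j := (Finset.mem_Icc.1 hjS).1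
        set β' := (insert 1 (T.image w)).min' (Finset.insert_nonempty _ _) with hβ'
        have hβ'1 : β' ≤ 1 := Finset.min'_le _ _ (Finset.mem_insert_self _ _)
        have hβ'T : ∀ x ∈ T, β' ≤ w x := fun x hx =>
          Finset.min'_le _ _ (Finset.mem_insert_of_mem (Finset.mem_image_of_mem _ hx))
        have hβ'j : w j < β' := by
          rw [hβ', Finset.lt_min'_iff]
          intro y hy
          rcases Finset.mem_insert.1 hy with rfl | hy
          · exact Int.fract_lt_one _
          · obtain ⟨x, hx, rfl⟩ := Finset.mem_image.1 hy
            refine lt_of_le_of_ne (hmin x hx) ?_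
            exact hinj j hjS x (hTS (Finset.mem_insert_of_mem hx)) (fun h => hj (h ▸ hx))
        have h1 := ih (fun x hx => hTS (Finset.mem_insert_of_mem hx)) β' hβ'T hβ'1
        have hfl : (⌊(j : ℝ) * α⌋₊ : ℝ) + w j = j * α := by
          have h0 : 0 ≤ (j : ℝ) * α := by positivity
          rw [natCast_floor_eq_intCast_floor h0]
          exact Int.floor_add_fract _
        have hcast : ((n - ⌊(j : ℝ) * α⌋₊ : ℕ) : ℝ) = n - ⌊(j : ℝ) * α⌋₊ := Nat.cast_sub (hn j hjS)
        have h2 := count_one (s := s) (Y := VV (JJ s) (n + β')) (Y' := VV (JJ s) (n + w j))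
          (MP_VV hs _) (VV_anti (by linarith)) (a ^ j) (n - ⌊(j : ℝ) * α⌋₊)
          (fun c hc => by
            have := W_mul_VV (pow_le_W _ hc) ((pow_mem_VV hj0).2 hαmem)
            refine VV_anti (le_of_eq ?_) this
            rw [hcast]; linarith)
          (fun f hf hF => by
            by_contra hfm
            have h3 : a ^ j ∈ VV (JJ s) (⌊(j : ℝ) * α⌋₊ + β') := by
              refine VV_cancel hs hf hfm ?_
              refine VV_anti (le_of_eq ?_) hF
              rw [hcast]; ring
            have := hpow j hj0 _ h3
            linarith)
        have h3 : len (VV (JJ s) (n + β)) ≤ len (VV (JJ s) (n + w j)) :=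
          len_mono (MP_VV hs _) (VV_anti (by
            have := hβ j (Finset.mem_insert_self _ _); linarith))
        rw [Finset.sum_insert hj]
        omega
    have := Nn_card_le hs.hd S (fun j => ⌊(j : ℝ) * α⌋₊) C (n0 + ∑ j ∈ S, ⌊(j : ℝ) * α⌋₊)
      (fun n hn => by
        have h1 := hchain n (fun j hj => le_trans (Finset.single_le_sum
          (f := fun j : ℕ => ⌊(j : ℝ) * α⌋₊) (fun _ _ => Nat.zero_le _) hj) (by omega)) S
          (Finset.Subset.refl _) 0 (fun j _ => Int.fract_nonneg _) zero_le_one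
        have e2 : (n : ℝ) + 1 = ((n + 1 : ℕ) : ℝ) := by push_cast; ring
        rw [add_zero, e2, VV_nat hs, VV_nat hs] at h1
        have := hC n (by omega)
        omega)
    rw [hS, Nat.card_Icc] at this
    omega
  obtain ⟨u, hu0, huC, z, hz⟩ := h_intg
  obtain ⟨v, hv⟩ : u ∣ q := Nat.dvd_factorial hu0 huC
  have hqα : (q : ℝ) * α = ((v * z : ℤ) : ℝ) := by
    rw [hv]; push_cast; rw [← hz]; ring
  have ht0 : (0 : ℝ) < t := by exact_mod_cast ht
  have hq0' : (0 : ℝ) < q := by exact_mod_cast hq0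
  have h1 := hle _ (VV_of_pow_mem (by positivity) h)
  rw [div_le_iff₀ (by positivity)] at h1
  push_cast at h1
  have h2 : (m : ℝ) < (q : ℝ) * α := by
    by_contra hc
    push Not at hc
    have := mul_le_mul_of_nonneg_right hc ht0.le
    nlinarith
  rw [hqα] at h2
  have h3 : ((m + 1 : ℕ) : ℝ) ≤ (q : ℝ) * α := by
    rw [hqα]
    have : (m : ℤ) < v * z := by exact_mod_cast h2
    have : ((m + 1 : ℕ) : ℤ) ≤ v * z := by push_cast; omega
    exact_mod_cast this
  rw [← VV_nat hs]
  exact VV_anti h3 ((pow_mem_VV hq0).2 hαmem)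

end PartF

/-! ### Part G: a finiteness criterion for reduced algebras over polynomial rings -/
section PartG
open TensorProduct

lemma finite_of_functionals {B M : Type*} [CommRing B] [IsDomain B] [IsNoetherianRing B]
    [AddCommGroup M] [Module B M] (Y : Finset M)
    (hY : ∀ z : M, ∃ b : B, b ≠ 0 ∧ b • z ∈ Submodule.span B (Y : Set M))
    (hf : ∀ y : M, y ≠ 0 → ∃ l : M →ₗ[B] B, l y ≠ 0) : Module.Finite B M := by
  let ev : (M →ₗ[B] B) →ₗ[B] (Y → B) := LinearMap.pi fun y => LinearMap.applyₗ (y : M)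
  have hev : Function.Injective ev := by
    refine (injective_iff_map_eq_zero ev).2 fun l hl => ?_
    ext z
    obtain ⟨b, hb, hz⟩ := hY z
    have h1 : Submodule.span B (Y : Set M) ≤ LinearMap.ker l := Submodule.span_le.2 fun y hy =>
      congrFun hl ⟨y, hy⟩
    have h2 : l (b • z) = 0 := h1 hz
    rw [map_smul, smul_eq_mul] at h2
    exact (mul_eq_zero.1 h2).resolve_left hb
  have hfin : Module.Finite B (M →ₗ[B] B) := Module.Finite.of_injective ev hev
  obtain ⟨T, hT⟩ := hfin.fg_top
  let g : M →ₗ[B] (T → B) := LinearMap.pi fun l => (l : M →ₗ[B] B)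
  refine Module.Finite.of_injective g ?_
  refine (injective_iff_map_eq_zero g).2 fun z hz => ?_
  by_contra hne
  obtain ⟨l, hl⟩ := hf z hne
  have h1 : Submodule.span B (T : Set (M →ₗ[B] B)) ≤ LinearMap.ker (LinearMap.applyₗ (R := B) (M₂ := B) z) :=
    Submodule.span_le.2 fun l hl => congrFun hz ⟨l, hl⟩
  rw [hT] at h1
  exact hl (h1 (Submodule.mem_top : l ∈ ⊤))

/-- A copy of a field, used to carry the module structure through Frobenius. -/
def FrobCopy (k : Type*) : Type _ := k

instance (k : Type*) [Field k] : AddCommGroup (FrobCopy k) := inferInstanceAs (AddCommGroup k)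

lemma exists_field_functional (k : Type*) [Field k] (p n : ℕ) [ExpChar k p] (c : k) (hc : c ≠ 0) :
    ∃ ψ : k →+ k, (∀ a x, ψ (a ^ p ^ n * x) = a * ψ x) ∧ ψ c ≠ 0 := by
  let M : Module k (FrobCopy k) := Module.compHom k (_root_.iterateFrobenius k p n)
  have h : ∃ l : Module.Dual k (FrobCopy k), l (c : k) ≠ 0 := by
    by_contra hcon
    push Not at hcon
    exact hc ((Module.forall_dual_apply_eq_zero_iff k (V := FrobCopy k) c).1 hcon)
  obtain ⟨l, hl⟩ := h
  refine ⟨l.toAddMonoidHom, fun a x => ?_, hl⟩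
  exact l.map_smul a x

lemma exists_poly_functional {d : ℕ} (k : Type*) [Field k] (p n : ℕ) [ExpChar k p]
    (y : MvPolynomial (Fin d) k) (hy : y ≠ 0) :
    ∃ Λ : MvPolynomial (Fin d) k →+ MvPolynomial (Fin d) k,
      (∀ b x, Λ (b ^ p ^ n * x) = b * Λ x) ∧ Λ y ≠ 0 := by
  classical
  obtain ⟨μ₀, hμ₀⟩ := MvPolynomial.ne_zero_iff.1 hy
  obtain ⟨ψ, hψ, hψ0⟩ := exists_field_functional k p n _ hμ₀
  set q := p ^ n with hq
  have hq0 : 0 < q := pow_pos (expChar_pos k p) n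
  let a : Fin d →₀ ℕ := Finsupp.equivFunOnFinite.symm fun i => μ₀ i % q
  have ha : ∀ i, a i = μ₀ i % q := fun i => rfl
  let dv : (Fin d →₀ ℕ) → (Fin d →₀ ℕ) := fun μ => Finsupp.equivFunOnFinite.symm fun i => μ i / q
  have hdv : ∀ ν : Fin d →₀ ℕ, dv (q • ν + a) = ν := by
    intro ν
    ext i
    change (q • ν + a) i / q = ν i
    simp only [Finsupp.add_apply, Finsupp.smul_apply, smul_eq_mul, ha]
    rw [Nat.mul_add_div hq0, Nat.div_eq_of_lt (Nat.mod_lt _ hq0), add_zero]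
  let L : MvPolynomial (Fin d) k → MvPolynomial (Fin d) k := fun x =>
    ∑ ν ∈ x.support.image dv, MvPolynomial.monomial ν (ψ (MvPolynomial.coeff (q • ν + a) x))
  have hL : ∀ x ν, MvPolynomial.coeff ν (L x) = ψ (MvPolynomial.coeff (q • ν + a) x) := by
    intro x ν
    simp only [L, MvPolynomial.coeff_sum, MvPolynomial.coeff_monomial]
    rw [Finset.sum_ite_eq']
    split_ifs with h
    · rfl
    · have : MvPolynomial.coeff (q • ν + a) x = 0 := by
        by_contra hne
        exact h (Finset.mem_image.2 ⟨_, MvPolynomial.mem_support_iff.2 hne, hdv ν⟩)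
      rw [this, map_zero]
  have hadd : ∀ x y, L (x + y) = L x + L y := fun x y => by
    ext ν; rw [MvPolynomial.coeff_add, hL, hL, hL, MvPolynomial.coeff_add, map_add]
  let Λ : MvPolynomial (Fin d) k →+ MvPolynomial (Fin d) k := AddMonoidHom.mk' L hadd
  have hchar : ExpChar (MvPolynomial (Fin d) k) p := inferInstance
  refine ⟨Λ, fun b => ?_, fun h => ?_⟩
  · change ∀ x, L (b ^ q * x) = b * L x
    induction b using MvPolynomial.induction_on with
    | C c =>
      intro x
      ext ν
      rw [← map_pow, hL, MvPolynomial.coeff_C_mul, MvPolynomial.coeff_C_mul, hL, hψ]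
    | add f g hf hg =>
      intro x
      rw [hq, add_pow_expChar_pow, ← hq, add_mul, hadd, hf, hg, add_mul]
    | mul_X f i hf =>
      intro x
      rw [mul_pow, mul_assoc, hf, mul_assoc]
      congr 1
      ext ν
      rw [hL, MvPolynomial.X_pow_eq_monomial, MvPolynomial.coeff_monomial_mul',
        MvPolynomial.coeff_X_mul', one_mul]
      have hlt : a i < q := by rw [ha]; exact Nat.mod_lt _ hq0
      by_cases hi : ν i = 0
      · rw [if_neg, if_neg, map_zero]
        · simpa using hi
        · rw [Finsupp.single_le_iff]
          simp only [Finsupp.add_apply, Finsupp.smul_apply, smul_eq_mul, hi]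
          omega
      · rw [if_pos, if_pos, hL]
        · congr 2
          have hi1 : Finsupp.single i 1 ≤ ν := Finsupp.single_le_iff.2 (Nat.pos_of_ne_zero hi)
          ext j
          simp only [Finsupp.coe_tsub, Pi.sub_apply, Finsupp.add_apply, Finsupp.smul_apply,
            smul_eq_mul]
          by_cases hij : j = i
          · subst hij
            simp only [Finsupp.single_eq_same]
            obtain ⟨t, ht⟩ : ∃ t, ν j = t + 1 := ⟨ν j - 1, by omega⟩
            rw [ht, Nat.add_sub_cancel, mul_add, mul_one]; omega
          · rw [Finsupp.single_eq_of_ne hij, Finsupp.single_eq_of_ne hij]; simp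
        · simpa using hi
        · rw [Finsupp.single_le_iff]
          simp only [Finsupp.add_apply, Finsupp.smul_apply, smul_eq_mul]
          have : q * 1 ≤ q * ν i := Nat.mul_le_mul_left q (Nat.pos_of_ne_zero hi)
          omega
  · have h1 : MvPolynomial.coeff (dv μ₀) (L y) = 0 := by
      have : L y = 0 := h
      rw [this]; simp
    rw [hL] at h1
    have h2 : q • dv μ₀ + a = μ₀ := by
      ext i
      change q * (μ₀ i / q) + μ₀ i % q = μ₀ i
      exact Nat.div_add_mod _ _
    rw [h2] at h1
    exact hψ0 h1

lemma exists_functional_of_field {d : ℕ} (k : Type*) [Field k] {K F D : Type*} [Field K] [Field F]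
    [Algebra (MvPolynomial (Fin d) k) K] [IsFractionRing (MvPolynomial (Fin d) k) K]
    [Algebra K F] [Algebra (MvPolynomial (Fin d) k) F]
    [IsScalarTower (MvPolynomial (Fin d) k) K F] [FiniteDimensional K F] [CommRing D]
    [Algebra (MvPolynomial (Fin d) k) D] [Algebra.IsIntegral (MvPolynomial (Fin d) k) D]
    (φ : D →ₐ[MvPolynomial (Fin d) k] F) (y : D) (hy : φ y ≠ 0) :
    ∃ l : D →ₗ[MvPolynomial (Fin d) k] MvPolynomial (Fin d) k, l y ≠ 0 := by
  set B := MvPolynomial (Fin d) k with hB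
  obtain ⟨p, hp⟩ := ExpChar.exists k
  have hpB : ExpChar B p := inferInstanceAs (ExpChar (MvPolynomial (Fin d) k) p)
  have hpK : ExpChar K p := expChar_of_injective_algebraMap (IsFractionRing.injective B K) p
  let E := separableClosure K F
  haveI : IsScalarTower B E F := IsScalarTower.of_algebraMap_eq fun b => rfl
  have hpE : ExpChar E p := expChar_of_injective_algebraMap (algebraMap K E).injective p
  have hpF : ExpChar F p := expChar_of_injective_algebraMap (algebraMap K F).injective p
  obtain ⟨n, hn⟩ := (IsPurelyInseparable.hasExponent_iff' (K := E) (L := F) p).1 inferInstance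
  choose ζ hζ using hn
  have hζadd : ∀ a b, ζ (a + b) = ζ a + ζ b := fun a b => by
    apply (algebraMap E F).injective
    rw [map_add, hζ, hζ, hζ, add_pow_expChar_pow]
  have hζsmul : ∀ (b : B) (a : F), ζ (algebraMap B F b * a) = algebraMap B E (b ^ p ^ n) * ζ a := by
    intro b a
    apply (algebraMap E F).injective
    rw [map_mul, hζ, hζ, mul_pow, ← IsScalarTower.algebraMap_apply B E F, map_pow]
  have hy' : ζ (φ y) ≠ 0 := by
    intro h
    have := hζ (φ y)
    rw [h, map_zero] at this
    exact hy (pow_eq_zero_iff (pow_pos (expChar_pos k p) n).ne' |>.1 this.symm)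
  have hnd := (traceForm_nondegenerate K E).1
  have hex : ∃ c : E, Algebra.trace K E (ζ (φ y) * c) ≠ 0 := by
    by_contra hcon
    push Not at hcon
    exact hy' (hnd _ hcon)
  obtain ⟨c, hc⟩ := hex
  have halg : IsAlgebraic B c := by
    have : Algebra.IsAlgebraic B E := by
      have := IsLocalization.isAlgebraic K (nonZeroDivisors B)
      exact Algebra.IsAlgebraic.trans B K E
    exact Algebra.IsAlgebraic.isAlgebraic c
  obtain ⟨b₀, hb₀, h_intg⟩ := halg.exists_integral_multiple
  have hint2 : ∀ z : D, IsIntegral B (Algebra.trace K E (ζ (φ z) * (b₀ • c))) := by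
    intro z
    refine Algebra.isIntegral_trace (IsIntegral.mul ?_ h_intg)
    have h1 : IsIntegral B (algebraMap E F (ζ (φ z))) := by
      rw [hζ]
      exact ((Algebra.IsIntegral.isIntegral z).map φ).pow _
    exact (isIntegral_algebraMap_iff (algebraMap E F).injective).1 h1
  have hint3 : ∀ z : D, ∃ b : B, algebraMap B K b = Algebra.trace K E (ζ (φ z) * (b₀ • c)) :=
    fun z => IsIntegrallyClosed.isIntegral_iff.1 (hint2 z)
  choose g hg using hint3
  have hinj := IsFractionRing.injective B K
  have hgadd : ∀ z z', g (z + z') = g z + g z' := fun z z' => hinj (by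
    rw [map_add, hg, hg, hg, map_add φ, hζadd, add_mul, map_add])
  have hgsmul : ∀ (b : B) z, g (b • z) = b ^ p ^ n * g z := fun b z => hinj (by
    rw [map_mul, hg, hg, map_smul φ, Algebra.smul_def, hζsmul, mul_assoc,
      IsScalarTower.algebraMap_apply B K E, ← Algebra.smul_def, map_smul, smul_eq_mul])
  have hgy : g y ≠ 0 := by
    intro h
    have := hg y
    rw [h, map_zero, mul_smul_comm, ← IsScalarTower.algebraMap_smul K b₀, map_smul,
      smul_eq_mul] at this
    rcases mul_eq_zero.1 this.symm with h1 | h1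
    · exact hb₀ (hinj (by rw [h1, map_zero]))
    · exact hc h1
  obtain ⟨Λ, hΛ, hΛ0⟩ := exists_poly_functional k p n (g y) hgy
  exact ⟨{ toFun := fun z => Λ (g z)
           map_add' := fun z z' => by rw [hgadd, map_add]
           map_smul' := fun b z => by rw [hgsmul, hΛ]; rfl }, hΛ0⟩

theorem finite_of_reduced {d : ℕ} (k : Type*) [Field k] {G : Type*} [CommRing G] [IsReduced G]
    [Algebra (MvPolynomial (Fin d) k) G] [Algebra.IsIntegral (MvPolynomial (Fin d) k) G]
    (htf : ∀ (b : MvPolynomial (Fin d) k) (z : G), b ≠ 0 → b • z = 0 → z = 0)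
    (Y : Finset G) (hY : ∀ z : G, ∃ b : MvPolynomial (Fin d) k, b ≠ 0 ∧
      b • z ∈ Submodule.span (MvPolynomial (Fin d) k) (Y : Set G)) :
    Module.Finite (MvPolynomial (Fin d) k) G := by
  refine finite_of_functionals Y hY fun y hy => ?_
  set B := MvPolynomial (Fin d) k with hB
  let K := FractionRing B
  let L := TensorProduct B K G
  let ι : G →ₐ[B] L := Algebra.TensorProduct.includeRight
  have hι0 : ∀ z, ι z = 0 → z = 0 := by
    intro z hz
    have h1 : (TensorProduct.mk B K G 1) z = 0 := hz
    obtain ⟨c, hc⟩ := (IsLocalizedModule.eq_zero_iff (nonZeroDivisors B) (TensorProduct.mk B K G 1)).1 h1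
    exact htf c z (nonZeroDivisors.ne_zero c.2) hc
  have hfin : Module.Finite K L := by
    classical
    refine ⟨⟨Y.image ι, ?_⟩⟩
    rw [eq_top_iff]
    rintro x -
    have hz : ∀ z : G, ι z ∈ Submodule.span K ((Y.image ι : Finset L) : Set L) := by
      intro z
      obtain ⟨b, hb, hbz⟩ := hY z
      have h1 : ι (b • z) ∈ Submodule.span K ((Y.image ι : Finset L) : Set L) := by
        have h2 : Submodule.span B (Y : Set G) ≤
          (Submodule.restrictScalars B (Submodule.span K ((Y.image ι : Finset L) : Set L))).comap
            ι.toLinearMap := Submodule.span_le.2 fun w hw =>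
              Submodule.subset_span (by rw [Finset.coe_image]; exact ⟨w, hw, rfl⟩)
        exact h2 hbz
      rw [map_smul, ← IsScalarTower.algebraMap_smul K b] at h1
      have hb' : algebraMap B K b ≠ 0 := by
        intro h; exact hb ((IsFractionRing.injective B K) (by rw [h, map_zero]))
      have := Submodule.smul_mem _ (algebraMap B K b)⁻¹ h1
      rwa [smul_smul, inv_mul_cancel₀ hb', one_smul] at this
    induction x using TensorProduct.induction_on with
    | zero => exact Submodule.zero_mem _
    | add x y hx hy => exact Submodule.add_mem _ hx hy
    | tmul c z =>
      have : (c ⊗ₜ[B] z : L) = c • ι z := by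
        change _ = c • ((1 : K) ⊗ₜ[B] z)
        rw [TensorProduct.smul_tmul', smul_eq_mul, mul_one]
      rw [this]
      exact Submodule.smul_mem _ _ (hz z)
  have hart : IsArtinianRing L := IsArtinianRing.of_finite K L
  have hnil : ¬ IsNilpotent (ι y) := by
    rintro ⟨n, hn⟩
    rw [← map_pow] at hn
    exact hy (eq_zero_of_pow_eq_zero (hι0 _ hn))
  rw [← mem_nilradical, nilradical_eq_sInf, Ideal.mem_sInf] at hnil
  push Not at hnil
  obtain ⟨M, hM, hyM⟩ := hnil
  have hMp : M.IsPrime := hM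
  have hMm : M.IsMaximal := inferInstance
  letI : Field (L ⧸ M) := Ideal.Quotient.field M
  refine exists_functional_of_field k (K := K) (F := L ⧸ M)
    ((Ideal.Quotient.mkₐ B M).comp ι) y ?_
  intro h
  exact hyM (Ideal.Quotient.eq_zero_iff_mem.1 h)

end PartG

/-! ### Part I: Chevalley-type lemma for analytically unramified local rings -/
section PartI

theorem adic_noetherian {R : Type*} [CommRing R] [IsNoetherianRing R] (I : Ideal R) :
    IsNoetherianRing (AdicCompletion I R) := by
  classical
  obtain ⟨n, s, hs⟩ := Submodule.fg_iff_exists_fin_generating_family.1 (IsNoetherian.noetherian I)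
  let P := MvPolynomial (Fin n) R
  let V : Ideal P := MvPolynomial.idealOfVars (Fin n) R
  let ev : P →+* R := MvPolynomial.eval s
  have hsurj : Function.Surjective ev := fun r => ⟨MvPolynomial.C r, MvPolynomial.eval_C r⟩
  have hmap : V.map ev = I := by
    rw [← hs]
    change Ideal.map ev (Ideal.span (Set.range MvPolynomial.X)) = Ideal.span (Set.range s)
    rw [Ideal.map_span, ← Set.range_comp]
    congr 2
    ext i
    exact MvPolynomial.eval_X i
  have hmapn : ∀ j, (V ^ j).map ev = I ^ j := fun j => by rw [Ideal.map_pow, hmap]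
  have hP : IsNoetherianRing (AdicCompletion V P) :=
    isNoetherianRing_of_ringEquiv _ (MvPowerSeries.toAdicCompletionAlgEquiv (Fin n) R).toRingEquiv
  have hle : ∀ j, V ^ j ≤ (I ^ j).comap ev := fun j => by
    rw [← hmapn j]; exact Ideal.le_comap_map
  let f : (j : ℕ) → AdicCompletion V P →+* R ⧸ I ^ j := fun j =>
    (Ideal.quotientMap (I ^ j) ev (hle j)).comp (AdicCompletion.evalₐ V j : _ →+* _)
  have hfmk : ∀ (x : AdicCompletion.AdicCauchySequence V P) j,
      f j (AdicCompletion.mk V P x) = Ideal.Quotient.mk (I ^ j) (ev (x j)) := by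
    intro x j
    simp only [f, RingHom.comp_apply]
    change Ideal.quotientMap (I ^ j) ev (hle j) (AdicCompletion.evalₐ V j (AdicCompletion.mk V P x)) = _
    rw [AdicCompletion.evalₐ_mk, Ideal.quotientMap_mk]
  have hf : ∀ {i j : ℕ} (hij : i ≤ j), (Ideal.Quotient.factorPow I hij).comp (f j) = f i := by
    intro i j hij
    ext x
    obtain ⟨x, rfl⟩ := AdicCompletion.mk_surjective V P x
    rw [RingHom.comp_apply, hfmk, hfmk]
    change Ideal.Quotient.mk (I ^ i) (ev (x j)) = _
    rw [Ideal.Quotient.eq, ← map_sub]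
    apply hle
    have := (x.2 hij).symm
    rw [SModEq.sub_mem] at this
    simpa using this
  let φ := AdicCompletion.liftRingHom I f hf
  refine isNoetherianRing_of_surjective _ _ φ ?_
  intro y
  obtain ⟨y, rfl⟩ := AdicCompletion.mk_surjective I R y
  have hstep : ∀ (j : ℕ) (p : {p : P // ev p - y j ∈ I ^ j}),
      ∃ p' : {p : P // ev p - y (j + 1) ∈ I ^ (j + 1)}, p'.1 - p.1 ∈ V ^ j := by
    rintro j ⟨p, hp⟩
    have h1 : y (j + 1) - ev p ∈ I ^ j := by
      have h2 := (y.2 (Nat.le_succ j)).symm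
      rw [SModEq.sub_mem] at h2
      have h3 : y (j + 1) - y j ∈ I ^ j := by simpa using h2
      have := sub_mem h3 hp
      have h4 : y (j + 1) - ev p = y (j + 1) - y j - (ev p - y j) := by ring
      rwa [h4]
    rw [← hmapn j, Ideal.mem_map_iff_of_surjective ev hsurj] at h1
    obtain ⟨u, hu, hu'⟩ := h1
    refine ⟨⟨p + u, ?_⟩, ?_⟩
    · rw [map_add, hu']
      have : ev p + (y (j + 1) - ev p) - y (j + 1) = 0 := by ring
      rw [this]; exact zero_mem _
    · simpa using hu
  choose g hg using hstep
  let q : (j : ℕ) → {p : P // ev p - y j ∈ I ^ j} := fun j => Nat.rec ⟨0, by simp⟩ g j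
  have hq : ∀ j, (q (j + 1)).1 - (q j).1 ∈ V ^ j := fun j => hg j (q j)
  let x : AdicCompletion.AdicCauchySequence V P := AdicCompletion.AdicCauchySequence.mk V P
    (fun j => (q j).1) (fun j => by
      symm
      rw [SModEq.sub_mem]
      simpa using hq j)
  refine ⟨AdicCompletion.mk V P x, ?_⟩
  apply AdicCompletion.ext_evalₐ
  intro j
  rw [AdicCompletion.evalₐ_liftRingHom, hfmk, AdicCompletion.evalₐ_mk, Ideal.Quotient.eq]
  exact (q j).2

theorem nilpotent_of_order {S : Type*} [CommRing S] [IsLocalRing S] [IsNoetherianRing S] (a : S)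
    (h : ∀ n, ∃ N, ∀ i, a ^ i ∈ maximalIdeal S ^ (i * n - N)) : IsNilpotent a := by
  classical
  by_contra hnil
  set m := maximalIdeal S with hm
  have hne : {p : Ideal S | p.IsPrime ∧ a ∉ p}.Nonempty := by
    rw [← mem_nilradical, nilradical_eq_sInf, Ideal.mem_sInf] at hnil
    push Not at hnil
    obtain ⟨M, hM, hyM⟩ := hnil
    exact ⟨M, hM, hyM⟩
  obtain ⟨Q, ⟨hQp, haQ⟩, hQmax⟩ : ∃ Q : Ideal S, (Q.IsPrime ∧ a ∉ Q) ∧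
      ∀ p : Ideal S, (p.IsPrime ∧ a ∉ p) → ¬ Q < p :=
    set_has_maximal_iff_noetherian.2 (inferInstance : IsNoetherian S S) _ hne
  have hgt : ∀ p : Ideal S, p.IsPrime → Q < p → a ∈ p := by
    intro p hp hlt
    by_contra hap
    exact hQmax p ⟨hp, hap⟩ hlt
  have ham : a ∈ m := by
    obtain ⟨N, hN⟩ := h 1
    have h1 := hN (N + 1)
    rw [show (N + 1) * 1 - N = 1 by omega, pow_one] at h1
    exact (inferInstance : m.IsPrime).mem_of_pow_mem _ h1
  have hQm : Q ≤ m := le_maximalIdeal hQp.ne_top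
  have hle : Q ⊔ Ideal.span {a} ≤ m := sup_le hQm ((Ideal.span_singleton_le_iff_mem _).2 ham)
  have hmin : m ∈ (Q ⊔ Ideal.span {a}).minimalPrimes := by
    by_contra hcon
    have hfin : (Q ⊔ Ideal.span {a}).minimalPrimes.Finite :=
      Ideal.finite_minimalPrimes_of_isNoetherianRing S _
    have hav : ¬ ((m : Set S) ⊆ ⋃ i ∈ (↑hfin.toFinset : Set (Ideal S)), (i : Set S)) := by
      rw [Ideal.subset_union_prime ⊥ ⊥ (fun i hi _ _ => (hfin.mem_toFinset.1 hi).1.1)]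
      rintro ⟨i, hi, hmi⟩
      have hi' := hfin.mem_toFinset.1 hi
      have : i = m := le_antisymm (le_maximalIdeal hi'.1.1.ne_top) hmi
      exact hcon (this ▸ hi')
    rw [Set.not_subset] at hav
    obtain ⟨x, hxm, hx⟩ := hav
    simp only [Set.mem_iUnion, not_exists] at hx
    have hx' : ∀ p ∈ (Q ⊔ Ideal.span {a}).minimalPrimes, x ∉ p := fun p hp =>
      hx p (by simpa using hp)
    have hlex : Q ⊔ Ideal.span {x} ≤ m := sup_le hQm ((Ideal.span_singleton_le_iff_mem _).2 hxm)
    obtain ⟨p, hp, -⟩ := Ideal.exists_minimalPrimes_le hlex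
    have hpp : p.IsPrime := hp.1.1
    have hxp : x ∈ p := hp.1.2 (Ideal.mem_sup_right (Ideal.mem_span_singleton_self x))
    have hQp' : Q ≤ p := le_sup_left.trans hp.1.2
    have hxQ : x ∉ Q := by
      obtain ⟨p1, hp1, -⟩ := Ideal.exists_minimalPrimes_le hle
      intro hxQ
      exact hx' p1 hp1 (hp1.1.2 (Ideal.mem_sup_left hxQ))
    have hQlt : Q < p := lt_of_le_of_ne hQp' (fun h => hxQ (h ▸ hxp))
    have hap : a ∈ p := hgt p hpp hQlt
    obtain ⟨p1, hp1, hp1p⟩ := Ideal.exists_minimalPrimes_le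
      (sup_le hQp' ((Ideal.span_singleton_le_iff_mem _).2 hap) : Q ⊔ Ideal.span {a} ≤ p)
    have hp1p' : p1.IsPrime := hp1.1.1
    have hQp1 : Q ≤ p1 := le_sup_left.trans hp1.1.2
    have hht := Ideal.map_height_le_one_of_mem_minimalPrimes hp
    have hker : ∀ {r : Ideal S}, Q ≤ r → (r.map (Ideal.Quotient.mk Q)).comap (Ideal.Quotient.mk Q) = r := by
      intro r hr
      rw [Ideal.comap_map_of_surjective _ Ideal.Quotient.mk_surjective, ← RingHom.ker_eq_comap_bot,
        Ideal.mk_ker, sup_eq_left.2 hr]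
    have hpr1 : (p1.map (Ideal.Quotient.mk Q)).IsPrime :=
      Ideal.map_isPrime_of_surjective Ideal.Quotient.mk_surjective (by rw [Ideal.mk_ker]; exact hQp1)
    have hpr : (p.map (Ideal.Quotient.mk Q)).IsPrime :=
      Ideal.map_isPrime_of_surjective Ideal.Quotient.mk_surjective (by rw [Ideal.mk_ker]; exact hQp')
    have hlt : p1.map (Ideal.Quotient.mk Q) < p.map (Ideal.Quotient.mk Q) := by
      refine lt_of_le_of_ne (Ideal.map_mono hp1p) fun he => ?_
      have : p1 = p := by rw [← hker hQp1, he, hker hQp']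
      exact hx' p1 hp1 (this ▸ hxp)
    have h0 := (Ideal.height_le_iff (n := 1)).1 hht _ hpr1 hlt
    have h0' : (p1.map (Ideal.Quotient.mk Q)).height = 0 := by
      exact Order.lt_one_iff.1 (by simpa using h0)
    rw [Ideal.height_eq_zero_iff_eq_bot] at h0'
    have : p1 = Q := by
      rw [← hker hQp1, h0', ← RingHom.ker_eq_comap_bot, Ideal.mk_ker]
    exact haQ (this ▸ hp1.1.2 (Ideal.mem_sup_right (Ideal.mem_span_singleton_self a)))
  have hrad : m ≤ (Q ⊔ Ideal.span {a}).radical := by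
    rw [Ideal.radical_eq_sInf]
    refine le_sInf fun p hp => ?_
    exact hmin.2 ⟨hp.2, hp.1⟩ (le_maximalIdeal hp.2.ne_top)
  obtain ⟨c, hc⟩ := Ideal.exists_pow_le_of_le_radical_of_fg hrad (IsNoetherian.noetherian m)
  obtain ⟨N, hN⟩ := h (c + 1)
  have hpow : ∀ i, (Q ⊔ Ideal.span {a}) ^ i ≤ Q ⊔ Ideal.span {a ^ i} := by
    intro i
    induction i with
    | zero => simp
    | succ i ih =>
      rw [pow_succ, pow_succ]
      refine (Ideal.mul_mono_left ih).trans ?_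
      rw [Ideal.sup_mul, Ideal.mul_sup, Ideal.mul_sup]
      refine sup_le (sup_le ?_ ?_) (sup_le ?_ ?_)
      · exact Ideal.mul_le_left.trans le_sup_left
      · exact Ideal.mul_le_left.trans le_sup_left
      · exact Ideal.mul_le_right.trans le_sup_left
      · rw [Ideal.span_singleton_mul_span_singleton]; exact le_sup_right
  have h1 : m ^ (c * (N + 1)) ≤ Q ⊔ m • m ^ (c * (N + 1)) := by
    rw [smul_eq_mul, ← pow_succ']
    calc m ^ (c * (N + 1)) = (m ^ c) ^ (N + 1) := by rw [pow_mul]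
      _ ≤ (Q ⊔ Ideal.span {a}) ^ (N + 1) := Ideal.pow_right_mono hc _
      _ ≤ _ := hpow _
      _ ≤ _ := by
        refine sup_le_sup_left ((Ideal.span_singleton_le_iff_mem _).2 ?_) _
        have := hN (N + 1)
        rwa [show (N + 1) * (c + 1) - N = c * (N + 1) + 1 by
          have : (N + 1) * (c + 1) = c * (N + 1) + 1 + N := by ring
          omega] at this
  have h2 := Submodule.le_of_le_smul_of_le_jacobson_bot (IsNoetherian.noetherian (m ^ (c * (N + 1))))
    (by rw [IsLocalRing.jacobson_eq_maximalIdeal ⊥ bot_ne_top]) h1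
  exact haQ (hQp.mem_of_pow_mem _ (h2 (Ideal.pow_mem_pow ham _)))

theorem chevalley {R : Type*} [CommRing R] [IsLocalRing R] [IsNoetherianRing R]
    (hAU : AnalyticallyUnramified R) {J : Ideal R} (hJm : J ≤ maximalIdeal R) (t : ℕ) :
    ∃ n, W J n ≤ maximalIdeal R ^ t := by
  classical
  by_contra hcon
  push Not at hcon
  set m := maximalIdeal R with hm
  have hMP : ∀ n j, MP (W J n ⊔ m ^ j) := fun n j => ⟨j, le_sup_right⟩
  have hst : ∀ j, ∃ n0, ∀ n ≥ n0, W J n ⊔ m ^ j = W J n0 ⊔ m ^ j := by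
    intro j
    have hb : BddAbove (Set.range fun n => len (W J n ⊔ m ^ j)) := by
      refine ⟨len (m ^ j), ?_⟩
      rintro _ ⟨n, rfl⟩
      exact len_mono ⟨j, le_rfl⟩ le_sup_right
    obtain ⟨n0, hn0⟩ := Nat.sSup_mem (Set.range_nonempty _) hb
    refine ⟨n0, fun n hn => ?_⟩
    refine eq_of_len_le (hMP _ _) (sup_le_sup_right (W_anti hn) _) ?_
    have h1 := le_csSup hb ⟨n, rfl⟩
    rw [← hn0] at h1
    exact h1
  choose ν hν using hst
  have hstep : ∀ (j : ℕ) (x : {x : R // x ∈ W J (ν j) ⊔ m ^ j}),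
      ∃ x' : {x : R // x ∈ W J (ν (j + 1)) ⊔ m ^ (j + 1)}, x'.1 - x.1 ∈ m ^ j := by
    rintro j ⟨x, hx⟩
    have h1 : x ∈ W J (max (ν j) (ν (j + 1))) ⊔ m ^ j := by rw [hν j _ (le_max_left _ _)]; exact hx
    obtain ⟨w, hw, u, hu, rfl⟩ := Submodule.mem_sup.1 h1
    refine ⟨⟨w, ?_⟩, ?_⟩
    · exact Ideal.mem_sup_left (W_anti (le_max_right _ _) hw)
    · simpa using hu
  choose g hg using hstep
  obtain ⟨x0, hx0, hx0t⟩ := Set.not_subset.1 (hcon (ν t))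
  let q : (j : ℕ) → {x : R // x ∈ W J (ν (t + j)) ⊔ m ^ (t + j)} := fun j =>
    Nat.rec ⟨x0, Ideal.mem_sup_left hx0⟩ (fun j => g (t + j)) j
  have hq : ∀ j, (q (j + 1)).1 - (q j).1 ∈ m ^ (t + j) := fun j => hg (t + j) (q j)
  let x : AdicCompletion.AdicCauchySequence m R := AdicCompletion.AdicCauchySequence.mk m R
    (fun j => (q j).1) (fun j => by
      symm
      rw [SModEq.sub_mem]
      have := Ideal.pow_le_pow_right (Nat.le_add_left j t) (hq j)
      simpa using this)
  set â : AdicCompletion m R := AdicCompletion.mk m R x with hâ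
  have hx : ∀ j, x j = (q j).1 := fun j => rfl
  have hqt : ∀ j, (q j).1 - x0 ∈ m ^ t := by
    intro j
    induction j with
    | zero => simp [q]
    | succ j ih =>
      have := add_mem (Ideal.pow_le_pow_right (Nat.le_add_right t j) (hq j)) ih
      simpa using this
  have hane : â ≠ 0 := by
    intro h0
    have h1 := congrArg (AdicCompletion.evalₐ m t) h0
    rw [hâ, AdicCompletion.evalₐ_mk, map_zero, Ideal.Quotient.eq_zero_iff_mem, hx] at h1
    have := sub_mem h1 (hqt t)
    exact hx0t (by simpa using this)
  have hN := adic_noetherian m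
  have hfg : m.FG := IsNoetherian.noetherian m
  have hker : ∀ (j : ℕ) (z : AdicCompletion m R), AdicCompletion.evalₐ m j z = 0 →
      z ∈ maximalIdeal (AdicCompletion m R) ^ j := by
    intro j z hz
    have h1 : z ∈ (AdicCompletion.eval m R j).ker := by
      rw [LinearMap.mem_ker, ← AdicCompletion.factor_evalₐ_eq_eval (I := m) z (by simp), hz, map_zero]
    rw [← AdicCompletion.pow_smul_top_eq_ker_eval hfg] at h1
    have hmm : maximalIdeal (AdicCompletion m R) = m.map (algebraMap R (AdicCompletion m R)) :=
      AdicCompletion.maximalIdeal_eq_map (R := R)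
    rw [hmm, ← Ideal.map_pow]
    refine Submodule.smul_induction_on h1 (fun r hr y _ => ?_) (fun y z hy hz => add_mem hy hz)
    rw [Algebra.smul_def]
    exact Ideal.mul_mem_right _ _ (Ideal.mem_map_of_mem _ hr)
  have hord : ∀ n, ∃ N, ∀ i, â ^ i ∈ maximalIdeal (AdicCompletion m R) ^ (i * n - N) := by
    intro n
    obtain ⟨N, hNn⟩ := W_uniform (J := J) n
    refine ⟨N, fun i => hker _ _ ?_⟩
    set j := i * n - N with hj
    rw [map_pow, hâ, AdicCompletion.evalₐ_mk, ← map_pow, Ideal.Quotient.eq_zero_iff_mem, hx]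
    have h1 : (q j).1 ∈ W J n ⊔ m ^ (t + j) := by
      have h2 : (q j).1 ∈ W J (max n (ν (t + j))) ⊔ m ^ (t + j) := by
        rw [hν (t + j) _ (le_max_right _ _)]; exact (q j).2
      have h6 : W J (max n (ν (t + j))) ⊔ m ^ (t + j) ≤ W J n ⊔ m ^ (t + j) :=
        sup_le_sup_right (W_anti (le_max_left _ _)) _
      exact h6 h2
    obtain ⟨w, hw, u, hu, hwu⟩ := Submodule.mem_sup.1 h1
    have hu' : u ∈ m ^ j := Ideal.pow_le_pow_right (Nat.le_add_left _ _) hu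
    have h3 : (q j).1 ^ i - w ^ i ∈ m ^ j := by
      have h4 : (q j).1 - w ∣ (q j).1 ^ i - w ^ i := sub_dvd_pow_sub_pow _ _ _
      refine Ideal.mem_of_dvd _ h4 ?_
      rw [← hwu]; simpa using hu'
    have h5 : w ^ i ∈ m ^ j := Ideal.pow_right_mono hJm _ (hNn i (Ideal.pow_mem_pow hw i))
    have := add_mem h3 h5
    simpa using this
  have hred : IsReduced (AdicCompletion m R) := hAU
  exact hane ((nilpotent_of_order â hord).eq_zero)

end PartI

/-! ### Part J: the associated graded ring of the refined filtration -/
section PartJ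

variable {R : Type*} [CommRing R]

/-- multiplicative filtrations -/
structure Fil (V : ℕ → Ideal R) : Prop where
  zero : V 0 = ⊤
  mul : ∀ {i j : ℕ} {a b : R}, a ∈ V i → b ∈ V j → a * b ∈ V (i + j)
  anti : ∀ i, V (i + 1) ≤ V i

lemma Fil.le {V : ℕ → Ideal R} (hV : Fil V) {i j : ℕ} (h : i ≤ j) : V j ≤ V i :=
  antitone_nat_of_succ_le hV.anti h

/-- the Rees ring of a filtration -/
def FA {V : ℕ → Ideal R} (hV : Fil V) : Subring R[X] where
  carrier := {f | ∀ n, f.coeff n ∈ V n}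
  zero_mem' := fun n => by simp
  one_mem' := fun n => by
    rcases n with _ | n
    · rw [hV.zero]; trivial
    · rw [Polynomial.coeff_one]; simp
  add_mem' := fun ha hb n => by rw [Polynomial.coeff_add]; exact add_mem (ha n) (hb n)
  neg_mem' := fun ha n => by rw [Polynomial.coeff_neg]; exact neg_mem (ha n)
  mul_mem' := fun ha hb n => by
    rw [Polynomial.coeff_mul]
    refine Ideal.sum_mem _ fun p hp => ?_
    rw [← Finset.HasAntidiagonal.mem_antidiagonal.1 hp]
    exact hV.mul (ha _) (hb _)

lemma mem_FA {V : ℕ → Ideal R} {hV : Fil V} {f : R[X]} : f ∈ FA hV ↔ ∀ n, f.coeff n ∈ V n := Iff.rfl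

/-- the ideal defining the associated graded ring -/
def FP {V : ℕ → Ideal R} (hV : Fil V) : Ideal (FA hV) where
  carrier := {f | ∀ n, (f : R[X]).coeff n ∈ V (n + 1)}
  zero_mem' := fun n => by simp
  add_mem' := fun ha hb n => by
    change (_ + _ : R[X]).coeff n ∈ _
    rw [Polynomial.coeff_add]; exact add_mem (ha n) (hb n)
  smul_mem' := fun c x hx n => by
    change ((c : R[X]) * (x : R[X])).coeff n ∈ _
    rw [Polynomial.coeff_mul]
    refine Ideal.sum_mem _ fun p hp => ?_
    rw [← Finset.HasAntidiagonal.mem_antidiagonal.1 hp, add_assoc]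
    exact hV.mul (c.2 _) (hx _)

lemma mem_FP {V : ℕ → Ideal R} {hV : Fil V} {f : FA hV} :
    f ∈ FP hV ↔ ∀ n, (f : R[X]).coeff n ∈ V (n + 1) := Iff.rfl

/-- the associated graded ring -/
abbrev GG {V : ℕ → Ideal R} (hV : Fil V) := FA hV ⧸ FP hV

lemma monomial_mem_FA {V : ℕ → Ideal R} (hV : Fil V) {n : ℕ} {x : R} (hx : x ∈ V n) :
    Polynomial.monomial n x ∈ FA hV := by
  intro j
  rw [Polynomial.coeff_monomial]
  split_ifs with h
  · rwa [← h]
  · exact zero_mem _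

/-- homogeneous elements -/
noncomputable def hmk {V : ℕ → Ideal R} (hV : Fil V) (n : ℕ) (x : V n) : GG hV :=
  Ideal.Quotient.mk _ ⟨Polynomial.monomial n x.1, monomial_mem_FA hV x.2⟩

lemma hmk_eq_zero {V : ℕ → Ideal R} (hV : Fil V) {n : ℕ} {x : V n} (h : hmk hV n x = 0) :
    x.1 ∈ V (n + 1) := by
  have := mem_FP.1 (Ideal.Quotient.eq_zero_iff_mem.1 h) n
  simpa using this

lemma hmk_eq_zero' {V : ℕ → Ideal R} (hV : Fil V) {n : ℕ} {x : V n} (h : x.1 ∈ V (n + 1)) :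
    hmk hV n x = 0 := by
  refine Ideal.Quotient.eq_zero_iff_mem.2 (mem_FP.2 fun j => ?_)
  change (Polynomial.monomial n x.1).coeff j ∈ _
  rw [Polynomial.coeff_monomial]
  split_ifs with h'
  · rwa [← h']
  · exact zero_mem _

lemma hmk_add {V : ℕ → Ideal R} (hV : Fil V) {n : ℕ} (x y : V n) :
    hmk hV n (x + y) = hmk hV n x + hmk hV n y := by
  rw [hmk, hmk, hmk, ← map_add]
  congr 1
  ext1
  simp

lemma hmk_sum {V : ℕ → Ideal R} (hV : Fil V) {n : ℕ} {ι : Type*} (S : Finset ι) (x : ι → V n) :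
    hmk hV n (∑ i ∈ S, x i) = ∑ i ∈ S, hmk hV n (x i) := by
  classical
  induction S using Finset.induction_on with
  | empty => simp only [Finset.sum_empty]; exact hmk_eq_zero' hV (by simp)
  | insert a S ha ih => rw [Finset.sum_insert ha, Finset.sum_insert ha, hmk_add, ih]

lemma hmk_mul {V : ℕ → Ideal R} (hV : Fil V) {n n' : ℕ} (x : V n) (y : V n') :
    hmk hV n x * hmk hV n' y = hmk hV (n + n') ⟨x.1 * y.1, hV.mul x.2 y.2⟩ := by
  rw [hmk, hmk, hmk, ← map_mul]
  congr 1
  ext1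
  simp [Polynomial.monomial_mul_monomial]

lemma hmk_pow {V : ℕ → Ideal R} (hV : Fil V) {n : ℕ} (x : V n) (i : ℕ) (h : x.1 ^ i ∈ V (n * i)) :
    hmk hV n x ^ i = hmk hV (n * i) ⟨x.1 ^ i, h⟩ := by
  rw [hmk, hmk, ← map_pow]
  congr 1
  ext1
  simp [Polynomial.monomial_pow]

/-- decomposition into homogeneous components -/
lemma mk_eq_sum {V : ℕ → Ideal R} (hV : Fil V) (a : FA hV) :
    (Ideal.Quotient.mk (FP hV) a) =
      ∑ n ∈ Finset.range ((a : R[X]).natDegree + 1), hmk hV n ⟨(a : R[X]).coeff n, a.2 n⟩ := by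
  simp only [hmk]
  rw [← map_sum]
  congr 1
  ext1
  rw [AddSubmonoidClass.coe_finset_sum]
  exact (a : R[X]).as_sum_range

lemma exists_rep {V : ℕ → Ideal R} (hV : Fil V) (z : GG hV) (hz : z ≠ 0) :
    ∃ a : FA hV, Ideal.Quotient.mk _ a = z ∧
      (a : R[X]).leadingCoeff ∉ V ((a : R[X]).natDegree + 1) := by
  obtain ⟨a, rfl⟩ := Ideal.Quotient.mk_surjective z
  obtain ⟨n, hn⟩ : ∃ n, (a : R[X]).natDegree = n := ⟨_, rfl⟩
  induction n using Nat.strong_induction_on generalizing a with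
  | _ n ih =>
    by_cases hl : (a : R[X]).leadingCoeff ∉ V ((a : R[X]).natDegree + 1)
    · exact ⟨a, rfl, hl⟩
    push Not at hl
    have hmem : (a : R[X]).eraseLead ∈ FA hV := fun j => by
      rw [Polynomial.eraseLead_coeff]
      split_ifs
      · exact zero_mem _
      · exact a.2 j
    have heq : Ideal.Quotient.mk (FP hV) ⟨_, hmem⟩ = Ideal.Quotient.mk (FP hV) a := by
      rw [Ideal.Quotient.eq]
      refine mem_FP.2 fun j => ?_
      change ((a : R[X]).eraseLead - (a : R[X])).coeff j ∈ _
      rw [Polynomial.coeff_sub, Polynomial.eraseLead_coeff]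
      split_ifs with hj
      · rw [zero_sub, hj]; exact neg_mem hl
      · rw [sub_self]; exact zero_mem _
    have hne : (a : R[X]).eraseLead ≠ 0 := by
      intro h0
      apply hz
      rw [← heq]
      have : (⟨_, hmem⟩ : FA hV) = 0 := Subtype.ext h0
      rw [this, map_zero]
    have hd := Polynomial.eraseLead_natDegree_lt_or_eraseLead_eq_zero (a : R[X])
    obtain ⟨a', ha', h'⟩ := ih _ (by rw [← hn]; exact hd.resolve_right hne) ⟨_, hmem⟩
      (by rw [heq]; exact hz) rfl
    exact ⟨a', ha'.trans heq, h'⟩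

lemma GG_reduced {V : ℕ → Ideal R} (hV : Fil V)
    (hred : ∀ (a : R) (t m : ℕ), 0 < t → a ∈ V m → a ^ t ∈ V (m * t + 1) → a ∈ V (m + 1)) :
    IsReduced (GG hV) := by
  refine ⟨fun z hz => ?_⟩
  by_contra hne
  obtain ⟨a, ha, hl⟩ := exists_rep hV z hne
  obtain ⟨t, ht⟩ := hz
  have ht' : z ^ (t + 1) = 0 := by rw [pow_succ, ht, zero_mul]
  rw [← ha, ← map_pow, Ideal.Quotient.eq_zero_iff_mem] at ht'
  have h1 := mem_FP.1 ht' ((t + 1) * (a : R[X]).natDegree)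
  rw [SubmonoidClass.coe_pow, Polynomial.coeff_pow_of_natDegree_le le_rfl] at h1
  refine hl (hred _ (t + 1) _ (Nat.succ_pos t) (a.2 _) ?_)
  rw [mul_comm]; exact h1

variable [IsLocalRing R] {d : ℕ}

/-- the map from the polynomial ring over `R` -/
noncomputable def PhiP (s : Fin d → R) (q : ℕ) : MvPolynomial (Fin d) R →+* R[X] :=
  MvPolynomial.eval₂Hom Polynomial.C (fun i => Polynomial.monomial q (s i))

lemma PhiP_homog (s : Fin d → R) (q : ℕ) {p : ℕ} {f : MvPolynomial (Fin d) R}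
    (hf : f.IsHomogeneous p) :
    PhiP s q f = Polynomial.monomial (q * p) (MvPolynomial.eval s f) := by
  conv_lhs => rw [f.as_sum]
  conv_rhs => rw [f.as_sum]
  rw [map_sum, map_sum, map_sum]
  refine Finset.sum_congr rfl fun μ hμ => ?_
  have hdeg : ∑ i ∈ μ.support, μ i = p := (hf.degree_eq_sum_deg_support hμ).symm
  rw [PhiP, MvPolynomial.coe_eval₂Hom, MvPolynomial.eval₂_monomial, MvPolynomial.eval_monomial,
    Finsupp.prod, Finsupp.prod]
  have : ∀ T : Finset (Fin d), ∏ a ∈ T, (Polynomial.monomial q (s a)) ^ μ a =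
      Polynomial.monomial (q * ∑ i ∈ T, μ i) (∏ a ∈ T, s a ^ μ a) := by
    classical
    intro T
    induction T using Finset.induction_on with
    | empty => simp
    | insert a T ha ih =>
      rw [Finset.prod_insert ha, Finset.sum_insert ha, Finset.prod_insert ha, ih,
        Polynomial.monomial_pow, Polynomial.monomial_mul_monomial, mul_add]
  rw [this, Polynomial.C_mul_monomial, hdeg]

lemma PhiP_coeff (s : Fin d → R) {q : ℕ} (hq : 0 < q) (f : MvPolynomial (Fin d) R) (p : ℕ) :
    (PhiP s q f).coeff (q * p) = MvPolynomial.eval s (MvPolynomial.homogeneousComponent p f) := by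
  conv_lhs => rw [← MvPolynomial.sum_homogeneousComponent f]
  rw [map_sum, Polynomial.finset_sum_coeff]
  have h1 : ∀ i, (PhiP s q (MvPolynomial.homogeneousComponent i f)).coeff (q * p) =
      if i = p then MvPolynomial.eval s (MvPolynomial.homogeneousComponent p f) else 0 := by
    intro i
    rw [PhiP_homog s q (MvPolynomial.homogeneousComponent_isHomogeneous i f),
      Polynomial.coeff_monomial]
    by_cases h : i = p
    · rw [if_pos h, if_pos (by rw [h]), h]
    · rw [if_neg h, if_neg (fun h' => h (Nat.eq_of_mul_eq_mul_left hq h'))]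
  simp only [h1]
  rw [Finset.sum_ite_eq']
  split_ifs with h
  · rfl
  · rw [MvPolynomial.homogeneousComponent_eq_zero]
    · simp
    · simpa using h

lemma PhiP_coeff_of_not_dvd (s : Fin d → R) {q : ℕ} (f : MvPolynomial (Fin d) R) (j : ℕ)
    (hj : ¬ q ∣ j) : (PhiP s q f).coeff j = 0 := by
  conv_lhs => rw [← MvPolynomial.sum_homogeneousComponent f]
  rw [map_sum, Polynomial.finset_sum_coeff]
  refine Finset.sum_eq_zero fun i _ => ?_
  rw [PhiP_homog s q (MvPolynomial.homogeneousComponent_isHomogeneous i f),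
      Polynomial.coeff_monomial, if_neg]
  rintro rfl
  exact hj ⟨i, rfl⟩

/-- compatibility of a filtration with `s` -/
structure FilS (V : ℕ → Ideal R) (s : Fin d → R) (q : ℕ) : Prop extends Fil V where
  hq : 0 < q
  hs : ∀ p, JJ s ^ p ≤ V (q * p)
  hm : maximalIdeal R ≤ V 1

variable {V : ℕ → Ideal R} {s : Fin d → R} {q : ℕ}

lemma PhiP_mem (hV : FilS V s q) (f : MvPolynomial (Fin d) R) : PhiP s q f ∈ FA hV.toFil := by
  intro j
  by_cases h : q ∣ j
  · obtain ⟨p, rfl⟩ := h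
    rw [PhiP_coeff s hV.hq]
    exact hV.hs p (mem_JJ_pow.2 ⟨_, MvPolynomial.homogeneousComponent_isHomogeneous p f, rfl⟩)
  · rw [PhiP_coeff_of_not_dvd s f j h]; exact zero_mem _

/-- map to the associated graded ring -/
noncomputable def PhiG (hV : FilS V s q) : MvPolynomial (Fin d) R →+* GG hV.toFil :=
  (Ideal.Quotient.mk _).comp ((PhiP s q).codRestrict (FA hV.toFil) (PhiP_mem hV))

lemma PhiG_C (hV : FilS V s q) {r : R} (hr : r ∈ maximalIdeal R) : PhiG hV (MvPolynomial.C r) = 0 := by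
  refine Ideal.Quotient.eq_zero_iff_mem.2 (mem_FP.2 fun n => ?_)
  change (PhiP s q (MvPolynomial.C r)).coeff n ∈ _
  rw [PhiP, MvPolynomial.coe_eval₂Hom, MvPolynomial.eval₂_C, Polynomial.coeff_C]
  split_ifs with h
  · subst h; exact hV.hm hr
  · exact zero_mem _

lemma PhiG_PE (hV : FilS V s q) {f : MvPolynomial (Fin d) R} (hf : f ∈ PE d (maximalIdeal R)) :
    PhiG hV f = 0 := by
  have : PE d (maximalIdeal R) ≤ RingHom.ker (PhiG hV) := by
    refine Ideal.map_le_iff_le_comap.2 fun r hr => ?_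
    exact PhiG_C hV hr
  exact this hf

lemma map_res_surjective : Function.Surjective (MvPolynomial.map (σ := Fin d) (residue R)) :=
  MvPolynomial.map_surjective _ residue_surjective

lemma map_res_eq_zero {f : MvPolynomial (Fin d) R} :
    MvPolynomial.map (residue R) f = 0 ↔ f ∈ PE d (maximalIdeal R) := by
  rw [mem_PE, MvPolynomial.ext_iff]
  simp only [MvPolynomial.coeff_map, MvPolynomial.coeff_zero, residue_eq_zero_iff]

/-- the structure map from the polynomial ring over the residue field -/
noncomputable def ThG (hV : FilS V s q) : MvPolynomial (Fin d) (ResidueField R) →+* GG hV.toFil :=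
  RingHom.liftOfSurjective (MvPolynomial.map (residue R)) map_res_surjective
    ⟨PhiG hV, fun f hf => PhiG_PE hV (map_res_eq_zero.1 hf)⟩

lemma ThG_map (hV : FilS V s q) (f : MvPolynomial (Fin d) R) :
    ThG hV (MvPolynomial.map (residue R) f) = PhiG hV f :=
  RingHom.liftOfRightInverse_comp_apply _ _ _ _ _

lemma PhiG_homog (hV : FilS V s q) {p : ℕ} {f : MvPolynomial (Fin d) R} (hf : f.IsHomogeneous p)
    (hx : MvPolynomial.eval s f ∈ V (q * p)) :
    PhiG hV f = hmk hV.toFil (q * p) ⟨MvPolynomial.eval s f, hx⟩ := by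
  rw [PhiG, hmk, RingHom.comp_apply]
  congr 1
  ext1
  exact PhiP_homog s q hf

lemma homog_smul (hV : FilS V s q) {p n : ℕ} {f : MvPolynomial (Fin d) R} (hf : f.IsHomogeneous p)
    (x : V n) (hx : MvPolynomial.eval s f * x.1 ∈ V (q * p + n)) :
    ThG hV (MvPolynomial.map (residue R) f) * hmk hV.toFil n x = hmk hV.toFil (q * p + n) ⟨_, hx⟩ := by
  rw [ThG_map, PhiG_homog hV hf (hV.hs p (mem_JJ_pow.2 ⟨f, hf, rfl⟩)), hmk_mul]

lemma GG_torsionfree (hV : FilS V s q)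
    (hc : ∀ (p n : ℕ) (f : MvPolynomial (Fin d) R) (a : R), f.IsHomogeneous p →
      f ∉ PE d (maximalIdeal R) → MvPolynomial.eval s f * a ∈ V (q * p + n) → a ∈ V n)
    (b : MvPolynomial (Fin d) (ResidueField R)) (z : GG hV.toFil) (hb : b ≠ 0) (hbz : ThG hV b * z = 0) :
    z = 0 := by
  classical
  by_contra hz
  obtain ⟨a, ha, hl⟩ := exists_rep hV.toFil z hz
  obtain ⟨f0, hf0⟩ := map_res_surjective (R := R) b
  set p := b.totalDegree with hp
  -- truncate
  set f : MvPolynomial (Fin d) R :=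
    ∑ i ∈ Finset.range (p + 1), MvPolynomial.homogeneousComponent i f0 with hf
  have hfb : MvPolynomial.map (residue R) f = b := by
    rw [hf, map_sum]
    conv_rhs => rw [← MvPolynomial.sum_homogeneousComponent b]
    refine Finset.sum_congr rfl fun i _ => ?_
    rw [← hf0]
    ext μ
    simp only [MvPolynomial.coeff_map, MvPolynomial.coeff_homogeneousComponent]
    split_ifs <;> simp
  set F := MvPolynomial.homogeneousComponent p f0 with hF
  have hFp : F.IsHomogeneous p := MvPolynomial.homogeneousComponent_isHomogeneous p f0
  have hFm : F ∉ PE d (maximalIdeal R) := by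
    rw [← map_res_eq_zero]
    intro h0
    obtain ⟨μ, hμ, hμp'⟩ := Finset.exists_mem_eq_sup b.support
      (MvPolynomial.support_nonempty.2 hb) (fun μ => μ.sum fun _ e => e)
    have hμp : μ.degree = p := by
      rw [hp, MvPolynomial.totalDegree, hμp', Finsupp.degree_apply]; rfl
    have h1 := congrArg (MvPolynomial.coeff μ) h0
    rw [MvPolynomial.coeff_map, hF, MvPolynomial.coeff_homogeneousComponent, if_pos (by rw [hμp]),
      ← MvPolynomial.coeff_map, hf0, MvPolynomial.coeff_zero] at h1
    exact MvPolynomial.mem_support_iff.1 hμ h1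
  have hPf : PhiP s q f = ∑ i ∈ Finset.range (p + 1),
      Polynomial.monomial (q * i) (MvPolynomial.eval s (MvPolynomial.homogeneousComponent i f0)) := by
    rw [hf, map_sum]
    exact Finset.sum_congr rfl fun i _ =>
      PhiP_homog s q (MvPolynomial.homogeneousComponent_isHomogeneous i f0)
  have hdeg : (PhiP s q f).natDegree ≤ q * p := by
    rw [hPf]
    refine Polynomial.natDegree_sum_le_of_forall_le _ _ fun i hi => ?_
    refine (Polynomial.natDegree_monomial_le _).trans (Nat.mul_le_mul_left q ?_)
    simpa [Nat.lt_succ_iff] using hi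
  have hco : (PhiP s q f).coeff (q * p) = MvPolynomial.eval s F := by
    rw [hPf, Polynomial.finset_sum_coeff, Finset.sum_eq_single p]
    · rw [Polynomial.coeff_monomial, if_pos rfl]
    · intro i _ hi
      rw [Polynomial.coeff_monomial, if_neg (fun h => hi (Nat.eq_of_mul_eq_mul_left hV.hq h))]
    · intro h; simp at h
  rw [← hfb, ThG_map, ← ha, PhiG, RingHom.comp_apply, ← map_mul,
    Ideal.Quotient.eq_zero_iff_mem] at hbz
  have h2 := mem_FP.1 hbz (q * p + (a : R[X]).natDegree)
  change ((PhiP s q f) * (a : R[X])).coeff _ ∈ _ at h2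
  rw [Polynomial.coeff_mul_add_eq_of_natDegree_le hdeg le_rfl, hco, add_assoc] at h2
  exact hl (hc _ _ F _ hFp hFm h2)

end PartJ

/-! ### Part K: finiteness of the refined Rees algebra -/
section PartK

variable {R : Type*} [CommRing R]

/-- the refined filtration -/
def VQ (J : Ideal R) (q : ℕ) (hq : 0 < q) (m : ℕ) : Ideal R where
  carrier := {a | a ^ q ∈ W J m}
  zero_mem' := by
    change (0 : R) ^ q ∈ W J m
    rw [zero_pow hq.ne']; exact zero_mem _
  add_mem' := fun ha hb => cross hq ha hb
  smul_mem' := fun c x hx => by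
    change (c • x) ^ q ∈ W J m
    rw [smul_eq_mul, mul_pow]; exact Ideal.mul_mem_left _ _ hx

lemma mem_VQ {J : Ideal R} {q : ℕ} {hq : 0 < q} {m : ℕ} {a : R} :
    a ∈ VQ J q hq m ↔ a ^ q ∈ W J m := Iff.rfl

lemma VQ_mul {J : Ideal R} {q : ℕ} (hq : 0 < q) (n : ℕ) : VQ J q hq (q * n) = W J n := by
  refine le_antisymm (fun a ha => W_of_pow hq (mem_VQ.1 ha)) fun a ha => mem_VQ.2 (W_pow_mem ha q)

variable [IsLocalRing R] [IsNoetherianRing R] {d : ℕ} {s : Fin d → R}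

lemma PE_pow_not_mem {f : MvPolynomial (Fin d) R} (hf : f ∉ PE d (maximalIdeal R)) (i : ℕ) :
    f ^ i ∉ PE d (maximalIdeal R) := by
  induction i with
  | zero =>
    rw [pow_zero]
    intro h1
    have := mem_PE.1 h1 0
    simp only [MvPolynomial.coeff_zero_one] at this
    exact (Ideal.ne_top_iff_one _).1 (maximalIdeal.isMaximal R).ne_top this
  | succ i ih =>
    intro h1
    rw [pow_succ'] at h1
    exact ih (PE_m_prime h1 hf)

lemma filS_VQ (hs : SU s) {q : ℕ} (hq : 0 < q)
    (hred : ∀ (a : R) (t m : ℕ), 0 < t →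
      a ^ (q * t) ∈ W (JJ s) (m * t + 1) → a ^ q ∈ W (JJ s) (m + 1)) :
    FilS (VQ (JJ s) q hq) s q where
  zero := by
    rw [eq_top_iff]; intro a _; rw [mem_VQ, W_zero]; trivial
  mul := fun ha hb => by
    rw [mem_VQ, mul_pow]; exact W_mul_mem ha hb
  anti := fun i a ha => W_anti (Nat.le_succ i) (mem_VQ.1 ha)
  hq := hq
  hs := fun p => by rw [VQ_mul]; exact pow_le_W p
  hm := fun r hr => by
    obtain ⟨N, hN⟩ := hs.hJ
    refine hred r (N + 1) 0 (Nat.succ_pos N) ?_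
    rw [zero_mul, zero_add, mul_comm, pow_mul]
    refine Ideal.pow_mem_of_mem _ ?_ q hq
    have h1 : r ^ (N + 1) ∈ JJ s := hN (Ideal.pow_le_pow_right (Nat.le_succ N) (Ideal.pow_mem_pow hr _))
    have h2 := pow_le_W (J := JJ s) 1
    rw [pow_one] at h2
    exact h2 h1

lemma VQ_cancel (hs : SU s) {q : ℕ} (hq : 0 < q) (p n : ℕ) (f : MvPolynomial (Fin d) R) (a : R)
    (hfp : f.IsHomogeneous p) (hf : f ∉ PE d (maximalIdeal R))
    (h : MvPolynomial.eval s f * a ∈ VQ (JJ s) q hq (q * p + n)) : a ∈ VQ (JJ s) q hq n := by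
  rw [mem_VQ, mul_pow, ← map_pow] at h
  refine W_cancel hs.hq hs.hJ (hfp.pow q) (PE_pow_not_mem hf q) ?_
  rwa [mul_comm p q]

lemma integral_step {q l : ℕ} {x : R} (hx : IsIntegralOverIdeal (JJ s ^ l) x) :
    (PhiP s q).IsIntegralElem (Polynomial.monomial (l * q) x) := by
  obtain ⟨N, hN, a, ha, heq⟩ := hx
  have : ∀ i, ∃ f : MvPolynomial (Fin d) R, i ∈ Finset.Icc 1 N →
      f.IsHomogeneous (l * i) ∧ MvPolynomial.eval s f = a i := by
    intro i
    by_cases hi : i ∈ Finset.Icc 1 N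
    · have h1 := ha i hi
      rw [← pow_mul] at h1
      obtain ⟨f, hf⟩ := mem_JJ_pow.1 h1
      exact ⟨f, fun _ => hf⟩
    · exact ⟨0, fun h => absurd h hi⟩
  choose f hf using this
  refine ⟨Polynomial.X ^ N + ∑ i ∈ Finset.Icc 1 N, Polynomial.C (f i) * Polynomial.X ^ (N - i),
    ?_, ?_⟩
  · refine Polynomial.monic_X_pow_add ?_
    refine (Polynomial.degree_sum_le _ _).trans_lt ?_
    refine (Finset.sup_lt_iff (WithBot.bot_lt_coe N)).2 ?_
    intro i hi
    refine (Polynomial.degree_C_mul_X_pow_le _ _).trans_lt ?_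
    have := Finset.mem_Icc.1 hi
    exact WithBot.coe_lt_coe.2 (by omega : N - i < N)
  · rw [Polynomial.eval₂_add, Polynomial.eval₂_X_pow, Polynomial.eval₂_finset_sum]
    have h1 : ∀ i ∈ Finset.Icc 1 N, Polynomial.eval₂ (PhiP s q) (Polynomial.monomial (l * q) x)
        (Polynomial.C (f i) * Polynomial.X ^ (N - i)) =
        Polynomial.monomial (l * q * N) (a i * x ^ (N - i)) := by
      intro i hi
      have hi' := Finset.mem_Icc.1 hi
      rw [Polynomial.eval₂_mul, Polynomial.eval₂_C, Polynomial.eval₂_X_pow,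
        PhiP_homog s q (hf i hi).1, (hf i hi).2, Polynomial.monomial_pow,
        Polynomial.monomial_mul_monomial]
      have hdeg : q * (l * i) + l * q * (N - i) = l * q * N := by
        have : N = i + (N - i) := by omega
        conv_rhs => rw [this]
        ring
      rw [hdeg]
    rw [Finset.sum_congr rfl h1, Polynomial.monomial_pow, ← map_sum, ← map_add, heq, map_zero]

lemma integral_W {q l : ℕ} (z0 : R) (hz0 : z0 ∈ JJ s) (hreg : ∀ z, z0 * z = 0 → z = 0)
    {x : R} (hx : x ∈ W (JJ s) l) :
    (PhiP s q).IsIntegralElem (Polynomial.monomial (l * q) x) := by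
  rw [← intCl_eq_W le_rfl ⟨0, fun n _ => pow_succ' _ _⟩ z0 hz0 hreg l] at hx
  induction hx using Submodule.span_induction with
  | mem x h => exact integral_step h
  | zero => rw [map_zero]; exact RingHom.isIntegralElem_zero _
  | add x y _ _ hx hy => rw [map_add]; exact hx.add _ hy
  | smul r x _ hx =>
    have h1 : Polynomial.monomial (l * q) (r • x) =
        PhiP s q (MvPolynomial.C r) * Polynomial.monomial (l * q) x := by
      rw [PhiP, MvPolynomial.coe_eval₂Hom, MvPolynomial.eval₂_C, Polynomial.C_mul_monomial,
        smul_eq_mul]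
    rw [h1]
    exact RingHom.IsIntegralElem.mul _ (RingHom.isIntegralElem_map _) hx

lemma integral_FA {q : ℕ} (hq : 0 < q) (z0 : R) (hz0 : z0 ∈ JJ s) (hreg : ∀ z, z0 * z = 0 → z = 0)
    {a : R[X]} (ha : ∀ n, a.coeff n ∈ VQ (JJ s) q hq n) : (PhiP s q).IsIntegralElem a := by
  rw [a.as_sum_range]
  refine Finset.sum_induction _ (fun z => (PhiP s q).IsIntegralElem z) (fun x y hx hy => hx.add _ hy)
    (RingHom.isIntegralElem_zero _) fun n _ => ?_
  have h1 := integral_W (q := q) z0 hz0 hreg (mem_VQ.1 (ha n))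
  rw [← Polynomial.monomial_pow] at h1
  obtain ⟨P, hP, hP0⟩ := h1
  refine ⟨Polynomial.expand _ q P, hP.expand hq, ?_⟩
  rw [Polynomial.expand_eq_comp_X_pow, Polynomial.eval₂_comp, Polynomial.eval₂_X_pow]
  exact hP0

lemma integral_GG (hs : SU s) {q : ℕ} (hq : 0 < q) (hV : FilS (VQ (JJ s) q hq) s q)
    (z0 : R) (hz0 : z0 ∈ JJ s) (hreg : ∀ z, z0 * z = 0 → z = 0)
    (z : GG hV.toFil) : (ThG hV).IsIntegralElem z := by
  obtain ⟨a, rfl⟩ := Ideal.Quotient.mk_surjective z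
  obtain ⟨P, hP, hP0⟩ := integral_FA hq z0 hz0 hreg a.2
  refine ⟨P.map (MvPolynomial.map (residue R)), hP.map _, ?_⟩
  rw [Polynomial.eval₂_map]
  have h1 : (ThG hV).comp (MvPolynomial.map (residue R)) = PhiG hV :=
    RingHom.ext fun f => ThG_map hV f
  rw [h1, PhiG, ← Polynomial.hom_eval₂]
  have h2 : Polynomial.eval₂ ((PhiP s q).codRestrict (FA hV.toFil) (PhiP_mem hV)) a P = 0 := by
    apply Subtype.ext
    change (FA hV.toFil).subtype _ = 0
    rw [Polynomial.hom_eval₂]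
    exact hP0
  rw [h2, map_zero]

lemma hmk_congr {V : ℕ → Ideal R} (hV : Fil V) {n n' : ℕ} (h : n = n') {x : V n} {x' : V n'}
    (hx : x.1 = x'.1) : hmk hV n x = hmk hV n' x' := by
  subst h
  congr 1
  exact Subtype.ext hx

end PartK

/-! ### Part L: linear equivalence of the filtrations -/
section PartL

variable {R : Type*} [CommRing R] [IsLocalRing R] [IsNoetherianRing R] {d : ℕ} {s : Fin d → R}

lemma indep_card (hs : SU s) {q : ℕ} (hq : 0 < q) (hV : FilS (VQ (JJ s) q hq) s q) :
    ∃ C : ℕ, ∀ r < q, ∀ T : Finset (Σ n, VQ (JJ s) q hq n), (∀ j ∈ T, j.1 % q = r) →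
      (∀ g : (Σ n, VQ (JJ s) q hq n) → MvPolynomial (Fin d) (ResidueField R),
        ∑ j ∈ T, ThG hV (g j) * hmk hV.toFil j.1 j.2 = 0 → ∀ j ∈ T, g j = 0) → T.card ≤ C := by
  classical
  obtain ⟨C, n0, hC⟩ := hs.hB
  refine ⟨C, fun r hr T hT hind => ?_⟩
  refine Nn_card_le hs.hd T (fun j => j.1 / q) C (n0 + T.sup fun j => j.1 / q) fun n hn => ?_
  have hl : ∀ j ∈ T, j.1 / q ≤ n := fun j hj => by
    have := Finset.le_sup (f := fun j : (Σ n, VQ (JJ s) q hq n) => j.1 / q) hj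
    omega
  have hj1 : ∀ j ∈ T, q * (n - j.1 / q) + j.1 = q * n + r := fun j hj => by
    have h1 := Nat.div_add_mod j.1 q
    rw [hT j hj] at h1
    have h2 := hl j hj
    have h3 : q * (n - j.1 / q) + q * (j.1 / q) = q * n := by
      rw [← mul_add]; congr 1; omega
    omega
  have hMP : ∀ m, MP (VQ (JJ s) q hq m) := fun m => by
    refine (hs.mpW m).mono fun a ha => ?_
    exact Ideal.pow_mem_of_mem _ ha q hq
  have hcount := count_multi (s := s) T (hMP (q * n + r + 1)) (hV.anti (q * n + r))
    (fun j => (j.2 : R)) (fun j => n - j.1 / q) (fun j hj c hc => ?_) (fun f hf hsum => ?_)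
  · have h1 : len (W (JJ s) n) ≤ len (VQ (JJ s) q hq (q * n + r)) := by
      rw [← VQ_mul hq n]
      refine len_mono (hMP _) (hV.toFil.le (Nat.le_add_right _ _)) |>.trans' ?_
      exact le_rfl
    have h2 : len (VQ (JJ s) q hq (q * n + r + 1)) ≤ len (W (JJ s) (n + 1)) := by
      rw [← VQ_mul hq (n + 1)]
      exact len_mono (hMP _) (hV.toFil.le (by rw [mul_add]; omega))
    have h3 := hC n (by omega)
    omega
  · rw [← hj1 j hj]
    exact hV.mul (hV.hs _ hc) j.2.2
  · have hmem : ∀ j, j ∈ T → MvPolynomial.eval s (f j) * (j.2 : R) ∈ VQ (JJ s) q hq (q * n + r) := by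
      intro j hj
      rw [← hj1 j hj]
      exact hV.mul (hV.hs _ (mem_JJ_pow.2 ⟨_, hf j, rfl⟩)) j.2.2
    have hz := hind (fun j => MvPolynomial.map (residue R) (f j)) ?_
    · exact fun j hj => map_res_eq_zero.1 (hz j hj)
    · have : ∀ j ∈ T, ThG hV (MvPolynomial.map (residue R) (f j)) * hmk hV.toFil j.1 j.2 =
          hmk hV.toFil (q * n + r)
            (if h : j ∈ T then ⟨MvPolynomial.eval s (f j) * (j.2 : R), hmem j h⟩ else 0) := by
        intro j hj
        rw [homog_smul hV (hf j) j.2 (hV.mul (hV.hs _ (mem_JJ_pow.2 ⟨_, hf j, rfl⟩)) j.2.2)]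
        refine hmk_congr _ (hj1 j hj) ?_
        rw [dif_pos hj]
      rw [Finset.sum_congr rfl this, ← hmk_sum]
      refine hmk_eq_zero' _ ?_
      rw [AddSubmonoidClass.coe_finset_sum]
      refine (congrArg (· ∈ VQ (JJ s) q hq (q * n + r + 1)) ?_).mpr hsum
      refine Finset.sum_congr rfl fun j hj => ?_
      rw [dif_pos hj]

lemma fin_of_hom {d : ℕ} (k : Type*) [Field k] {G : Type*} [CommRing G] [IsReduced G]
    [Algebra (MvPolynomial (Fin d) k) G] [Algebra.IsIntegral (MvPolynomial (Fin d) k) G]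
    (htf : ∀ (b : MvPolynomial (Fin d) k) (z : G), b ≠ 0 → b • z = 0 → z = 0)
    {ι : Type*} (v : ι → G) (hv : ∀ z : G, ∃ (T : Finset ℕ) (u : ℕ → ι), z = ∑ n ∈ T, v (u n))
    (hS : ∀ S : Set ι, (∀ T : Finset ι, (T : Set ι) ⊆ S → ∀ g : ι → MvPolynomial (Fin d) k,
      ∑ j ∈ T, g j • v j = 0 → ∀ j ∈ T, g j = 0) → S.Finite) :
    Module.Finite (MvPolynomial (Fin d) k) G := by
  classical
  obtain ⟨S, hS1, hmax⟩ := exists_maximal_linearIndepOn (MvPolynomial (Fin d) k) v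
  have hfin : S.Finite := hS S fun T hT g hg => by
    have h2 : LinearIndepOn (MvPolynomial (Fin d) k) v (T : Set ι) := hS1.mono hT
    exact linearIndepOn_finset_iff.1 h2 g hg
  refine finite_of_reduced k htf (hfin.image v).toFinset fun z => ?_
  rw [Set.Finite.coe_toFinset]
  obtain ⟨T, u, rfl⟩ := hv z
  refine Finset.sum_induction _ (fun z => ∃ b : MvPolynomial (Fin d) k, b ≠ 0 ∧
    b • z ∈ Submodule.span (MvPolynomial (Fin d) k) (v '' S)) ?_ ?_ fun n _ => ?_
  · rintro x y ⟨b, hb, hx⟩ ⟨c, hc, hy⟩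
    refine ⟨b * c, mul_ne_zero hb hc, ?_⟩
    rw [smul_add]
    refine add_mem ?_ ?_
    · rw [mul_comm, mul_smul]; exact Submodule.smul_mem _ _ hx
    · rw [mul_smul]; exact Submodule.smul_mem _ _ hy
  · exact ⟨1, one_ne_zero, by rw [smul_zero]; exact zero_mem _⟩
  · by_cases hn : u n ∈ S
    · exact ⟨1, one_ne_zero, by rw [one_smul]; exact Submodule.subset_span ⟨_, hn, rfl⟩⟩
    · exact hmax _ hn

lemma VQ_gens (hs : SU s) {q : ℕ} (hq : 0 < q)
    (hred : ∀ (a : R) (t m : ℕ), 0 < t →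
      a ^ (q * t) ∈ W (JJ s) (m * t + 1) → a ^ q ∈ W (JJ s) (m + 1))
    (z0 : R) (hz0 : z0 ∈ JJ s) (hreg : ∀ z, z0 * z = 0 → z = 0) :
    ∃ D : ℕ, ∀ m > D, VQ (JJ s) q hq m ≤
      JJ s * VQ (JJ s) q hq (m - q) ⊔ VQ (JJ s) q hq (m + 1) := by
  classical
  have hV := filS_VQ hs hq hred
  letI := (ThG hV).toAlgebra
  have hsmul : ∀ (b : MvPolynomial (Fin d) (ResidueField R)) (z : GG hV.toFil),
      b • z = ThG hV b * z := fun b z => Algebra.smul_def b z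
  haveI : IsReduced (GG hV.toFil) := GG_reduced _ (fun a t m ht ha h => by
    refine hred a t m ht ?_
    rw [mul_comm q t, pow_mul]; exact h)
  haveI : Algebra.IsIntegral (MvPolynomial (Fin d) (ResidueField R)) (GG hV.toFil) :=
    ⟨fun z => integral_GG hs hq hV z0 hz0 hreg z⟩
  have htf : ∀ (b : MvPolynomial (Fin d) (ResidueField R)) (z : GG hV.toFil), b ≠ 0 → b • z = 0 →
      z = 0 := fun b z hb h => GG_torsionfree hV (VQ_cancel hs hq) b z hb (by rw [← hsmul]; exact h)
  have hfg : Module.Finite (MvPolynomial (Fin d) (ResidueField R)) (GG hV.toFil) := by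
    refine fin_of_hom (ResidueField R) htf
      (fun j : (Σ n, VQ (JJ s) q hq n) => hmk hV.toFil j.1 j.2) (fun z => ?_) (fun S hS => ?_)
    · obtain ⟨a, rfl⟩ := Ideal.Quotient.mk_surjective z
      exact ⟨_, fun n => ⟨n, ⟨(a : R[X]).coeff n, a.2 n⟩⟩, mk_eq_sum _ a⟩
    · obtain ⟨C, hC⟩ := indep_card hs hq hV
      have h1 : S ⊆ ⋃ r ∈ Finset.range q, {j ∈ S | j.1 % q = r} := fun j hj => by
        simp only [Set.mem_iUnion]
        exact ⟨j.1 % q, Finset.mem_range.2 (Nat.mod_lt _ hq), hj, rfl⟩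
      refine Set.Finite.subset (Set.Finite.biUnion (Finset.finite_toSet _) fun r hr => ?_) h1
      by_contra hinf
      obtain ⟨T, hT, hTc⟩ := Set.Infinite.exists_subset_card_eq hinf (C + 1)
      have := hC r (Finset.mem_range.1 hr) T (fun j hj => (hT hj).2) (fun g hg =>
        hS T (fun j hj => (hT hj).1) g (by simpa only [hsmul] using hg))
      omega
  obtain ⟨Z, hZ⟩ := hfg.fg_top
  choose rep hrep using fun z : GG hV.toFil => Ideal.Quotient.mk_surjective z
  refine ⟨Z.sup fun z => ((rep z : FA hV.toFil) : R[X]).natDegree, fun m hm x hx => ?_⟩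
  have hx1 : hmk hV.toFil m ⟨x, hx⟩ ∈ Submodule.span (MvPolynomial (Fin d) (ResidueField R))
      (Z : Set (GG hV.toFil)) := by rw [hZ]; trivial
  obtain ⟨b, -, hb⟩ := Submodule.mem_span_finset.1 hx1
  choose f hf using fun z => map_res_surjective (R := R) (b z)
  have h1 : ∑ z ∈ Z, b z • z = Ideal.Quotient.mk (FP hV.toFil)
      (∑ z ∈ Z, (PhiP s q).codRestrict (FA hV.toFil) (PhiP_mem hV) (f z) * rep z) := by
    rw [map_sum]
    refine Finset.sum_congr rfl fun z _ => ?_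
    rw [hsmul, ← hf, ThG_map, map_mul, hrep]
    rfl
  rw [h1, hmk, Ideal.Quotient.eq] at hb
  have h2 := mem_FP.1 hb m
  have h3 : (∑ z ∈ Z, PhiP s q (f z) * (rep z : R[X])).coeff m - x ∈ VQ (JJ s) q hq (m + 1) := by
    have h4 : ((∑ z ∈ Z, (PhiP s q).codRestrict (FA hV.toFil) (PhiP_mem hV) (f z) * rep z :
      FA hV.toFil) : R[X]) = ∑ z ∈ Z, PhiP s q (f z) * (rep z : R[X]) := by
      rw [AddSubmonoidClass.coe_finset_sum]; rfl
    rw [← h4]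
    have h5 : x = (Polynomial.monomial m x).coeff m := by rw [Polynomial.coeff_monomial, if_pos rfl]
    conv =>
      enter [2]
      rw [h5]
    rw [← Polynomial.coeff_sub]
    exact h2
  have h6 : (∑ z ∈ Z, PhiP s q (f z) * (rep z : R[X])).coeff m ∈
      JJ s * VQ (JJ s) q hq (m - q) := by
    rw [Polynomial.finset_sum_coeff]
    refine Ideal.sum_mem _ fun z hz => ?_
    rw [Polynomial.coeff_mul]
    refine Ideal.sum_mem _ fun p hp => ?_
    have hp' := Finset.HasAntidiagonal.mem_antidiagonal.1 hp
    by_cases hd : ((rep z : FA hV.toFil) : R[X]).natDegree < p.2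
    · rw [Polynomial.coeff_eq_zero_of_natDegree_lt hd, mul_zero]; exact zero_mem _
    by_cases hdv : q ∣ p.1
    · obtain ⟨l, hl⟩ := hdv
      have hle := Finset.le_sup (f := fun z => ((rep z : FA hV.toFil) : R[X]).natDegree) hz
      rcases l with _ | l
      · rw [mul_zero] at hl; omega
      · rw [hl, PhiP_coeff s hq]
        have h7 : MvPolynomial.eval s (MvPolynomial.homogeneousComponent (l + 1) (f z)) ∈
          JJ s ^ (l + 1) := mem_JJ_pow.2 ⟨_, MvPolynomial.homogeneousComponent_isHomogeneous _ _, rfl⟩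
        have h8 : JJ s ^ l * VQ (JJ s) q hq p.2 ≤ VQ (JJ s) q hq (m - q) := by
          refine Ideal.mul_le.2 fun r hr t ht => ?_
          have h9 := hV.mul (hV.hs l hr) ht
          have h10 : q * l + p.2 = m - q := by rw [mul_add] at hl; omega
          rwa [h10] at h9
        have h9 := Ideal.mul_mem_mul h7 ((rep z).2 p.2)
        rw [pow_succ', mul_assoc] at h9
        exact Ideal.mul_mono_right h8 h9
    · rw [PhiP_coeff_of_not_dvd s _ _ hdv, zero_mul]; exact zero_mem _
  have h7 : x = (∑ z ∈ Z, PhiP s q (f z) * (rep z : R[X])).coeff m -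
    ((∑ z ∈ Z, PhiP s q (f z) * (rep z : R[X])).coeff m - x) := by ring
  rw [h7]
  exact sub_mem (Ideal.mem_sup_left h6) (Ideal.mem_sup_right h3)

theorem W_le_pow (hs : SU s) (hAU : AnalyticallyUnramified R) (hJm : JJ s ≤ maximalIdeal R)
    (z0 : R) (hz0 : z0 ∈ JJ s) (hreg : ∀ z, z0 * z = 0 → z = 0) :
    ∃ c, ∀ n, W (JJ s) (n + c) ≤ JJ s ^ n := by
  obtain ⟨q, hq, hred⟩ := reduced_exponent hs
  obtain ⟨D, hD⟩ := VQ_gens hs hq hred z0 hz0 hreg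
  have hV := filS_VQ hs hq hred
  have hMP : ∀ m, MP (VQ (JJ s) q hq m) := fun m => by
    refine (hs.mpW m).mono fun a ha => ?_
    exact Ideal.pow_mem_of_mem _ ha q hq
  have h1 : ∀ m > D, ∀ k, VQ (JJ s) q hq m ≤
      JJ s * VQ (JJ s) q hq (m - q) ⊔ VQ (JJ s) q hq (m + k) := by
    intro m hm k
    induction k with
    | zero => exact le_sup_right
    | succ k ih =>
      refine ih.trans (sup_le le_sup_left ((hD (m + k) (by omega)).trans (sup_le ?_ ?_)))
      · exact (Ideal.mul_mono_right (hV.toFil.le (by omega))).trans le_sup_left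
      · exact le_sup_right
  have h2 : ∀ m > D, VQ (JJ s) q hq m ≤ JJ s * VQ (JJ s) q hq (m - q) := by
    intro m hm
    obtain ⟨t, ht⟩ := hs.hJ.mul (hMP (m - q))
    obtain ⟨n, hn⟩ := chevalley hAU hJm t
    refine (h1 m hm (q * n)).trans (sup_le le_rfl ?_)
    refine (hV.toFil.le (Nat.le_add_left _ _)).trans ?_
    rw [VQ_mul]
    exact hn.trans ht
  have h3 : ∀ n, VQ (JJ s) q hq (D + q * n) ≤ JJ s ^ n := by
    intro n
    induction n with
    | zero => rw [pow_zero, Ideal.one_eq_top]; exact le_top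
    | succ n ih =>
      refine (h2 _ (by rw [mul_add]; omega)).trans ?_
      rw [pow_succ']
      refine Ideal.mul_mono_right (le_trans ?_ ih)
      exact hV.toFil.le (by rw [mul_add]; omega)
  refine ⟨D, fun n => ?_⟩
  rw [← VQ_mul hq]
  refine (hV.toFil.le ?_).trans (h3 n)
  rw [mul_add, add_comm]
  exact Nat.add_le_add_left (Nat.le_mul_of_pos_left D hq) _

end PartL

/-! ### Part M: asymptotics of Hilbert polynomials -/
section PartM
open Filter Topology

lemma sum_Nn (d n : ℕ) : ∑ i ∈ Finset.range n, Nn (d + 1) i = (n + d).choose (d + 1) := by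
  induction n with
  | zero => simp
  | succ n ih =>
    rw [Finset.sum_range_succ, ih, Nn_eq, show n + 1 + d = n + d + 1 by ring,
      Nat.choose_succ_succ (n + d) d, add_comm]

lemma choose_low {k D : ℕ} (h : k < D) (a c : ℕ) :
    Tendsto (fun n : ℕ => ((n + a - c).choose k : ℝ) / (n : ℝ) ^ D) atTop (𝓝 0) := by
  have h1 := choose_tendsto k a c
  have h2 : Tendsto (fun n : ℕ => (1 : ℝ) / (n : ℝ) ^ (D - k)) atTop (𝓝 0) := by
    have : Tendsto (fun n : ℕ => ((n : ℝ)) ^ (D - k)) atTop atTop :=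
      (tendsto_pow_atTop (by omega)).comp tendsto_natCast_atTop_atTop
    exact this.inv_tendsto_atTop.congr fun n => (one_div _).symm
  have h3 := h1.mul h2
  rw [mul_zero] at h3
  refine h3.congr fun n => ?_
  rw [div_mul_div_comm, mul_one, ← pow_add]
  congr 2
  omega

lemma hilb_step {d : ℕ} (hd : 0 < d) (L : ℕ → ℕ) (e : ℕ → ℤ)
    (h : ∃ N : ℕ, ∀ n ≥ N, (L n : ℤ) =
      ∑ i ∈ Finset.range (d + 1), (-1 : ℤ) ^ i * e i * ((n + d - i).choose (d - i))) :
    ∃ C n0 : ℕ, ∀ n ≥ n0, L (n + 1) ≤ L n + C * Nn d (n + 1) := by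
  obtain ⟨N, hN⟩ := h
  obtain ⟨d, rfl⟩ : ∃ d', d = d' + 1 := ⟨d - 1, by omega⟩
  refine ⟨∑ i ∈ Finset.range (d + 1 + 1), (e i).natAbs, N, fun n hn => ?_⟩
  have h1 := hN n hn
  have h2 := hN (n + 1) (by omega)
  have key : (L (n + 1) : ℤ) - L n ≤
      (∑ i ∈ Finset.range (d + 1 + 1), (e i).natAbs : ℕ) * (Nn (d + 1) (n + 1) : ℤ) := by
    rw [h1, h2, ← Finset.sum_sub_distrib, Nat.cast_sum, Finset.sum_mul]
    refine Finset.sum_le_sum fun i hi => ?_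
    have hi' : i ≤ d + 1 := by simpa [Nat.lt_succ_iff] using hi
    obtain ⟨b, hb⟩ := Nat.exists_eq_add_of_le hi'
    have e1 : n + 1 + (d + 1) - i = n + 1 + b := by omega
    have e2 : n + (d + 1) - i = n + b := by omega
    have e3 : d + 1 - i = b := by omega
    rw [e1, e2, e3, ← mul_sub, Nn_eq]
    obtain ⟨δ, hδ, hδ'⟩ : ∃ δ : ℕ, ((n + 1 + b).choose b : ℤ) - ((n + b).choose b : ℤ) = δ ∧
        δ ≤ (n + 1 + d).choose d := by
      rcases b with _ | b
      · exact ⟨0, by simp, by simp⟩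
      · refine ⟨(n + (b + 1)).choose b, ?_, ?_⟩
        · rw [show n + 1 + (b + 1) = n + (b + 1) + 1 by ring, Nat.choose_succ_succ]
          push_cast; ring
        · have hbd : b ≤ d := by omega
          rw [show n + (b + 1) = n + 1 + b by ring]
          rw [← Nat.choose_symm_add, ← Nat.choose_symm_add]
          exact Nat.choose_le_choose _ (by omega)
    rw [hδ]
    have h3 : (-1 : ℤ) ^ i * e i ≤ ((e i).natAbs : ℤ) := by
      rw [Int.natCast_natAbs]
      rcases neg_one_pow_eq_or ℤ i with h | h <;> rw [h]
      · rw [one_mul]; exact le_abs_self _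
      · rw [neg_one_mul]; exact neg_le_abs _
    calc (-1 : ℤ) ^ i * e i * δ ≤ ((e i).natAbs : ℤ) * δ :=
          mul_le_mul_of_nonneg_right h3 (Int.natCast_nonneg _)
      _ ≤ _ := mul_le_mul_of_nonneg_left (by exact_mod_cast hδ') (Int.natCast_nonneg _)
  have h4 : (L (n + 1) : ℤ) ≤ ((L n + (∑ i ∈ Finset.range (d + 1 + 1), (e i).natAbs) *
      Nn (d + 1) (n + 1) : ℕ) : ℤ) := by
    rw [Nat.cast_add, Nat.cast_mul]; linarith
  exact_mod_cast h4

lemma hilb_e0 {d : ℕ} (hd : 0 < d) (L : ℕ → ℕ) (e : ℕ → ℤ)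
    (h : ∃ N : ℕ, ∀ n ≥ N, (L n : ℤ) =
      ∑ i ∈ Finset.range (d + 1), (-1 : ℤ) ^ i * e i * ((n + d - i).choose (d - i)))
    (eJ c : ℕ) (hle : ∀ n, eJ * ∑ i ∈ Finset.range n, Nn d i ≤ L (n + c)) : (eJ : ℤ) ≤ e 0 := by
  obtain ⟨N, hN⟩ := h
  obtain ⟨d, rfl⟩ : ∃ d', d = d' + 1 := ⟨d - 1, by omega⟩
  have t1 : Tendsto (fun n : ℕ => (eJ : ℝ) * (((n + d - 0).choose (d + 1) : ℝ) / (n : ℝ) ^ (d + 1)))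
      atTop (𝓝 ((eJ : ℝ) * (1 / ((d + 1).factorial : ℝ)))) :=
    (choose_tendsto (d + 1) d 0).const_mul _
  have t2 : Tendsto (fun n : ℕ => ∑ i ∈ Finset.range (d + 1 + 1), ((-1 : ℝ) ^ i * e i) *
      (((n + (c + (d + 1)) - i).choose (d + 1 - i) : ℝ) / (n : ℝ) ^ (d + 1)))
      atTop (𝓝 (∑ i ∈ Finset.range (d + 1 + 1),
        ((-1 : ℝ) ^ i * e i) * if i = 0 then (1 / ((d + 1).factorial : ℝ)) else 0)) := by
    refine tendsto_finsetSum _ fun i hi => Tendsto.const_mul _ ?_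
    split_ifs with h0
    · subst h0; exact choose_tendsto (d + 1) (c + (d + 1)) 0
    · exact choose_low (by omega) _ _
  have t3 : (∑ i ∈ Finset.range (d + 1 + 1),
        ((-1 : ℝ) ^ i * e i) * if i = 0 then (1 / ((d + 1).factorial : ℝ)) else 0) =
        (e 0 : ℝ) * (1 / ((d + 1).factorial : ℝ)) := by
    rw [Finset.sum_eq_single 0]
    · simp
    · intro i _ hi; rw [if_neg hi, mul_zero]
    · intro h; simp at h
  rw [t3] at t2
  have h5 := le_of_tendsto_of_tendsto t1 t2 (by
    filter_upwards [eventually_ge_atTop N] with n hn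
    have h1 := hle n
    rw [sum_Nn] at h1
    have h2 := hN (n + c) (by omega)
    have h3 : ((eJ * (n + d).choose (d + 1) : ℕ) : ℝ) ≤ ∑ i ∈ Finset.range (d + 1 + 1),
        (-1 : ℝ) ^ i * e i * ((n + c + (d + 1) - i).choose (d + 1 - i) : ℝ) := by
      have h4 : ((L (n + c) : ℤ) : ℝ) = ((∑ i ∈ Finset.range (d + 1 + 1), (-1 : ℤ) ^ i * e i *
        ((n + c + (d + 1) - i).choose (d + 1 - i)) : ℤ) : ℝ) := by rw [h2]
      push_cast at h4
      rw [← h4]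
      exact_mod_cast h1
    have h6 : ∑ i ∈ Finset.range (d + 1 + 1), ((-1 : ℝ) ^ i * e i) *
      (((n + (c + (d + 1)) - i).choose (d + 1 - i) : ℝ) / (n : ℝ) ^ (d + 1)) =
      (∑ i ∈ Finset.range (d + 1 + 1),
        (-1 : ℝ) ^ i * e i * ((n + c + (d + 1) - i).choose (d + 1 - i) : ℝ)) / (n : ℝ) ^ (d + 1) := by
      rw [Finset.sum_div]
      refine Finset.sum_congr rfl fun i _ => ?_
      rw [add_assoc, mul_div_assoc]
    rw [h6, ← mul_div_assoc]
    refine div_le_div_of_nonneg_right ?_ (by positivity)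
    push_cast at h3
    exact h3)
  have h7 : (0 : ℝ) < 1 / ((d + 1).factorial : ℝ) := by positivity
  have h8 : (eJ : ℝ) ≤ e 0 := le_of_mul_le_mul_right h5 h7
  exact_mod_cast h8

lemma hilb_contra {d : ℕ} (hd : 0 < d) (L : ℕ → ℕ) (e : ℕ → ℤ)
    (h : ∃ N : ℕ, ∀ n ≥ N, (L n : ℤ) =
      ∑ i ∈ Finset.range (d + 1), (-1 : ℤ) ^ i * e i * ((n + d - i).choose (d - i)))
    (he1 : e 1 = e 0 - L 0 + 1)
    (eJ k k' n1 : ℕ) (hle : (eJ : ℤ) ≤ e 0)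
    (hcon : ∀ n ≥ n1, L n + Nn d (n - k) + Nn d (n - k') ≤
      eJ * ∑ i ∈ Finset.range n, Nn d i + L 0 * Nn d n) : False := by
  obtain ⟨N, hN⟩ := h
  have t1 := (Nn_tendsto hd k).add (Nn_tendsto hd k')
  have t0 := Nn_tendsto hd 0
  obtain ⟨d, rfl⟩ : ∃ d', d = d' + 1 := ⟨d - 1, by omega⟩
  simp only [Nat.add_sub_cancel] at t1 t0
  have t2 : Tendsto (fun n : ℕ => ∑ i ∈ Finset.range d, ((-1 : ℝ) ^ (i + 2) * e (i + 2)) *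
      (((n + (d + 1) - (i + 2)).choose (d + 1 - (i + 2)) : ℝ) / (n : ℝ) ^ d))
      atTop (𝓝 (∑ i ∈ Finset.range d, ((-1 : ℝ) ^ (i + 2) * e (i + 2)) * 0)) := by
    refine tendsto_finsetSum _ fun i hi => Tendsto.const_mul _ ?_
    have := Finset.mem_range.1 hi
    exact choose_low (by omega) _ _
  simp only [mul_zero, Finset.sum_const_zero] at t2
  have h5 := le_of_tendsto_of_tendsto t1 (t0.sub t2) (by
    filter_upwards [eventually_ge_atTop N, eventually_ge_atTop n1] with n hn hn1
    have h1 := hcon n hn1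
    rw [sum_Nn] at h1
    have h2 := hN n hn
    rw [Finset.sum_range_succ', Finset.sum_range_succ'] at h2
    have h3 : ((n + (d + 1) - 0).choose (d + 1 - 0) : ℤ) =
        (n + d).choose (d + 1) + Nn (d + 1) n := by
      rw [Nn_eq, Nat.sub_zero, Nat.sub_zero, show n + (d + 1) = n + d + 1 by ring,
        Nat.choose_succ_succ]
      push_cast; ring
    have h4 : ((n + (d + 1) - (0 + 1)).choose (d + 1 - (0 + 1)) : ℤ) = Nn (d + 1) n := by
      rw [Nn_eq]
      norm_num
    simp only [Nat.cast_add, h3, h4, zero_add, he1, pow_zero, pow_one, one_mul] at h2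
    have h6 : (Nn (d + 1) (n - k) : ℤ) + Nn (d + 1) (n - k') ≤ Nn (d + 1) n -
        ∑ i ∈ Finset.range d, (-1 : ℤ) ^ (i + 2) * e (i + 2) *
          ((n + (d + 1) - (i + 2)).choose (d + 1 - (i + 2))) := by
      have h1' : (L n : ℤ) + Nn (d + 1) (n - k) + Nn (d + 1) (n - k') ≤
        eJ * (n + d).choose (d + 1) + L 0 * Nn (d + 1) n := by exact_mod_cast h1
      have h7 : (eJ : ℤ) * (n + d).choose (d + 1) ≤ e 0 * (n + d).choose (d + 1) :=
        mul_le_mul_of_nonneg_right hle (Int.natCast_nonneg _)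
      simp only [add_assoc, Nat.reduceAdd] at h2 h1' ⊢
      nlinarith [h2, h1', h7]
    have h8 : (Nn (d + 1) (n - k) : ℝ) + Nn (d + 1) (n - k') ≤ Nn (d + 1) n -
        ∑ i ∈ Finset.range d, (-1 : ℝ) ^ (i + 2) * e (i + 2) *
          ((n + (d + 1) - (i + 2)).choose (d + 1 - (i + 2)) : ℝ) := by
      have := (Int.cast_le (R := ℝ)).2 h6
      refine le_of_eq_of_le ?_ (this.trans_eq ?_)
      · push_cast; rfl
      · rw [Int.cast_sub, Int.cast_sum]
        simp only [Int.cast_mul, Int.cast_pow, Int.cast_neg, Int.cast_one, Int.cast_natCast]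
    have h9 : ∑ i ∈ Finset.range d, ((-1 : ℝ) ^ (i + 2) * e (i + 2)) *
      (((n + (d + 1) - (i + 2)).choose (d + 1 - (i + 2)) : ℝ) / (n : ℝ) ^ d) =
      (∑ i ∈ Finset.range d, (-1 : ℝ) ^ (i + 2) * e (i + 2) *
          ((n + (d + 1) - (i + 2)).choose (d + 1 - (i + 2)) : ℝ)) / (n : ℝ) ^ d := by
      rw [Finset.sum_div]
      exact Finset.sum_congr rfl fun i _ => by rw [mul_div_assoc]
    rw [h9, ← add_div, Nat.sub_zero, ← sub_div]
    exact div_le_div_of_nonneg_right h8 (by positivity))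
  have h7 : (0 : ℝ) < 1 / (d.factorial : ℝ) := by positivity
  linarith

end PartM

/-! ### Part N: structure of the Sally module, first part -/
section PartN

variable {R : Type*} [CommRing R] [IsLocalRing R] [IsNoetherianRing R] {d : ℕ} {s : Fin d → R}

/-- the ideals `J^n * closure(I)` -/
def TT (s : Fin d → R) (n : ℕ) : Ideal R := JJ s ^ n * W (JJ s) 1

lemma JJ_le_W1 : JJ s ≤ W (JJ s) 1 := by
  have := pow_le_W (J := JJ s) 1
  rwa [pow_one] at this

lemma TT_le_W (n : ℕ) : TT s n ≤ W (JJ s) (n + 1) := by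
  rw [TT, Ideal.mul_le]
  intro a ha b hb
  exact W_mul_mem (pow_le_W n ha) hb

lemma pow_le_TT (n : ℕ) : JJ s ^ (n + 1) ≤ TT s n := by
  rw [TT, pow_succ]; exact Ideal.mul_mono le_rfl JJ_le_W1

lemma MP_TT (hJ : MP (JJ s)) (n : ℕ) : MP (TT s n) := (hJ.pow (n + 1)).mono (pow_le_TT n)

lemma pow_mul_TT {n k : ℕ} {c a : R} (hc : c ∈ JJ s ^ n) (ha : a ∈ TT s k) :
    c * a ∈ TT s (n + k) := by
  rw [TT, pow_add, mul_assoc]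
  exact Ideal.mul_mem_mul hc ha

lemma TT_cancel (hq : QReg s) (hJ : MP (JJ s)) {p n : ℕ}
    {f : MvPolynomial (Fin d) R} (hfp : f.IsHomogeneous p) (hf : f ∉ PE d (maximalIdeal R))
    {a : R} (h : MvPolynomial.eval s f * a ∈ TT s (p + n)) : a ∈ TT s n :=
  form_cancel hq hJ JJ_le_W1 hfp hf h

/-- the multiplicity one hypothesis in counting form -/
def Mult1 (s : Fin d → R) : Prop :=
  ∀ k k' n1 : ℕ, ¬ ∀ n ≥ n1, len (W (JJ s) (n + 1)) + Nn d (n - k) + Nn d (n - k') ≤ len (TT s n)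

lemma eval_mem_pow {p : ℕ} {f : MvPolynomial (Fin d) R} (hf : f.IsHomogeneous p) :
    MvPolynomial.eval s f ∈ JJ s ^ p := mem_JJ_pow.2 ⟨f, hf, rfl⟩

lemma pow_mul_W {n k : ℕ} {c a : R} (hc : c ∈ JJ s ^ n) (ha : a ∈ W (JJ s) k) :
    c * a ∈ W (JJ s) (n + k) := W_mul_mem (pow_le_W n hc) ha

lemma two_count (hJ : MP (JJ s)) (hm : Mult1 s) {k l n1 : ℕ} {y y' : R} (hy : y ∈ W (JJ s) (k + 1))
    (hy' : y' ∈ W (JJ s) (l + 1)) (hk : k ≤ n1) (hl : l ≤ n1)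
    (hA : ∀ n ≥ n1, ∀ f : MvPolynomial (Fin d) R, f.IsHomogeneous (n - k) →
      MvPolynomial.eval s f * y ∈ TT s n → f ∈ PE d (maximalIdeal R))
    (hB : ∀ n ≥ n1, ∀ f : MvPolynomial (Fin d) R, f.IsHomogeneous (n - l) → ∀ g ∈ JJ s ^ (n - k),
      MvPolynomial.eval s f * y' - g * y ∈ TT s n → f ∈ PE d (maximalIdeal R)) : False := by
  refine hm k l n1 fun n hn => ?_
  have hW : MP (TT s n) := MP_TT hJ n
  set Y1 : Ideal R := TT s n ⊔ JJ s ^ (n - k) * Ideal.span {y} with hY1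
  have hW1 : MP Y1 := hW.mono le_sup_left
  have hYW : Y1 ≤ W (JJ s) (n + 1) := by
    refine sup_le (TT_le_W n) ?_
    rw [Ideal.mul_le]
    intro a ha b hb
    obtain ⟨t, rfl⟩ := Ideal.mem_span_singleton'.1 hb
    have := pow_mul_W ha hy
    rw [show n - k + (k + 1) = n + 1 by omega] at this
    rw [show a * (t * y) = t * (a * y) by ring]
    exact Ideal.mul_mem_left _ _ this
  have h1 := count_one (s := s) hW (le_sup_left : TT s n ≤ Y1) y (n - k)
    (fun c hc => Ideal.mem_sup_right (Ideal.mul_mem_mul hc (Ideal.mem_span_singleton_self y)))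
    (fun f hf h => hA n hn f hf h)
  have h2 := count_one (s := s) hW1 hYW y' (n - l)
    (fun c hc => by
      have := pow_mul_W hc hy'
      rwa [show n - l + (l + 1) = n + 1 by omega] at this)
    (fun f hf h => by
      obtain ⟨t, ht, u, hu, htu⟩ := Submodule.mem_sup.1 h
      obtain ⟨g, hg, rfl⟩ := Ideal.mem_mul_span_singleton.1 hu
      refine hB n hn f hf g hg ?_
      rw [← htu]; simpa using ht)
  change len Y1 + _ ≤ _ at h1
  omega

/-- the Sally module is killed by the maximal ideal -/
lemma sally_m (hq : QReg s) (hJ : MP (JJ s)) (hm : Mult1 s) {k : ℕ} {y z : R}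
    (hy : y ∈ W (JJ s) (k + 1)) (hz : z ∈ maximalIdeal R) : z * y ∈ TT s k := by
  by_contra hzy
  obtain ⟨c, hc, hc'⟩ := (MP_TT hJ k).exists_socle hzy
  refine two_count hJ hm (k := k) (l := k) (n1 := k) (y := c * (z * y)) (y' := y)
    (Ideal.mul_mem_left _ _ (Ideal.mul_mem_left _ _ hy)) hy le_rfl le_rfl ?_ ?_
  · intro n hn f hf h
    by_contra hcon
    refine hc (TT_cancel hq hJ hf hcon (n := k) ?_)
    rwa [Nat.sub_add_cancel hn]
  · intro n hn f hf g hg h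
    by_contra hcon
    refine hzy (TT_cancel hq hJ hf hcon (n := k) ?_)
    rw [Nat.sub_add_cancel hn]
    have h1 : z * (MvPolynomial.eval s f * y - g * (c * (z * y))) ∈ TT s n :=
      Ideal.mul_mem_left _ _ h
    have h2 : g * (z * (c * (z * y))) ∈ TT s (n - k + k) := pow_mul_TT hg (hc' z hz)
    rw [Nat.sub_add_cancel hn] at h2
    have := Ideal.add_mem _ h1 h2
    convert this using 1
    ring

lemma sally_m_form (hq : QReg s) (hJ : MP (JJ s)) (hm : Mult1 s) {k n : ℕ} {y : R}
    (hy : y ∈ W (JJ s) (k + 1)) {f : MvPolynomial (Fin d) R} (hf : f.IsHomogeneous n)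
    (hfm : f ∈ PE d (maximalIdeal R)) : MvPolynomial.eval s f * y ∈ TT s (n + k) := by
  have h1 := eval_mem_JJ_pow_mul (s := s) hf hfm
  have h2 : JJ s ^ n * maximalIdeal R * Ideal.span {y} ≤ TT s (n + k) := by
    rw [mul_assoc, Ideal.mul_le]
    intro a ha b hb
    obtain ⟨z, hz, rfl⟩ := Ideal.mem_mul_span_singleton.1 hb
    exact pow_mul_TT ha (sally_m hq hJ hm hy hz)
  exact h2 (Ideal.mul_mem_mul h1 (Ideal.mem_span_singleton_self y))

/-- the Sally module has rank one -/
lemma sally_rank (hq : QReg s) (hJ : MP (JJ s)) (hm : Mult1 s) {k l : ℕ} {y y' : R}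
    (hy : y ∈ W (JJ s) (k + 1)) (hyT : y ∉ TT s k) (hy' : y' ∈ W (JJ s) (l + 1)) :
    ∃ n, k ≤ n ∧ l ≤ n ∧ ∃ F G : MvPolynomial (Fin d) R, F.IsHomogeneous (n - l) ∧
      G.IsHomogeneous (n - k) ∧ F ∉ PE d (maximalIdeal R) ∧
      MvPolynomial.eval s F * y' - MvPolynomial.eval s G * y ∈ TT s n := by
  by_contra hcon
  refine two_count hJ hm (n1 := max k l) hy hy' (le_max_left _ _) (le_max_right _ _) ?_ ?_
  · intro n hn f hf h
    by_contra hcon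
    refine hyT (TT_cancel hq hJ hf hcon (n := k) ?_)
    rwa [Nat.sub_add_cancel (le_trans (le_max_left _ _) hn)]
  · intro n hn f hf g hg h
    by_contra hfm
    obtain ⟨G, hG, rfl⟩ := mem_JJ_pow.1 hg
    exact hcon ⟨n, le_trans (le_max_left _ _) hn, le_trans (le_max_right _ _) hn, f, G, hf, hG,
      hfm, h⟩

/-! homogeneity of factors -/
section factors
variable {K : Type*} [CommRing K]

lemma wdeg (μ : Fin d →₀ ℕ) : Finsupp.weight (1 : Fin d → ℕ) μ = μ.degree := by
  rw [Finsupp.degree_eq_weight_one]; rfl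

/-- the grading homomorphism -/
noncomputable def grd (d : ℕ) (K : Type*) [CommRing K] :
    MvPolynomial (Fin d) K →ₐ[K] Polynomial (MvPolynomial (Fin d) K) :=
  MvPolynomial.aeval fun i => Polynomial.C (MvPolynomial.X i) * Polynomial.X

lemma grd_monomial (μ : Fin d →₀ ℕ) (a : K) : grd d K (MvPolynomial.monomial μ a) =
    Polynomial.monomial μ.degree (MvPolynomial.monomial μ a) := by
  rw [grd, MvPolynomial.aeval_monomial, ← Polynomial.C_mul_X_pow_eq_monomial,
    MvPolynomial.monomial_eq, Finsupp.degree_apply, map_mul]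
  rw [Polynomial.algebraMap_apply, MvPolynomial.algebraMap_eq, mul_assoc]
  congr 1
  rw [Finsupp.prod, Finsupp.prod, map_prod, ← Finset.prod_pow_eq_pow_sum, ← Finset.prod_mul_distrib]
  refine Finset.prod_congr rfl fun i _ => ?_
  rw [mul_pow, map_pow]

lemma coeff_grd (f : MvPolynomial (Fin d) K) (j : ℕ) (μ : Fin d →₀ ℕ) :
    MvPolynomial.coeff μ ((grd d K f).coeff j) =
      if μ.degree = j then MvPolynomial.coeff μ f else 0 := by
  classical
  induction f using MvPolynomial.induction_on' with
  | monomial ν a =>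
    rw [grd_monomial, Polynomial.coeff_monomial]
    by_cases h : ν = μ
    · subst h
      split_ifs <;> simp
    · split_ifs <;> simp [MvPolynomial.coeff_monomial, h]
  | add p q hp hq =>
    rw [map_add, Polynomial.coeff_add, MvPolynomial.coeff_add, hp, hq, MvPolynomial.coeff_add]
    split_ifs <;> simp

lemma grd_injective : Function.Injective (grd d K) := by
  intro f g h
  ext μ
  have h1 := coeff_grd f μ.degree μ
  have h2 := coeff_grd g μ.degree μ
  rw [if_pos rfl] at h1 h2
  rw [← h1, ← h2, h]

lemma grd_homog {f : MvPolynomial (Fin d) K} {n : ℕ} :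
    f.IsHomogeneous n ↔ grd d K f = Polynomial.monomial n f := by
  constructor
  · intro hf
    ext j μ
    rw [coeff_grd, Polynomial.coeff_monomial]
    by_cases h : MvPolynomial.coeff μ f = 0
    · split_ifs <;> simp [h]
    · have := hf h
      rw [wdeg] at this
      have h2 : μ.degree = n := this
      rw [h2]
      split_ifs <;> simp
  · intro h μ hμ
    rw [wdeg]
    change μ.degree = n
    have h1 := coeff_grd f n μ
    rw [h, Polynomial.coeff_monomial, if_pos rfl] at h1
    by_contra hcon
    rw [if_neg hcon] at h1
    exact hμ h1

lemma homog_of_mul [IsDomain K] {f g : MvPolynomial (Fin d) K} {n : ℕ} (h : (f * g).IsHomogeneous n)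
    (h0 : f * g ≠ 0) : ∃ a b, a + b = n ∧ f.IsHomogeneous a ∧ g.IsHomogeneous b := by
  have hf0 : grd d K f ≠ 0 := fun h' => left_ne_zero_of_mul h0
    (grd_injective (by rw [h', map_zero]))
  have hg0 : grd d K g ≠ 0 := fun h' => right_ne_zero_of_mul h0
    (grd_injective (by rw [h', map_zero]))
  have h1 := grd_homog.1 h
  rw [map_mul] at h1
  have h2 := Polynomial.natDegree_mul hf0 hg0
  have h3 := Polynomial.natTrailingDegree_mul hf0 hg0
  rw [h1, Polynomial.natDegree_monomial_eq _ h0] at h2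
  rw [h1, Polynomial.natTrailingDegree_monomial h0] at h3
  have h4 := Polynomial.natTrailingDegree_le_natDegree (grd d K f)
  have h5 := Polynomial.natTrailingDegree_le_natDegree (grd d K g)
  have key : ∀ f : MvPolynomial (Fin d) K,
      (grd d K f).natTrailingDegree = (grd d K f).natDegree →
      f.IsHomogeneous (grd d K f).natDegree := by
    intro f hf μ hμ
    rw [wdeg]
    change μ.degree = _
    have h1 := coeff_grd f μ.degree μ
    rw [if_pos rfl] at h1
    have h2 : (grd d K f).coeff μ.degree ≠ 0 := by
      intro h; rw [h] at h1; exact hμ (by simpa using h1.symm)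
    have h3 := Polynomial.le_natDegree_of_ne_zero h2
    have h4 := Polynomial.natTrailingDegree_le_of_ne_zero h2
    omega
  exact ⟨_, _, h2.symm, key f (by omega), key g (by omega)⟩

end factors
end PartN

/-! ### Part O: structure of the Sally module, second part -/
section PartO

variable {R : Type*} [CommRing R] [IsLocalRing R] [IsNoetherianRing R] {d : ℕ} {s : Fin d → R}

lemma homog_map {f : MvPolynomial (Fin d) R} {n : ℕ} (h : f.IsHomogeneous n) :
    (MvPolynomial.map (residue R) f).IsHomogeneous n := by
  intro μ hμ
  apply h
  intro h0
  rw [MvPolynomial.coeff_map, h0, map_zero] at hμ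
  exact hμ rfl

lemma lift_form {f0 : MvPolynomial (Fin d) (ResidueField R)} {n : ℕ} (h : f0.IsHomogeneous n) :
    ∃ f : MvPolynomial (Fin d) R, f.IsHomogeneous n ∧ MvPolynomial.map (residue R) f = f0 := by
  classical
  obtain ⟨g, rfl⟩ := map_res_surjective (R := R) f0
  refine ⟨MvPolynomial.homogeneousComponent n g,
    MvPolynomial.homogeneousComponent_isHomogeneous n g, ?_⟩
  ext μ
  rw [MvPolynomial.coeff_map, MvPolynomial.coeff_homogeneousComponent, MvPolynomial.coeff_map]
  split_ifs with hμ
  · rfl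
  · rw [map_zero]
    by_contra hne
    have hc : MvPolynomial.coeff μ (MvPolynomial.map (residue R) g) ≠ 0 := by
      rw [MvPolynomial.coeff_map]; exact fun h => hne h.symm
    have := h hc
    rw [wdeg] at this
    exact hμ this

lemma not_PE_iff {f : MvPolynomial (Fin d) R} :
    f ∉ PE d (maximalIdeal R) ↔ MvPolynomial.map (residue R) f ≠ 0 :=
  map_res_eq_zero.symm.not

lemma coprime_red {a b : ℕ} (hab : a ≤ b) {F G : MvPolynomial (Fin d) R} (hF : F.IsHomogeneous a)
    (hG : G.IsHomogeneous b) (hFm : F ∉ PE d (maximalIdeal R)) :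
    ∃ (u p r : ℕ) (H F' G' : MvPolynomial (Fin d) R), u + p = a ∧ u + r = b ∧
      H.IsHomogeneous u ∧ F'.IsHomogeneous p ∧ G'.IsHomogeneous r ∧
      H ∉ PE d (maximalIdeal R) ∧ F' ∉ PE d (maximalIdeal R) ∧
      F - H * F' ∈ PE d (maximalIdeal R) ∧ G - H * G' ∈ PE d (maximalIdeal R) ∧
      IsRelPrime (MvPolynomial.map (residue R) F') (MvPolynomial.map (residue R) G') := by
  have hF0 := not_PE_iff.1 hFm
  obtain ⟨f, g, h, hrel, hf, hg⟩ := UniqueFactorizationMonoid.exists_reduced_factors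
    (MvPolynomial.map (residue R) F) hF0 (MvPolynomial.map (residue R) G)
  have hhf : h * f ≠ 0 := by rw [hf]; exact hF0
  obtain ⟨u, p, hup, hh1, hf1⟩ := homog_of_mul (f := h) (g := f) (n := a)
    (by rw [hf]; exact homog_map hF) hhf
  have hg1 : ∃ r, u + r = b ∧ g.IsHomogeneous r := by
    by_cases hg0 : g = 0
    · exact ⟨b - u, by omega, by rw [hg0]; exact MvPolynomial.isHomogeneous_zero _ _ _⟩
    · obtain ⟨u', r, hur, hh2, hg2⟩ := homog_of_mul (f := h) (g := g) (n := b)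
        (by rw [hg]; exact homog_map hG) (mul_ne_zero (left_ne_zero_of_mul hhf) hg0)
      have := hh1.inj_right hh2 (left_ne_zero_of_mul hhf)
      exact ⟨r, by omega, hg2⟩
  obtain ⟨r, hur, hg1⟩ := hg1
  obtain ⟨H, hH, rfl⟩ := lift_form hh1
  obtain ⟨F', hF', rfl⟩ := lift_form hf1
  obtain ⟨G', hG', rfl⟩ := lift_form hg1
  refine ⟨u, p, r, H, F', G', hup, hur, hH, hF', hG', not_PE_iff.2 (left_ne_zero_of_mul hhf),
    not_PE_iff.2 (right_ne_zero_of_mul hhf), map_res_eq_zero.1 ?_, map_res_eq_zero.1 ?_, hrel⟩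
  · rw [map_sub, map_mul, hf, sub_self]
  · rw [map_sub, map_mul, hg, sub_self]

lemma hcop {p r N : ℕ} {F G A B : MvPolynomial (Fin d) R} (hF : F.IsHomogeneous p)
    (hG : G.IsHomogeneous r) (hFm : F ∉ PE d (maximalIdeal R))
    (hrel : IsRelPrime (MvPolynomial.map (residue R) F) (MvPolynomial.map (residue R) G))
    (hp : p ≤ N) (hr : r ≤ N) (hA : A.IsHomogeneous (N - p)) (hB : B.IsHomogeneous (N - r))
    (h : F * A + G * B ∈ PE d (maximalIdeal R)) :
    ∃ Γ : MvPolynomial (Fin d) R, (A - Γ * G).IsHomogeneous (N - p) ∧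
      (B + Γ * F).IsHomogeneous (N - r) ∧ A - Γ * G ∈ PE d (maximalIdeal R) ∧
      B + Γ * F ∈ PE d (maximalIdeal R) := by
  have hF0 := not_PE_iff.1 hFm
  have h0 := map_res_eq_zero.2 h
  rw [map_add, map_mul, map_mul] at h0
  set f := MvPolynomial.map (residue R) F with hf
  set g := MvPolynomial.map (residue R) G with hg
  have hdvd : f ∣ g * MvPolynomial.map (residue R) B :=
    ⟨-MvPolynomial.map (residue R) A, by linear_combination h0⟩
  obtain ⟨γ, hγ⟩ := hrel.dvd_of_dvd_mul_left hdvd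
  have hA' : MvPolynomial.map (residue R) A = - (g * γ) := by
    apply mul_left_cancel₀ hF0
    rw [hγ] at h0
    linear_combination h0
  by_cases hB0 : MvPolynomial.map (residue R) B = 0
  · have hγ0 : γ = 0 := by
      rw [hB0] at hγ
      exact (mul_eq_zero.1 hγ.symm).resolve_left hF0
    refine ⟨0, by simpa using hA, by simpa using hB, ?_, ?_⟩
    · rw [zero_mul, sub_zero]; exact map_res_eq_zero.1 (by rw [hA', hγ0]; simp)
    · rw [zero_mul, add_zero]; exact map_res_eq_zero.1 hB0
  · obtain ⟨p', q, hpq, h1, h2⟩ := homog_of_mul (f := f) (g := γ) (n := N - r)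
      (by rw [← hγ]; exact homog_map hB) (by rwa [← hγ])
    have hpp : p' = p := h1.inj_right (homog_map hF) hF0
    obtain ⟨Γ, hΓ, rfl⟩ := lift_form h2
    refine ⟨-Γ, hA.sub ?_, hB.add ?_, map_res_eq_zero.1 ?_, map_res_eq_zero.1 ?_⟩
    · have := (hΓ.neg).mul hG
      rwa [show q + r = N - p by omega] at this
    · have := (hΓ.neg).mul hF
      rwa [show q + p = N - r by omega] at this
    · rw [map_sub, map_mul, map_neg, hA']; ring
    · rw [map_add, map_mul, map_neg, hγ]; ring

lemma mem_pow_mul_sup {n : ℕ} {b : Ideal R} {x a : R}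
    (h : a ∈ JJ s ^ n * (b ⊔ Ideal.span {x})) : ∃ a0 ∈ JJ s ^ n * b,
      ∃ A : MvPolynomial (Fin d) R, A.IsHomogeneous n ∧ a = a0 + MvPolynomial.eval s A * x := by
  rw [Ideal.mul_sup] at h
  obtain ⟨t, ht, u, hu, htu⟩ := Submodule.mem_sup.1 h
  obtain ⟨g, hg, rfl⟩ := Ideal.mem_mul_span_singleton.1 hu
  obtain ⟨A, hA, rfl⟩ := mem_JJ_pow.1 hg
  exact ⟨t, ht, A, hA, htu.symm⟩

lemma form_m_mul {n : ℕ} {b : Ideal R} {x : R} (hx : ∀ r ∈ maximalIdeal R, r * x ∈ b)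
    {A : MvPolynomial (Fin d) R} (hA : A.IsHomogeneous n) (hAm : A ∈ PE d (maximalIdeal R)) :
    MvPolynomial.eval s A * x ∈ JJ s ^ n * b := by
  have h1 := eval_mem_JJ_pow_mul (s := s) hA hAm
  have h2 : JJ s ^ n * maximalIdeal R * Ideal.span {x} ≤ JJ s ^ n * b := by
    rw [mul_assoc]
    refine Ideal.mul_mono le_rfl ?_
    intro c hc
    obtain ⟨z, hz, rfl⟩ := Ideal.mem_mul_span_singleton.1 hc
    exact hx z hz
  exact h2 (Ideal.mul_mem_mul h1 (Ideal.mem_span_singleton_self x))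

/-- the induction predicate of the descent -/
def QQ (s : Fin d → R) (F G : MvPolynomial (Fin d) R) (p r : ℕ) (u0 v0 : R) (b : Ideal R)
    (N : ℕ) : Prop :=
  ∃ c, u0 - MvPolynomial.eval s G * c ∈ JJ s ^ (N - p) * b ∧
    v0 + MvPolynomial.eval s F * c ∈ JJ s ^ (N - r) * b

lemma descent_step (hq : QReg s) (hJ : MP (JJ s)) {p r N : ℕ} {F G : MvPolynomial (Fin d) R}
    (hF : F.IsHomogeneous p)
    (hG : G.IsHomogeneous r) (hFm : F ∉ PE d (maximalIdeal R))
    (hrel : IsRelPrime (MvPolynomial.map (residue R) F) (MvPolynomial.map (residue R) G))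
    (hp : p ≤ N) (hr : r ≤ N) {u0 v0 : R} (htop : QQ s F G p r u0 v0 ⊤ N) :
    ∀ b : Ideal R, MP b → JJ s ≤ b →
      MvPolynomial.eval s F * u0 + MvPolynomial.eval s G * v0 ∈ JJ s ^ N * b →
      QQ s F G p r u0 v0 b N := by
  refine mp_induction ?_ ?_
  · intro _ _; exact htop
  · intro b x hb hx hm ih hJb hh
    obtain ⟨c, h1, h2⟩ := ih (hJb.trans le_sup_left) (Ideal.mul_mono le_rfl le_sup_left hh)
    obtain ⟨a0, ha0, A, hA, hAe⟩ := mem_pow_mul_sup h1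
    obtain ⟨b0, hb0, B, hB, hBe⟩ := mem_pow_mul_sup h2
    have hFA : F * A + G * B ∈ PE d (maximalIdeal R) := by
      by_contra hcon
      apply hx
      have hhom : (F * A + G * B).IsHomogeneous N := by
        have e1 := hF.mul hA
        have e2 := hG.mul hB
        rw [Nat.add_sub_cancel' hp] at e1
        rw [Nat.add_sub_cancel' hr] at e2
        exact e1.add e2
      have := form_cancel hq hJ hJb hhom hcon (a := x) (n := 0) (by
        rw [add_zero]
        have e1 : MvPolynomial.eval s F * a0 ∈ JJ s ^ N * b := by
          have := Ideal.mul_mem_mul (eval_mem_pow (s := s) hF) ha0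
          rwa [← mul_assoc, ← pow_add, Nat.add_sub_cancel' hp] at this
        have e2 : MvPolynomial.eval s G * b0 ∈ JJ s ^ N * b := by
          have := Ideal.mul_mem_mul (eval_mem_pow (s := s) hG) hb0
          rwa [← mul_assoc, ← pow_add, Nat.add_sub_cancel' hr] at this
        have := Ideal.sub_mem _ (Ideal.sub_mem _ hh e1) e2
        convert this using 1
        simp only [map_add, map_mul]
        linear_combination (- MvPolynomial.eval s F) * hAe - MvPolynomial.eval s G * hBe)
      simpa using this
    obtain ⟨Γ, g1, g2, g3, g4⟩ := hcop hF hG hFm hrel hp hr hA hB hFA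
    refine ⟨c + MvPolynomial.eval s Γ * x, ?_, ?_⟩
    · have := Ideal.add_mem _ ha0 (form_m_mul (s := s) hm g1 g3)
      convert this using 1
      simp only [map_sub, map_mul]
      linear_combination hAe
    · have := Ideal.add_mem _ hb0 (form_m_mul (s := s) hm g2 g4)
      convert this using 1
      simp only [map_add, map_mul]
      linear_combination hBe

lemma descent (hq : QReg s) (hJ : MP (JJ s)) {p r n : ℕ} {F G : MvPolynomial (Fin d) R}
    (hF : F.IsHomogeneous p)
    (hG : G.IsHomogeneous r) (hFm : F ∉ PE d (maximalIdeal R))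
    (hrel : IsRelPrime (MvPolynomial.map (residue R) F) (MvPolynomial.map (residue R) G))
    (hpr : p ≤ r) (hr : r ≤ n) {u0 v0 : R}
    (hh : MvPolynomial.eval s F * u0 + MvPolynomial.eval s G * v0 ∈ TT s n) :
    QQ s F G p r u0 v0 (W (JJ s) 1) n := by
  have hhn : MvPolynomial.eval s F * u0 + MvPolynomial.eval s G * v0 ∈ JJ s ^ n :=
    Ideal.mul_le_left hh
  have key : ∀ i, r + i ≤ n → QQ s F G p r u0 v0 ⊤ (r + i) := by
    intro i
    induction i with
    | zero =>
      intro _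
      refine ⟨0, ?_, ?_⟩
      · rw [mul_zero, sub_zero, Ideal.mul_top]
        refine form_cancel' hq hJ hF hFm ?_
        rw [add_zero, Nat.add_sub_cancel' hpr]
        have e1 : MvPolynomial.eval s G * v0 ∈ JJ s ^ r :=
          Ideal.mul_mem_right _ _ (eval_mem_pow hG)
        have := Ideal.sub_mem _ (Ideal.pow_le_pow_right hr hhn) e1
        simpa using this
      · simp
    | succ i ih =>
      intro hi
      obtain ⟨c, h1, h2⟩ := descent_step hq hJ hF hG hFm hrel (by omega) (by omega)
        (ih (by omega)) (JJ s) hJ le_rfl (by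
          rw [← pow_succ]; exact Ideal.pow_le_pow_right (by omega) hhn)
      refine ⟨c, ?_, ?_⟩
      · rw [Ideal.mul_top]
        rw [← pow_succ] at h1
        rwa [show r + (i + 1) - p = r + i - p + 1 by omega]
      · rw [Ideal.mul_top]
        rw [← pow_succ] at h2
        rwa [show r + (i + 1) - r = r + i - r + 1 by omega]
  have h1 := key (n - r) (by omega)
  rw [Nat.add_sub_cancel' hr] at h1
  exact descent_step hq hJ hF hG hFm hrel (by omega) hr h1 _ (hJ.mono JJ_le_W1) JJ_le_W1 hh

/-- the Sally module is generated by an element of lowest degree -/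
lemma sally_gen (hq : QReg s) (hJ : MP (JJ s)) (hm : Mult1 s) {k l : ℕ} {y : R}
    (hy : y ∈ W (JJ s) (k + 1)) (hyT : y ∉ TT s k) (hmin : ∀ j < k, W (JJ s) (j + 1) ≤ TT s j)
    (hkl : k ≤ l) {y' : R} (hy' : y' ∈ W (JJ s) (l + 1)) :
    ∃ g ∈ JJ s ^ (l - k), y' - g * y ∈ TT s l := by
  obtain ⟨n, hkn, hln, F0, G0, hF0, hG0, hF0m, h0⟩ := sally_rank hq hJ hm hy hyT hy'
  obtain ⟨u, p, r, H, F, G, hup, hur, hH, hF, hG, hHm, hFm, e1, e2, hrel⟩ :=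
    coprime_red (by omega : n - l ≤ n - k) hF0 hG0 hF0m
  have hFG : MvPolynomial.eval s F * y' - MvPolynomial.eval s G * y ∈ TT s (p + l) := by
    refine TT_cancel hq hJ hH hHm ?_
    rw [show u + (p + l) = n by omega]
    have t1 := sally_m_form hq hJ hm hy' (n := n - l)
      (hF0.sub (by have := hH.mul hF; rwa [hup] at this)) e1
    have t2 := sally_m_form hq hJ hm hy (n := n - k)
      (hG0.sub (by have := hH.mul hG; rwa [hur] at this)) e2
    rw [Nat.sub_add_cancel hln] at t1
    rw [Nat.sub_add_cancel hkn] at t2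
    have := Ideal.add_mem _ (Ideal.sub_mem _ h0 t1) t2
    convert this using 1
    simp only [map_sub, map_mul]
    ring
  rcases Nat.eq_zero_or_pos p with hp0 | hp0
  · subst hp0
    rw [zero_add] at hFG
    have hu : IsUnit (MvPolynomial.eval s F) := by
      by_contra hcon
      apply hFm
      have hFC : F = MvPolynomial.C (MvPolynomial.coeff 0 F) :=
        (MvPolynomial.totalDegree_eq_zero_iff_eq_C).1 (by
          have := hF.totalDegree_le; omega)
      rw [hFC]
      refine Ideal.mem_map_of_mem _ ?_
      rw [hFC, MvPolynomial.eval_C] at hcon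
      exact hcon
    obtain ⟨v, hv⟩ := hu.exists_left_inv
    refine ⟨v * MvPolynomial.eval s G, ?_, ?_⟩
    · have := eval_mem_pow (s := s) hG
      rw [show r = l - k by omega] at this
      exact Ideal.mul_mem_left _ _ this
    · have := Ideal.mul_mem_left _ v hFG
      convert this using 1
      linear_combination (- y') * hv
  · exfalso
    obtain ⟨c, _, h2⟩ := descent hq hJ hF hG hFm hrel (by omega) (by omega : r ≤ p + l)
      (u0 := y') (v0 := -y) (by convert hFG using 1; ring)
    rw [show p + l - r = k by omega] at h2
    change _ ∈ TT s k at h2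
    have hcT : MvPolynomial.eval s F * c ∉ TT s k := by
      intro h3
      apply hyT
      have := Ideal.sub_mem _ h3 h2
      convert this using 1
      ring
    apply hcT
    by_cases hpk : p ≤ k
    · have h3 : MvPolynomial.eval s F * c ∈ W (JJ s) (k + 1) := by
        have := Ideal.add_mem _ (TT_le_W k h2) hy
        convert this using 1
        ring
      have h4 : c ∈ W (JJ s) (k - p + 1) := W_cancel hq hJ hF hFm (by
        rwa [show p + (k - p + 1) = k + 1 by omega])
      have := pow_mul_TT (eval_mem_pow (s := s) hF) (hmin (k - p) (by omega) h4)
      rwa [Nat.add_sub_cancel' hpk] at this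
    · refine pow_le_TT k (Ideal.mul_mem_right _ _ ?_)
      exact Ideal.pow_le_pow_right (by omega : k + 1 ≤ p) (eval_mem_pow hF)

/-- the annihilator of the generator -/
lemma sally_ann (hq : QReg s) (hJ : MP (JJ s)) (hm : Mult1 s) {k n : ℕ} {y : R}
    (hy : y ∈ W (JJ s) (k + 1)) (hyT : y ∉ TT s k) {c : R} (hc : c ∈ JJ s ^ n) :
    c * y ∈ TT s (n + k) ↔ c ∈ JJ s ^ n * maximalIdeal R := by
  constructor
  · intro h
    obtain ⟨f, hf, rfl⟩ := mem_JJ_pow.1 hc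
    refine eval_mem_JJ_pow_mul hf ?_
    by_contra hcon
    exact hyT (TT_cancel hq hJ hf hcon h)
  · intro h
    obtain ⟨f, hf, hfm, rfl⟩ := mem_JJ_pow_mul.1 h
    exact sally_m_form hq hJ hm hy hf hfm

end PartO

/-! ### Part P: the isomorphism and the depth -/
section PartP
open RingTheory.Sequence
open scoped Pointwise

lemma rees_monomial_mem {R : Type*} [CommRing R] {J : Ideal R} {n : ℕ} {c : R} (hc : c ∈ J ^ n) :
    Polynomial.monomial n c ∈ reesAlgebra J := by
  intro i
  rw [Polynomial.coeff_monomial]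
  split_ifs with h
  · exact h ▸ hc
  · exact Ideal.zero_mem _

lemma rees_eq_sum {R : Type*} [CommRing R] {J : Ideal R} (r : reesAlgebra J) :
    r = ∑ n ∈ (r : Polynomial R).support,
      (⟨Polynomial.monomial n ((r : Polynomial R).coeff n), rees_monomial_mem (r.2 n)⟩ :
        reesAlgebra J) := by
  apply Subtype.ext
  rw [AddSubmonoidClass.coe_finset_sum]
  exact (r : Polynomial R).as_sum_support

lemma mem_map_rees {R : Type*} [CommRing R] {J a : Ideal R} (r : reesAlgebra J) :
    r ∈ Ideal.map (algebraMap R (reesAlgebra J)) a ↔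
      ∀ n, (r : Polynomial R).coeff n ∈ J ^ n * a := by
  constructor
  · intro h
    refine Submodule.span_induction (p := fun (r : reesAlgebra J) _ => ∀ n,
      (r : Polynomial R).coeff n ∈ J ^ n * a)
      ?_ ?_ ?_ ?_ h
    · rintro _ ⟨z, hz, rfl⟩ n
      change (Polynomial.C z).coeff n ∈ _
      rw [Polynomial.coeff_C]
      split_ifs with h0
      · subst h0; simpa using hz
      · exact Ideal.zero_mem _
    · intro n; simp
    · intro x y _ _ hx hy n
      change ((x : Polynomial R) + (y : Polynomial R)).coeff n ∈ _
      rw [Polynomial.coeff_add]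
      exact Ideal.add_mem _ (hx n) (hy n)
    · intro c x _ hx n
      change ((c : Polynomial R) * (x : Polynomial R)).coeff n ∈ _
      rw [Polynomial.coeff_mul]
      refine Ideal.sum_mem _ fun ij hij => ?_
      have := Ideal.mul_mem_mul (c.2 ij.1) (hx ij.2)
      rwa [← mul_assoc, ← pow_add, Finset.HasAntidiagonal.mem_antidiagonal.1 hij] at this
  · intro h
    rw [rees_eq_sum r]
    refine Ideal.sum_mem _ fun n _ => ?_
    have key : ∀ c (hc : c ∈ J ^ n * a), (⟨Polynomial.monomial n c,
        rees_monomial_mem (Ideal.mul_le_left hc)⟩ : reesAlgebra J) ∈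
        Ideal.map (algebraMap R (reesAlgebra J)) a := by
      intro c hc
      refine Submodule.mul_induction_on' (C := fun c hc => (⟨Polynomial.monomial n c,
        rees_monomial_mem (Ideal.mul_le_left hc)⟩ : reesAlgebra J) ∈
        Ideal.map (algebraMap R (reesAlgebra J)) a) ?_ ?_ hc
      · intro b hb z hz
        have h1 : (⟨Polynomial.monomial n (b * z), rees_monomial_mem (Ideal.mul_le_left
            (Ideal.mul_mem_mul hb hz))⟩ : reesAlgebra J) =
            ⟨Polynomial.monomial n b, rees_monomial_mem hb⟩ * algebraMap R (reesAlgebra J) z := by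
          apply Subtype.ext
          change Polynomial.monomial n (b * z) = Polynomial.monomial n b * Polynomial.C z
          rw [Polynomial.monomial_mul_C]
        rw [h1]
        exact Ideal.mul_mem_left _ _ (Ideal.mem_map_of_mem _ hz)
      · intro x hx y hy h1 h2
        have := Ideal.add_mem _ h1 h2
        convert this using 1
        apply Subtype.ext
        change Polynomial.monomial n (x + y) = Polynomial.monomial n x + Polynomial.monomial n y
        rw [map_add]
    exact key _ (h n)

lemma coeff_mul_mon {R : Type*} [CommRing R] (r : Polynomial R) (k l : ℕ) (y : R) :
    (r * Polynomial.monomial k y).coeff l = if k ≤ l then r.coeff (l - k) * y else 0 := by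
  rw [← Polynomial.C_mul_X_pow_eq_monomial, ← mul_assoc, Polynomial.coeff_mul_X_pow']
  split_ifs <;> simp

lemma sally_iso {R : Type*} [CommRing R] {J m : Ideal R} (Wf Tf : ℕ → Ideal R)
    (N₁ N₂ : Submodule (reesAlgebra J) (Polynomial R))
    (h₁ : ∀ p : Polynomial R, p ∈ N₁ ↔ (p.coeff 0 = 0 ∧ ∀ n, 1 ≤ n → p.coeff n ∈ Wf n))
    (h₂ : ∀ p : Polynomial R, p ∈ N₂ ↔ (p.coeff 0 = 0 ∧ ∀ n, 1 ≤ n → p.coeff n ∈ Tf n))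
    (k : ℕ) (hk : 1 ≤ k) (y : R) (hy : y ∈ Wf k)
    (hlow : ∀ l, 1 ≤ l → l < k → Wf l ≤ Tf l)
    (hgen : ∀ l, k ≤ l → ∀ y' ∈ Wf l, ∃ g ∈ J ^ (l - k), y' - g * y ∈ Tf l)
    (hann : ∀ n, ∀ c ∈ J ^ n, (c * y ∈ Tf (n + k) ↔ c ∈ J ^ n * m)) :
    Nonempty ((submoduleQuot N₁ N₂) ≃ₗ[reesAlgebra J]
      ((reesAlgebra J) ⧸ Ideal.map (algebraMap R (reesAlgebra J)) m)) := by
  classical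
  have hyN : Polynomial.monomial k y ∈ N₁ := by
    rw [h₁]
    refine ⟨by rw [Polynomial.coeff_monomial, if_neg (by omega)], fun n _ => ?_⟩
    rw [Polynomial.coeff_monomial]
    split_ifs with h
    · exact h ▸ hy
    · exact Ideal.zero_mem _
  let φ : reesAlgebra J →ₗ[reesAlgebra J] submoduleQuot N₁ N₂ :=
    LinearMap.toSpanSingleton _ _ (Submodule.Quotient.mk ⟨Polynomial.monomial k y, hyN⟩)
  have hφ : ∀ r (p : N₁), φ r = Submodule.Quotient.mk p ↔
      (p : Polynomial R) - (r : Polynomial R) * Polynomial.monomial k y ∈ N₂ := by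
    intro r p
    rw [eq_comm, LinearMap.toSpanSingleton_apply, ← Submodule.Quotient.mk_smul,
      Submodule.Quotient.eq]
    rfl
  have hsurj : Function.Surjective φ := by
    intro q
    obtain ⟨⟨p, hp⟩, rfl⟩ := Submodule.Quotient.mk_surjective _ q
    have hp' := (h₁ p).1 hp
    choose! g hg hg' using fun n : ℕ => hgen (n + k) (by omega) (p.coeff (n + k))
      (hp'.2 (n + k) (by omega))
    have hr : ∑ n ∈ Finset.range (p.natDegree + 1), Polynomial.monomial n (g n) ∈
        reesAlgebra J := by
      refine Subalgebra.sum_mem _ fun n _ => rees_monomial_mem ?_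
      have := hg n
      rwa [Nat.add_sub_cancel] at this
    refine ⟨⟨_, hr⟩, (hφ _ _).2 ?_⟩
    rw [h₂]
    have hc : ∀ n, (∑ n ∈ Finset.range (p.natDegree + 1), Polynomial.monomial n (g n)).coeff n =
        if n < p.natDegree + 1 then g n else 0 := by
      intro n
      rw [Polynomial.finset_sum_coeff]
      simp [Polynomial.coeff_monomial]
    refine ⟨?_, fun n hn => ?_⟩
    · rw [Polynomial.coeff_sub, coeff_mul_mon, if_neg (by omega), hp'.1, sub_zero]
    · rw [Polynomial.coeff_sub, coeff_mul_mon]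
      split_ifs with hkn
      · rw [hc]
        split_ifs with hlt
        · have := hg' (n - k)
          rwa [Nat.sub_add_cancel hkn] at this
        · have : p.coeff n = 0 := Polynomial.coeff_eq_zero_of_natDegree_lt (by omega)
          rw [this]; simp
      · rw [sub_zero]
        exact hlow n hn (by omega) (hp'.2 n hn)
  have hker : LinearMap.ker φ = Ideal.map (algebraMap R (reesAlgebra J)) m := by
    ext r
    rw [LinearMap.mem_ker, mem_map_rees]
    have h0 : (0 : submoduleQuot N₁ N₂) = Submodule.Quotient.mk 0 := rfl
    rw [h0, hφ, h₂]
    constructor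
    · rintro ⟨_, h⟩ n
      have := h (n + k) (by omega)
      rw [Polynomial.coeff_sub, coeff_mul_mon, if_pos (by omega), Nat.add_sub_cancel] at this
      refine (hann n _ (r.2 n)).1 ?_
      simpa using this
    · intro h
      refine ⟨?_, fun n hn => ?_⟩
      · rw [Polynomial.coeff_sub, coeff_mul_mon, if_neg (by omega)]; simp
      · rw [Polynomial.coeff_sub, coeff_mul_mon]
        split_ifs with hkn
        · have := (hann (n - k) _ (r.2 (n - k))).2 (h (n - k))
          rw [Nat.sub_add_cancel hkn] at this
          simpa using this
        · simp
  exact ⟨((Submodule.quotEquivOfEq _ _ hker.symm).trans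
    (φ.quotKerEquivOfSurjective hsurj)).symm⟩

/-- the comparison map from the polynomial ring to the Rees algebra -/
noncomputable def thA {R : Type*} [CommRing R] {d : ℕ} (s : Fin d → R) :
    MvPolynomial (Fin d) R →ₐ[R] reesAlgebra (JJ s) :=
  MvPolynomial.aeval fun i => ⟨Polynomial.monomial 1 (s i), rees_monomial_mem (by
    rw [pow_one]; exact Ideal.subset_span ⟨i, rfl⟩)⟩

lemma thA_coe {R : Type*} [CommRing R] {d : ℕ} (s : Fin d → R) (f : MvPolynomial (Fin d) R) :
    (thA s f : Polynomial R) = Polynomial.map (MvPolynomial.eval s) (grd d R f) := by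
  have h : ((reesAlgebra (JJ s)).val.comp (thA s)).toRingHom =
      (Polynomial.mapRingHom (MvPolynomial.eval s)).comp (grd d R).toRingHom := by
    apply MvPolynomial.ringHom_ext
    · intro r
      simp [thA, grd, Polynomial.algebraMap_apply]
    · intro i
      simp [thA, grd, Polynomial.C_mul_X_eq_monomial]
  exact congrArg (fun g => g f) h

lemma grd_coeff_homog {R : Type*} [CommRing R] {d : ℕ} (f : MvPolynomial (Fin d) R) (n : ℕ) :
    ((grd d R f).coeff n).IsHomogeneous n := by
  intro μ hμ
  rw [coeff_grd] at hμ
  rw [wdeg]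
  by_contra h
  rw [if_neg h] at hμ
  exact hμ rfl

/-- surjection onto the fiber ring -/
lemma thA_surjective {R : Type*} [CommRing R] {d : ℕ} (s : Fin d → R) :
    Function.Surjective (thA s) := by
  intro r
  rw [← AlgHom.mem_range, rees_eq_sum r]
  refine Subalgebra.sum_mem _ fun n _ => ?_
  obtain ⟨f, hf, hfe⟩ := mem_JJ_pow.1 (r.2 n)
  refine ⟨f, Subtype.ext ?_⟩
  change (thA s f : Polynomial R) = _
  rw [thA_coe, grd_homog.1 hf, Polynomial.map_monomial, hfe]

lemma thA_mem {R : Type*} [CommRing R] [IsLocalRing R] {d : ℕ} {s : Fin d → R}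
    (hq : QReg s) (hJm : JJ s ≤ maximalIdeal R) (f : MvPolynomial (Fin d) R) :
    thA s f ∈ Ideal.map (algebraMap R (reesAlgebra (JJ s))) (maximalIdeal R) ↔
      f ∈ PE d (maximalIdeal R) := by
  rw [mem_map_rees]
  constructor
  · intro h
    rw [mem_PE]
    intro μ
    have h1 := h μ.degree
    rw [thA_coe, Polynomial.coeff_map] at h1
    have h2 := qreg_aux (fun f hf h => hq _ f hf h) _ (grd_coeff_homog f μ.degree) _ hJm h1
    have h3 := mem_PE.1 h2 μ
    rwa [coeff_grd, if_pos rfl] at h3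
  · intro h n
    rw [thA_coe, Polynomial.coeff_map]
    refine eval_mem_JJ_pow_mul (grd_coeff_homog f n) (mem_PE.2 fun μ => ?_)
    rw [coeff_grd]
    split_ifs
    · exact mem_PE.1 h μ
    · exact Ideal.zero_mem _

lemma equiv_of_ker {A B C : Type*} [CommRing A] [CommRing B] [CommRing C] (f : A →+* B)
    (g : A →+* C) (hf : Function.Surjective f) (hg : Function.Surjective g)
    (h : RingHom.ker f = RingHom.ker g) : ∃ e : B ≃+* C, ∀ a, e (f a) = g a := by
  refine ⟨((RingHom.quotientKerEquivOfSurjective hf).symm.trans (Ideal.quotEquivOfEq h)).trans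
    (RingHom.quotientKerEquivOfSurjective hg), fun a => ?_⟩
  have : f a = RingHom.quotientKerEquivOfSurjective hf (Ideal.Quotient.mk _ a) := rfl
  rw [RingEquiv.trans_apply, RingEquiv.trans_apply, this, RingEquiv.symm_apply_apply]
  rfl

lemma equiv_of_ker' {P A C : Type*} [CommRing P] [CommRing A] [CommRing C] (I : Ideal A)
    (t : P →+* A) (g : P →+* C) (ht : Function.Surjective t) (hg : Function.Surjective g)
    (h : ∀ f, t f ∈ I ↔ g f = 0) : ∃ e : (A ⧸ I) ≃+* C, ∀ f, e (Ideal.Quotient.mk I (t f)) = g f := by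
  refine equiv_of_ker ((Ideal.Quotient.mk I).comp t) g (Ideal.Quotient.mk_surjective.comp ht) hg ?_
  ext f
  rw [RingHom.mem_ker, RingHom.mem_ker, ← h, RingHom.comp_apply, Ideal.Quotient.eq_zero_iff_mem]

lemma fiber_equiv {R : Type*} [CommRing R] [IsLocalRing R] {d : ℕ} {s : Fin d → R}
    (hq : QReg s) (hJm : JJ s ≤ maximalIdeal R) :
    ∃ e : (reesAlgebra (JJ s) ⧸ Ideal.map (algebraMap R (reesAlgebra (JJ s))) (maximalIdeal R)) ≃+*
      MvPolynomial (Fin d) (ResidueField R), ∀ f : MvPolynomial (Fin d) R,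
        e (Ideal.Quotient.mk _ (thA s f)) = MvPolynomial.map (residue R) f :=
  equiv_of_ker' (Ideal.map (algebraMap R (reesAlgebra (JJ s))) (maximalIdeal R))
    (thA s).toRingHom (MvPolynomial.map (residue R)) (thA_surjective s) map_res_surjective
    (fun f => (thA_mem hq hJm f).trans map_res_eq_zero.symm)

lemma regular_length_le : ∀ (n : ℕ) (S : Type*) [CommRing S] (rs : List S), rs.length = n →
    IsRegular S rs → (n : WithBot ℕ∞) ≤ ringKrullDim S := by
  intro n
  induction n with
  | zero =>
    intro S _ rs hl h
    haveI := h.nontrivial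
    simpa using ringKrullDim_nonneg_of_nontrivial
  | succ n ih =>
    intro S _ rs hl h
    obtain ⟨r, rs, rfl⟩ := List.exists_cons_of_length_eq_add_one hl
    rw [isRegular_cons_iff] at h
    have he : (r • (⊤ : Submodule S S)) = Ideal.span {r} := by
      ext x
      rw [Submodule.mem_smul_pointwise_iff_exists, Ideal.mem_span_singleton']
      constructor
      · rintro ⟨b, _, rfl⟩; exact ⟨b, by rw [smul_eq_mul, mul_comm]⟩
      · rintro ⟨b, rfl⟩; exact ⟨b, trivial, by rw [smul_eq_mul, mul_comm]⟩
    let e : QuotSMulTop r S ≃ₗ[S] (S ⧸ Ideal.span {r}) := Submodule.quotEquivOfEq _ _ he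
    have h2 : IsRegular (S ⧸ Ideal.span {r}) (rs.map (Ideal.Quotient.mk (Ideal.span {r}))) := by
      refine (AddEquiv.isRegular_congr (e := e.toAddEquiv) ?_).1 h.2
      rw [List.forall₂_map_right_iff, List.forall₂_same]
      intro a _ x
      change e (a • x) = _
      rw [map_smul]
      rfl
    have h3 := ih _ _ (by simpa using hl) h2
    have hr : r ∈ nonZeroDivisors S := by
      rw [mem_nonZeroDivisors_iff]
      refine ⟨fun x hx => h.1 (by simpa using hx), fun x hx => h.1 ?_⟩
      change r * x = r * 0
      rw [mul_comm, hx, mul_zero]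
    have h4 := ringKrullDim_quotient_succ_le_of_nonZeroDivisor hr
    refine le_trans ?_ h4
    push_cast
    gcongr

lemma regular_X (d : ℕ) (K : Type*) [Field K] :
    IsRegular (MvPolynomial (Fin d) K)
      (List.ofFn fun i : Fin d => (MvPolynomial.X i : MvPolynomial (Fin d) K)) := by
  classical
  have hsp : ∀ i, i ≤ d → Ideal.ofList ((List.ofFn fun i : Fin d =>
      (MvPolynomial.X i : MvPolynomial (Fin d) K)).take i) =
      Ideal.span (MvPolynomial.X '' {j : Fin d | (j : ℕ) < i}) := by
    intro i hi
    rw [Ideal.ofList]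
    congr 1
    ext x
    simp only [Set.mem_setOf_eq, Set.mem_image, List.mem_take_iff_getElem, List.getElem_ofFn,
      List.length_ofFn]
    constructor
    · rintro ⟨j, hj, rfl⟩
      exact ⟨⟨j, by omega⟩, by simp; omega, rfl⟩
    · rintro ⟨j, hj, rfl⟩
      exact ⟨j, by omega, rfl⟩
  refine ⟨⟨?_⟩, ?_⟩
  · intro i hi
    have hid : i < d := by simpa using hi
    rw [hsp i hid.le, smul_eq_mul, Ideal.mul_top]
    rw [isSMulRegular_iff_right_eq_zero_of_smul]
    intro q
    obtain ⟨f, rfl⟩ := Submodule.Quotient.mk_surjective _ q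
    intro h
    rw [← Submodule.Quotient.mk_smul, Submodule.Quotient.mk_eq_zero, List.getElem_ofFn,
      smul_eq_mul] at h
    rw [Submodule.Quotient.mk_eq_zero]
    rw [MvPolynomial.mem_ideal_span_X_image] at h ⊢
    intro μ hμ
    obtain ⟨j, hj, hj'⟩ := h (Finsupp.single ⟨i, hid⟩ 1 + μ) (by
      rw [MvPolynomial.mem_support_iff, MvPolynomial.coeff_X_mul]
      exact MvPolynomial.mem_support_iff.1 hμ)
    refine ⟨j, hj, ?_⟩
    have hne : (⟨i, hid⟩ : Fin d) ≠ j := by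
      rintro rfl
      simp at hj
    simpa [Finsupp.single_apply, hne] using hj'
  · have h1 := hsp d le_rfl
    rw [List.take_of_length_le (by simp)] at h1
    rw [h1, smul_eq_mul, Ideal.mul_top]
    intro h
    have : (1 : MvPolynomial (Fin d) K) ∈
        Ideal.span (MvPolynomial.X '' {j : Fin d | (j : ℕ) < d}) := by
      rw [← h]; trivial
    rw [MvPolynomial.mem_ideal_span_X_image] at this
    obtain ⟨j, _, hj⟩ := this 0 (by simp)
    exact hj rfl

lemma rdepth_fiber {R : Type*} [CommRing R] [IsLocalRing R] {d : ℕ} {s : Fin d → R}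
    (hq : QReg s) (hJm : JJ s ≤ maximalIdeal R) (MJ : Ideal (reesAlgebra (JJ s)))
    (hMJ : ∀ p : reesAlgebra (JJ s), p ∈ MJ ↔ (p : Polynomial R).coeff 0 ∈ maximalIdeal R)
    (M : Type*) [AddCommGroup M] [Module (reesAlgebra (JJ s)) M]
    (E : M ≃ₗ[reesAlgebra (JJ s)]
      (reesAlgebra (JJ s) ⧸ Ideal.map (algebraMap R (reesAlgebra (JJ s))) (maximalIdeal R))) :
    rdepth (reesAlgebra (JJ s)) MJ M = (d : ℕ∞) := by
  obtain ⟨e, he⟩ := fiber_equiv hq hJm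
  have key : ∀ rs : List (reesAlgebra (JJ s)), IsRegular M rs ↔
      IsRegular (MvPolynomial (Fin d) (ResidueField R))
        (rs.map fun a => e (Ideal.Quotient.mk _ a)) := by
    intro rs
    rw [LinearEquiv.isRegular_congr E]
    refine AddEquiv.isRegular_congr (e := e.toAddEquiv) ?_
    rw [List.forall₂_map_right_iff, List.forall₂_same]
    intro a _ x
    obtain ⟨b, rfl⟩ := Ideal.Quotient.mk_surjective x
    change e (Ideal.Quotient.mk _ (a * b)) = _
    rw [map_mul, map_mul]
    rfl
  apply le_antisymm
  · refine sSup_le ?_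
    rintro _ ⟨rs, rfl, _, hrs⟩
    have h1 := regular_length_le _ _ _ rfl ((key rs).1 hrs)
    rw [MvPolynomial.ringKrullDim_of_isNoetherianRing, ringKrullDim_eq_zero_of_field] at h1
    simp at h1
    exact_mod_cast h1
  · refine le_sSup ⟨List.ofFn fun i => thA s (MvPolynomial.X i), by simp, ?_, ?_⟩
    · intro x hx
      rw [List.mem_ofFn] at hx
      obtain ⟨i, rfl⟩ := hx
      rw [hMJ, thA_coe, grd, MvPolynomial.aeval_X]
      simp
    · rw [key, List.map_ofFn]
      have : ((fun a => e (Ideal.Quotient.mk _ a)) ∘ fun i => thA s (MvPolynomial.X i)) =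
          fun i => (MvPolynomial.X i : MvPolynomial (Fin d) (ResidueField R)) := by
        funext i
        rw [Function.comp_apply, he, MvPolynomial.map_X]
      rw [this]
      exact regular_X d _

end PartP

theorem sally_free_rank_one_of_multiplicity_one
    (R : Type*) [CommRing R] [IsLocalRing R] [IsNoetherianRing R]
    (d : ℕ) (hd : 0 < d) (hdim : ringKrullDim R = d)
    (hCM : IsCMLocal R) (hAU : AnalyticallyUnramified R)
    (hres : Infinite (ResidueField R))
    (I J : Ideal R) (hI : IsMPrimary I) (hJ : IsMinimalReduction d J I)
    -- the Sally module of the normal filtration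
    (N₁ N₂ : Submodule (reesAlgebra J) (Polynomial R))
    (h₁ : ∀ p : Polynomial R, p ∈ N₁ ↔
      (p.coeff 0 = 0 ∧ ∀ n, 1 ≤ n → p.coeff n ∈ intCl (I ^ (n + 1))))
    (h₂ : ∀ p : Polynomial R, p ∈ N₂ ↔
      (p.coeff 0 = 0 ∧ ∀ n, 1 ≤ n → p.coeff n ∈ J ^ n * intCl I))
    (hnz : Nontrivial (submoduleQuot N₁ N₂))
    -- `S̄` has multiplicity one, i.e. `ē₁ = e₀ − λ(R/Ī) + 1`
    (L : ℕ → ℕ) (e : ℕ → ℤ) (hHilb : NormalHilbertData d I L e)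
    (he1 : e 1 = e 0 - L 0 + 1)
    -- the maximal homogeneous ideal of the Rees algebra of `J`
    (MJ : Ideal (reesAlgebra J))
    (hMJ : ∀ p : reesAlgebra J, p ∈ MJ ↔ (p : Polynomial R).coeff 0 ∈ maximalIdeal R) :
    -- `S̄` is free of rank one over `B = R(J)/m·R(J)`, and `depth S̄ = d`
    Nonempty ((submoduleQuot N₁ N₂) ≃ₗ[reesAlgebra J]
      ((reesAlgebra J) ⧸ Ideal.map (algebraMap R (reesAlgebra J)) (maximalIdeal R))) ∧
    rdepth (reesAlgebra J) MJ (submoduleQuot N₁ N₂) = (d : ℕ∞) := by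
  classical
  obtain ⟨hJI, ⟨s, hs⟩, hred⟩ := hJ
  change J = JJ s at hs
  subst hs
  have hIm : I ≤ maximalIdeal R := by
    have : I ≤ I.radical := Ideal.le_radical
    rwa [show I.radical = maximalIdeal R from hI] at this
  have hJm : JJ s ≤ maximalIdeal R := hJI.trans hIm
  have hsm : ∀ i, s i ∈ maximalIdeal R := fun i => hJm (Ideal.subset_span ⟨i, rfl⟩)
  have hrad : maximalIdeal R ≤ (JJ s).radical := by
    obtain ⟨N, hN⟩ := hred
    have h1 : I ^ (N + 1) ≤ JJ s := by rw [hN N le_rfl]; exact Ideal.mul_le_left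
    have h2 := Ideal.radical_mono h1
    rw [Ideal.radical_pow I (Nat.succ_ne_zero N), show I.radical = maximalIdeal R from hI] at h2
    exact h2
  have hMP : MP (JJ s) := by
    obtain ⟨n, hn⟩ := Ideal.exists_radical_pow_le_of_fg (JJ s) (IsNoetherian.noetherian _)
    exact ⟨n, (Ideal.pow_right_mono hrad n).trans hn⟩
  have hwr : WReg s := wreg_of_CM hdim hCM s hsm hrad
  have hq : QReg s := qreg_of_wreg s hwr
  have hreg : ∀ z, s ⟨0, hd⟩ * z = 0 → z = 0 := by
    intro z hz
    have hemp : s '' {j | j < (⟨0, hd⟩ : Fin d)} = ∅ := by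
      rw [Set.image_eq_empty]
      ext j
      simp [Fin.lt_def]
    have := hwr ⟨0, hd⟩ z (by rw [hz]; exact Ideal.zero_mem _)
    rw [hemp, Ideal.span_empty] at this
    exact this
  have hs0 : s ⟨0, hd⟩ ∈ JJ s := Ideal.subset_span ⟨_, rfl⟩
  have hW : ∀ n, intCl (I ^ n) = W (JJ s) n := intCl_eq_W hJI hred _ hs0 hreg
  have hW1 : intCl I = W (JJ s) 1 := by rw [← hW 1, pow_one]
  obtain ⟨hL, hpoly⟩ := hHilb
  have hMPW : ∀ n, MP (W (JJ s) n) := fun n => (hMP.pow n).mono (pow_le_W n)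
  have hLlen : ∀ n, L n = len (W (JJ s) (n + 1)) := by
    intro n
    have h1 := hL n
    rw [hW, mlen, ← Module.coe_length, ← len_cast (hMPW (n + 1))] at h1
    exact_mod_cast h1.symm
  have hSU : SU s := by
    refine ⟨hd, hq, hMP, ?_⟩
    obtain ⟨C, n0, h⟩ := hilb_step hd L e hpoly
    refine ⟨C, n0 + 1, fun n hn => ?_⟩
    obtain ⟨m, rfl⟩ : ∃ m, n = m + 1 := ⟨n - 1, by omega⟩
    have := h m (by omega)
    rwa [hLlen, hLlen] at this
  obtain ⟨c, hc⟩ := W_le_pow hSU hAU hJm _ hs0 hreg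
  have hle : ((len (JJ s) : ℕ) : ℤ) ≤ e 0 := by
    refine hilb_e0 hd L e hpoly (len (JJ s)) c fun n => ?_
    rw [← len_pow hq hMP, hLlen]
    exact len_mono (hMPW _) ((W_anti (by omega)).trans (hc n))
  have hm : Mult1 s := by
    intro k k' n1 hcon
    refine hilb_contra hd L e hpoly he1 (len (JJ s)) k k' n1 hle fun n hn => ?_
    rw [hLlen, hLlen, ← len_pow hq hMP, zero_add, ← len_mul hq hMP n _ (hMPW 1) JJ_le_W1]
    exact hcon n hn
  -- a nonzero element of lowest degree
  have hex : ∃ k, ¬ W (JJ s) (k + 1) ≤ TT s k := by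
    by_contra hcon
    push Not at hcon
    obtain ⟨q, hq0⟩ := exists_ne (0 : submoduleQuot N₁ N₂)
    obtain ⟨⟨p, hp⟩, rfl⟩ := Submodule.Quotient.mk_surjective _ q
    apply hq0
    rw [Submodule.Quotient.mk_eq_zero]
    change p ∈ N₂
    rw [h₁] at hp
    rw [h₂]
    refine ⟨hp.1, fun n hn => ?_⟩
    have := hp.2 n hn
    rw [hW] at this
    rw [hW1]
    exact hcon n this
  have hk := Nat.find_spec hex
  have hmin : ∀ j < Nat.find hex, W (JJ s) (j + 1) ≤ TT s j := fun j hj => by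
    have := Nat.find_min hex hj
    push Not at this
    exact this
  generalize Nat.find hex = k at hk hmin
  obtain ⟨y, hy, hyT⟩ := SetLike.not_le_iff_exists.1 hk
  have hk1 : 1 ≤ k := by
    by_contra h0
    obtain rfl : k = 0 := by omega
    apply hyT
    rw [TT, pow_zero, one_mul]
    exact hy
  have hiso := sally_iso (J := JJ s) (m := maximalIdeal R) (fun n => W (JJ s) (n + 1)) (TT s) N₁ N₂
    (fun p => by rw [h₁]; simp only [hW])
    (fun p => by rw [h₂]; simp only [hW1]; rfl) k hk1 y hy (fun l _ hl => hmin l hl)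
    (fun l hl y' hy' => sally_gen hq hMP hm hy hyT hmin hl hy')
    (fun n c hc => sally_ann hq hMP hm hy hyT hc)
  refine ⟨hiso, ?_⟩
  obtain ⟨E⟩ := hiso
  exact rdepth_fiber hq hJm MJ hMJ _ E
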